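/- arXiv:2304.13196 — 2 statements merged into one kernel-verified Lean document; each statement's English description precedes it below -/
import Mathlib

section
/- Let g ≥ 2, let r be an odd prime, and let 𝒪 ⊆ π₁Σ_g ∖ {1} be a subset that is contained in the union of finitely many orbits of the natural action of Aut(π₁Σ_g) on π₁Σ_g. Then there exists a finite-index normal subgroup R of π₁Σ_g whose index is a power of r and such that H₁^𝒪(R;ℚ) is a proper ℚ-subspace of H₁(R;ℚ) = Abelianization(R) ⊗_ℤ ℚ. -/
open scoped TensorProduct


/-- Images in `H₁(R;ℚ) = ℚ ⊗ Abelianization R` of powers `x^m ∈ R` of elements `x ∈ O`. -/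
def elevationImages {π : Type} [Group π] (R : Subgroup π) (O : Set π) :
    Set (ℚ ⊗[ℤ] Additive (Abelianization ↥R)) :=
  {v | ∃ x ∈ O, ∃ m : ℤ, ∃ h : x ^ m ∈ R,
    v = (1 : ℚ) ⊗ₜ[ℤ] Additive.ofMul (Abelianization.of (⟨x ^ m, h⟩ : ↥R))}

/-- The `O`-homology `H₁^O(R;ℚ)`: the ℚ-span of the images of elevations of elements of `O`. -/
def OHomology {π : Type} [Group π] (R : Subgroup π) (O : Set π) :
    Submodule ℚ (ℚ ⊗[ℤ] Additive (Abelianization ↥R)) :=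
  Submodule.span ℚ (elevationImages R O)

/-- The surface relator `[x₁,y₁]⋯[x_g,y_g]`, with `xᵢ = (i, false)`, `yᵢ = (i, true)`. -/
def surfaceRelator (g : ℕ) : FreeGroup (Fin g × Bool) :=
  (List.ofFn fun i : Fin g =>
    FreeGroup.of (i, false) * FreeGroup.of (i, true) *
      (FreeGroup.of (i, false))⁻¹ * (FreeGroup.of (i, true))⁻¹).prod

/-- The genus-`g` surface group. -/
def SurfaceGroup (g : ℕ) : Type :=
  PresentedGroup {surfaceRelator g}

instance (g : ℕ) : Group (SurfaceGroup g) :=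
  inferInstanceAs (Group (PresentedGroup _))

/-- The standard generators of the surface group. -/
def surfaceGen (g : ℕ) (i : Fin g × Bool) : SurfaceGroup g :=
  PresentedGroup.of i

lemma lift_surfaceRelator {G : Type} [CommGroup G] (g : ℕ) (f : Fin g × Bool → G) :
    FreeGroup.lift f (surfaceRelator g) = 1 := by
  rw [surfaceRelator, map_list_prod]
  refine List.prod_eq_one ?_
  intro x hx
  simp only [List.map_ofFn, List.mem_ofFn, Function.comp] at hx
  obtain ⟨i, rfl⟩ := hx
  simp [mul_comm, mul_assoc, mul_left_comm]

/-- The mod-`d` abelianization of the free group on `m` generators. -/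
def freeModAb (m d : ℕ) : FreeGroup (Fin m) →* Multiplicative (Fin m → ZMod d) :=
  FreeGroup.lift fun i => Multiplicative.ofAdd (Pi.single i (1 : ZMod d))

/-- The mod-`d` abelianization of the genus-`g` surface group. -/
def surfaceModAb (g d : ℕ) : SurfaceGroup g →* Multiplicative (Fin g × Bool → ZMod d) :=
  PresentedGroup.toGroup
    (f := fun i => Multiplicative.ofAdd (Pi.single i (1 : ZMod d)))
    (by intro r hr
        rw [Set.mem_singleton_iff] at hr
        subst hr
        exact lift_surfaceRelator _ _)

set_option autoImplicit false
namespace SurfOrb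

/-- commutator of a pair -/
def cm {G : Type} [Group G] (p : G × G) : G := p.1 * p.2 * p.1⁻¹ * p.2⁻¹

/-- product of commutators of a list of pairs -/
def PP {G : Type} [Group G] (l : List (G × G)) : G := (l.map cm).prod

/-- map a hom over a list of pairs -/
def mp {G H : Type} [Group G] [Group H] (f : G →* H) (l : List (G × G)) : List (H × H) :=
  l.map (Prod.map f f)

/-- elements occurring in a list of pairs -/
def gens {G : Type} (l : List (G × G)) : Set G := {x | ∃ p ∈ l, x = p.1 ∨ x = p.2}

section basics
variable {G H K : Type} [Group G] [Group H] [Group K]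

@[simp] lemma PP_nil : PP ([] : List (G × G)) = 1 := rfl
@[simp] lemma PP_cons (p : G × G) (l : List (G × G)) : PP (p :: l) = cm p * PP l := by simp [PP]
@[simp] lemma PP_append (l l' : List (G × G)) : PP (l ++ l') = PP l * PP l' := by simp [PP]
@[simp] lemma mp_nil (f : G →* H) : mp f [] = [] := rfl
@[simp] lemma mp_cons (f : G →* H) (p : G × G) (l : List (G × G)) :
    mp f (p :: l) = (f p.1, f p.2) :: mp f l := rfl
@[simp] lemma mp_length (f : G →* H) (l : List (G × G)) : (mp f l).length = l.length := by
  simp [mp]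
lemma mp_mp (f : G →* H) (k : H →* K) (l : List (G × G)) : mp k (mp f l) = mp (k.comp f) l := by
  simp [mp, Function.comp_def]
lemma cm_map (f : G →* H) (p : G × G) : cm (f p.1, f p.2) = f (cm p) := by simp [cm]
lemma PP_mp (f : G →* H) (l : List (G × G)) : PP (mp f l) = f (PP l) := by
  induction l with
  | nil => simp
  | cons p l ih => simp [ih, cm_map]

lemma mp_congr_of_closure {f f' : G →* H} {l : List (G × G)} (h : mp f l = mp f' l)
    {x : G} (hx : x ∈ Subgroup.closure (gens l)) : f x = f' x := by
  have : Set.EqOn f f' (gens l) := by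
    rintro x ⟨p, hp, hx⟩
    have h2 := (List.map_inj_left.1 h) p hp
    rw [Prod.ext_iff] at h2
    rcases hx with rfl | rfl
    · exact h2.1
    · exact h2.2
  exact MonoidHom.eqOn_closure this hx

lemma exists_lift_list (S : Subgroup G) (l : List (G × G)) (h : ∀ x ∈ gens l, x ∈ S) :
    ∃ l' : List (S × S), mp S.subtype l' = l := by
  induction l with
  | nil => exact ⟨[], rfl⟩
  | cons p l ih =>
    obtain ⟨l', hl'⟩ := ih (fun x ⟨q, hq, hx⟩ => h x ⟨q, List.mem_cons_of_mem _ hq, hx⟩)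
    exact ⟨(⟨p.1, h _ ⟨p, by simp, Or.inl rfl⟩⟩, ⟨p.2, h _ ⟨p, by simp, Or.inr rfl⟩⟩) :: l',
      by simp [hl']⟩

lemma gens_mp_subtype (S : Subgroup G) (l : List (S × S)) :
    ∀ x ∈ gens (mp S.subtype l), x ∈ S := by
  rintro x ⟨p, hp, hx⟩
  obtain ⟨q, hq, rfl⟩ := List.mem_map.1 hp
  rcases hx with rfl | rfl
  · exact q.1.2
  · exact q.2.2
end basics

/-- `G` is a surface group with standard generating list `l`. -/
structure Marked {G : Type} [Group G] (l : List (G × G)) : Prop where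
  rel : PP l = 1
  gen : Subgroup.closure (gens l) = ⊤
  lift : ∀ (H : Type) [Group H] (l' : List (H × H)), l'.length = l.length → PP l' = 1 →
    ∃ f : G →* H, mp f l = l'

lemma Marked.ext {G H : Type} [Group G] [Group H] {l : List (G × G)} (h : Marked l)
    {f f' : G →* H} (e : mp f l = mp f' l) : f = f' :=
  MonoidHom.ext fun x => mp_congr_of_closure e (by rw [h.gen]; trivial)

/-- moves -/
structure Mv where
  T : ∀ {H : Type} [Group H], List (H × H) → List (H × H)
  S : ∀ {H : Type} [Group H], List (H × H) → List (H × H)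
  TS : ∀ {H : Type} [Group H] (l : List (H × H)), T (S l) = l
  ST : ∀ {H : Type} [Group H] (l : List (H × H)), S (T l) = l
  len : ∀ {H : Type} [Group H] (l : List (H × H)), (T l).length = l.length
  nat : ∀ {H K : Type} [Group H] [Group K] (f : H →* K) (l : List (H × H)),
    T (mp f l) = mp f (T l)
  pp : ∀ {H : Type} [Group H] (l : List (H × H)), PP (T l) = PP l

def Mv.inv (m : Mv) : Mv where
  T := m.S
  S := m.T
  TS := m.ST
  ST := m.TS
  len l := by rw [← m.len, m.TS]
  nat f l := by
    conv_lhs => rw [← m.TS l, ← m.nat, m.ST]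
  pp l := by rw [← m.pp, m.TS]

def Mv.comp (m n : Mv) : Mv where
  T l := m.T (n.T l)
  S l := n.S (m.S l)
  TS l := by rw [n.TS, m.TS]
  ST l := by rw [m.ST, n.ST]
  len l := by rw [m.len, n.len]
  nat f l := by rw [n.nat, m.nat]
  pp l := by rw [m.pp, n.pp]

def Mv.one : Mv where
  T l := l
  S l := l
  TS _ := rfl
  ST _ := rfl
  len _ := rfl
  nat _ _ := rfl
  pp _ := rfl

def Mv.cons (m : Mv) : Mv where
  T l := match l with
    | [] => []
    | p :: l => p :: m.T l
  S l := match l with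
    | [] => []
    | p :: l => p :: m.S l
  TS l := by cases l <;> simp [m.TS]
  ST l := by cases l <;> simp [m.ST]
  len l := by cases l <;> simp [m.len]
  nat f l := by cases l <;> simp [m.nat]
  pp l := by cases l <;> simp [m.pp]

def Mv.A (k : ℤ) : Mv where
  T l := match l with
    | [] => []
    | p :: l => (p.1 * p.2 ^ k, p.2) :: l
  S l := match l with
    | [] => []
    | p :: l => (p.1 * p.2 ^ (-k), p.2) :: l
  TS l := by cases l <;> simp
  ST l := by cases l <;> simp
  len l := by cases l <;> simp
  nat f l := by cases l <;> simp
  pp l := by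
    cases l
    · simp
    · simp only [PP_cons, cm]; group

def Mv.B (k : ℤ) : Mv where
  T l := match l with
    | [] => []
    | p :: l => (p.1, p.2 * p.1 ^ k) :: l
  S l := match l with
    | [] => []
    | p :: l => (p.1, p.2 * p.1 ^ (-k)) :: l
  TS l := by cases l <;> simp
  ST l := by cases l <;> simp
  len l := by cases l <;> simp
  nat f l := by cases l <;> simp
  pp l := by
    cases l
    · simp
    · simp only [PP_cons, cm]; group

/-- the curve joining two handles -/
def gam {H : Type} [Group H] (p q : H × H) : H := p.2⁻¹ * q.1 * q.2 * q.1⁻¹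

def Mv.C : Mv where
  T l := match l with
    | [] => []
    | [p] => [p]
    | p :: q :: l => (p.1 * (gam p q)⁻¹, gam p q * p.2 * (gam p q)⁻¹) ::
        (gam p q * q.1, q.2) :: l
  S l := match l with
    | [] => []
    | [p] => [p]
    | p :: q :: l => (p.1 * (gam p q), (gam p q)⁻¹ * p.2 * (gam p q)) ::
        ((gam p q)⁻¹ * q.1, q.2) :: l
  TS l := by
    rcases l with _ | ⟨p, _ | ⟨q, l⟩⟩
    · rfl
    · rfl
    · simp only [gam, List.cons.injEq, Prod.ext_iff, and_true]
      refine ⟨⟨?_, ?_⟩, ?_⟩ <;> group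
  ST l := by
    rcases l with _ | ⟨p, _ | ⟨q, l⟩⟩
    · rfl
    · rfl
    · simp only [gam, List.cons.injEq, Prod.ext_iff, and_true]
      refine ⟨⟨?_, ?_⟩, ?_⟩ <;> group
  len l := by rcases l with _ | ⟨p, _ | ⟨q, l⟩⟩ <;> simp
  nat f l := by rcases l with _ | ⟨p, _ | ⟨q, l⟩⟩ <;> simp [gam]
  pp l := by
    rcases l with _ | ⟨p, _ | ⟨q, l⟩⟩
    · rfl
    · rfl
    · simp only [PP_cons, cm, gam]; group

lemma Mv.gens_sub (m : Mv) {G : Type} [Group G] (l : List (G × G)) :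
    ∀ x ∈ gens (m.T l), x ∈ Subgroup.closure (gens l) := by
  obtain ⟨l', hl'⟩ := exists_lift_list (Subgroup.closure (gens l)) l
    (fun x hx => Subgroup.subset_closure hx)
  have := gens_mp_subtype _ (m.T l')
  rwa [← m.nat, hl'] at this

lemma Marked.move {G : Type} [Group G] {l : List (G × G)} (h : Marked l) (m : Mv) :
    Marked (m.T l) where
  rel := by rw [m.pp, h.rel]
  gen := by
    rw [eq_top_iff, ← h.gen, Subgroup.closure_le]
    have := m.inv.gens_sub (m.T l)
    have e : m.inv.T (m.T l) = l := m.ST l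
    rw [e] at this
    exact this
  lift H _ l' hl hp := by
    obtain ⟨f, hf⟩ := h.lift H (m.S l') (by rw [← m.len l, ← hl]; exact m.inv.len l')
      ((m.inv.pp l').trans hp)
    exact ⟨f, by rw [← m.nat, hf, m.TS]⟩

section norm
variable {r : ℕ} [Fact r.Prime]

/-- reachability of lists by moves -/
def Reach {H : Type} [Group H] (l l' : List (H × H)) : Prop := ∃ m : Mv, m.T l = l'

section
variable {H : Type} [Group H]
lemma Reach.refl (l : List (H × H)) : Reach l l := ⟨Mv.one, rfl⟩
lemma Reach.trans {l l' l'' : List (H × H)} : Reach l l' → Reach l' l'' → Reach l l'' :=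
  fun ⟨m, hm⟩ ⟨n, hn⟩ => ⟨n.comp m, by rw [← hn, ← hm]; rfl⟩
lemma Reach.symm {l l' : List (H × H)} : Reach l l' → Reach l' l :=
  fun ⟨m, hm⟩ => ⟨m.inv, by rw [← hm]; exact m.ST l⟩
lemma Reach.cons {l l' : List (H × H)} (p : H × H) : Reach l l' → Reach (p :: l) (p :: l') :=
  fun ⟨m, hm⟩ => ⟨m.cons, by rw [← hm]; rfl⟩
end

abbrev MZ (r : ℕ) := Multiplicative (ZMod r)

open Multiplicative in
lemma reachA (x y k : ZMod r) (l : List (MZ r × MZ r)) :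
    Reach ((ofAdd x, ofAdd y) :: l) ((ofAdd (x + k * y), ofAdd y) :: l) := by
  refine ⟨Mv.A (k.val : ℤ), ?_⟩
  have e : (ofAdd y : MZ r) ^ (k.val : ℤ) = ofAdd (k * y) := by
    rw [zpow_natCast, ← ofAdd_nsmul, nsmul_eq_mul, ZMod.natCast_zmod_val]
  simp only [Mv.A, e, ← ofAdd_add]

open Multiplicative in
lemma reachB (x y k : ZMod r) (l : List (MZ r × MZ r)) :
    Reach ((ofAdd x, ofAdd y) :: l) ((ofAdd x, ofAdd (y + k * x)) :: l) := by
  refine ⟨Mv.B (k.val : ℤ), ?_⟩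
  have e : (ofAdd x : MZ r) ^ (k.val : ℤ) = ofAdd (k * x) := by
    rw [zpow_natCast, ← ofAdd_nsmul, nsmul_eq_mul, ZMod.natCast_zmod_val]
  simp only [Mv.B, e, ← ofAdd_add]

open Multiplicative in
lemma reachC (x y z w : ZMod r) (l : List (MZ r × MZ r)) :
    Reach ((ofAdd x, ofAdd y) :: (ofAdd z, ofAdd w) :: l)
      ((ofAdd (x - (w - y)), ofAdd y) :: (ofAdd (z + (w - y)), ofAdd w) :: l) := by
  refine ⟨Mv.C, ?_⟩
  simp only [Mv.C, gam, ← ofAdd_add, ← ofAdd_neg, List.cons.injEq, Prod.mk.injEq,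
    EmbeddingLike.apply_eq_iff_eq, and_true]
  refine ⟨⟨?_, ?_⟩, ?_⟩ <;> ring

open Multiplicative in
lemma reach01 (x y : ZMod r) (h : x ≠ 0 ∨ y ≠ 0) (l : List (MZ r × MZ r)) :
    Reach ((ofAdd x, ofAdd y) :: l) ((ofAdd 0, ofAdd 1) :: l) := by
  have key : ∀ x y : ZMod r, x ≠ 0 →
      Reach ((ofAdd x, ofAdd y) :: l) ((ofAdd 0, ofAdd 1) :: l) := by
    intro x y hx
    have h1 := reachB x y ((1 - y) / x) l
    have h2 := reachA x 1 (-x) l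
    rw [div_mul_cancel₀ _ hx, add_sub_cancel] at h1
    rw [mul_one, add_neg_cancel] at h2
    exact h1.trans h2
  by_cases hx : x = 0
  · subst hx
    have hy : y ≠ 0 := by simpa using h
    refine (reachA 0 y (1 / y) l).trans (key _ _ ?_)
    rw [zero_add, div_mul_cancel₀ _ hy]
    exact one_ne_zero
  · exact key x y hx

open Multiplicative in
lemma reach_any {x y z w : ZMod r} (h : x ≠ 0 ∨ y ≠ 0) (h' : z ≠ 0 ∨ w ≠ 0)
    (l : List (MZ r × MZ r)) :
    Reach ((ofAdd x, ofAdd y) :: l) ((ofAdd z, ofAdd w) :: l) :=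
  (reach01 x y h l).trans (reach01 z w h' l).symm

open Multiplicative in
lemma reach_elim {x y z w : ZMod r} (h : x ≠ 0 ∨ y ≠ 0) (h' : z ≠ 0 ∨ w ≠ 0)
    (l : List (MZ r × MZ r)) :
    Reach ((ofAdd x, ofAdd y) :: (ofAdd z, ofAdd w) :: l)
      ((ofAdd 1, ofAdd 0) :: (ofAdd 0, ofAdd 0) :: l) := by
  have h1 := reach_any (z := 0) (w := 1) h (by simp) ((ofAdd z, ofAdd w) :: l)
  have h2 := (reach_any (z := 1) (w := 0) h' (by simp) l).cons (ofAdd (0 : ZMod r), ofAdd (1 : ZMod r))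
  have h3 := reachC (0 : ZMod r) 1 1 0 l
  have e1 : (0 : ZMod r) - (0 - 1) = 1 := by ring
  have e2 : (1 : ZMod r) + (0 - 1) = 0 := by ring
  rw [e1, e2] at h3
  have h4 := reach_any (x := (1 : ZMod r)) (y := 1) (z := 1) (w := 0) (by simp) (by simp)
    ((ofAdd 0, ofAdd 0) :: l)
  exact h1.trans (h2.trans (h3.trans h4))

open Multiplicative in
lemma reach_norm (l : List (MZ r × MZ r)) (h : ∃ p ∈ l, p ≠ (1, 1)) :
    Reach l ((ofAdd 1, 1) :: List.replicate (l.length - 1) (1, 1)) := by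
  induction l with
  | nil => simp at h
  | cons p l ih =>
    obtain ⟨x, y⟩ := p
    by_cases hl : ∃ p ∈ l, p ≠ (1, 1)
    · have h0 := (ih hl).cons (x, y)
      obtain ⟨q, l0, rfl⟩ : ∃ q l0, l = q :: l0 := by
        cases l with
        | nil => simp at hl
        | cons q l0 => exact ⟨q, l0, rfl⟩
      refine h0.trans ?_
      simp only [List.length_cons, Nat.add_sub_cancel]
      set R := List.replicate l0.length ((1 : MZ r), (1 : MZ r)) with hR
      by_cases hp : x = ofAdd 0 ∧ y = ofAdd 0
      · obtain ⟨rfl, rfl⟩ := hp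
        have h2 := (reach_any (x := (1 : ZMod r)) (y := 0) (z := 0) (w := 1) (by simp) (by simp)
          R).cons (ofAdd (0 : ZMod r), ofAdd (0 : ZMod r))
        have h3 := reachC (0 : ZMod r) 0 0 1 R
        have h4 := reach_elim (x := (0 : ZMod r) - (1 - 0)) (y := 0) (z := 0 + (1 - 0)) (w := 1)
          (by simp) (by simp) R
        exact h2.trans (h3.trans h4)
      · refine (reach_elim (x := x.toAdd) (y := y.toAdd) (z := 1) (w := 0) ?_ (by simp) R)
        by_contra hh
        push Not at hh
        exact hp hh
    · push Not at hl
      have e : l = List.replicate l.length (1, 1) := List.eq_replicate_iff.2 ⟨rfl, hl⟩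
      obtain ⟨p, hp, hp1⟩ := h
      have : (x, y) ≠ (1, 1) := by
        rcases List.mem_cons.1 hp with rfl | hp
        · exact hp1
        · exact absurd (hl p hp) hp1
      rw [List.length_cons, Nat.add_sub_cancel, ← e]
      refine reach_any (x := x.toAdd) (y := y.toAdd) (z := 1) (w := 0) ?_ (by simp) l
      by_contra hh
      push Not at hh
      exact this (Prod.ext hh.1 hh.2)

open Multiplicative in
/-- Any nonzero class mod `r` can be moved to the standard one. -/
lemma Marked.normalize {G : Type} [Group G] {l : List (G × G)} (h : Marked l)
    (f : G →* MZ r) (hf : f ≠ 1) :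
    ∃ l' : List (G × G), Marked l' ∧ l'.length = l.length ∧
      mp f l' = (ofAdd 1, 1) :: List.replicate (l.length - 1) (1, 1) := by
  have : ∃ p ∈ mp f l, p ≠ (1, 1) := by
    by_contra hh
    push Not at hh
    apply hf
    apply h.ext
    apply List.map_inj_left.2
    intro p hp
    exact hh _ (List.mem_map_of_mem hp)
  obtain ⟨m, hm⟩ := reach_norm _ this
  refine ⟨m.T l, h.move m, m.len l, ?_⟩
  rw [← m.nat, hm, mp_length]
end norm

lemma marked_surface (g : ℕ) :
    Marked (List.ofFn fun i : Fin g => (surfaceGen g (i, false), surfaceGen g (i, true))) where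
  rel := by
    have : (PresentedGroup.mk {surfaceRelator g}) (surfaceRelator g) = 1 :=
      PresentedGroup.one_of_mem rfl
    rw [surfaceRelator, map_list_prod, List.map_ofFn] at this
    rw [PP, List.map_ofFn]
    exact this
  gen := by
    have := PresentedGroup.closure_range_of {surfaceRelator g}
    rw [eq_top_iff]
    refine this.ge.trans (Subgroup.closure_mono ?_)
    rintro _ ⟨⟨i, b⟩, rfl⟩
    refine ⟨(surfaceGen g (i, false), surfaceGen g (i, true)), ?_, ?_⟩
    · rw [List.mem_ofFn]; exact ⟨i, rfl⟩
    · cases b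
      · exact Or.inl rfl
      · exact Or.inr rfl
  lift H _ l' hl hp := by
    rw [List.length_ofFn] at hl
    subst hl
    let F : Fin l'.length × Bool → H := fun q => if q.2 then (l'.get q.1).2 else (l'.get q.1).1
    have hF : ∀ x ∈ ({surfaceRelator l'.length} : Set _), FreeGroup.lift F x = 1 := by
      rintro x rfl
      rw [surfaceRelator, map_list_prod, List.map_ofFn, ← hp, PP]
      congr 1
      conv_rhs => rw [← List.ofFn_get l', List.map_ofFn]
      congr 1
      funext i
      simp [F, cm]
    obtain ⟨f, e⟩ : ∃ f : SurfaceGroup l'.length →* H, ∀ q, f (surfaceGen _ q) = F q :=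
      ⟨PresentedGroup.toGroup hF, fun q => PresentedGroup.toGroup.of hF⟩
    refine ⟨f, ?_⟩
    conv_rhs => rw [← List.ofFn_get l']
    rw [mp, List.map_ofFn]
    congr 1
    funext i
    refine Prod.ext ?_ ?_
    · exact (e (i, false)).trans (by simp [F])
    · exact (e (i, true)).trans (by simp [F])

end SurfOrb

set_option autoImplicit false
namespace SurfOrb

lemma exists_blocks {X : Type} [Nonempty X] (m n : ℕ) (L : List X) (hL : L.length = n * m) :
    ∃ w : ℕ → Fin m → X, L = (List.range n).flatMap (fun j => List.ofFn (w j)) := by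
  induction n generalizing L with
  | zero =>
    have : L = [] := List.eq_nil_of_length_eq_zero (by simpa using hL)
    subst this
    exact ⟨fun _ _ => Classical.arbitrary X, rfl⟩
  | succ n ih =>
    obtain ⟨w, hw⟩ := ih (L.take (n * m)) (by rw [List.length_take, hL]; apply min_eq_left; nlinarith)
    have hd : (L.drop (n * m)).length = m := by
      rw [List.length_drop, hL, Nat.succ_mul]; omega
    refine ⟨Function.update w n (fun i => (L.drop (n * m)).get (i.cast hd.symm)), ?_⟩
    rw [List.range_succ, List.flatMap_append]
    conv_lhs => rw [← List.take_append_drop (n * m) L]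
    congr 1
    · rw [hw]
      apply List.flatMap_congr
      intro j hj
      rw [Function.update_of_ne]
      exact (List.mem_range.1 hj).ne
    · simp only [List.flatMap_cons, List.flatMap_nil, List.append_nil, Function.update_self]
      generalize L.drop (n * m) = D at hd
      subst hd
      exact (List.ofFn_get D).symm

section wreath
variable {H : Type} [Group H] (n : ℕ)

/-- shift action -/
def shiftHom : MZ n →* MulAut (ZMod n → H) where
  toFun k :=
    { toFun := fun ψ j => ψ (j + k.toAdd)
      invFun := fun ψ j => ψ (j - k.toAdd)
      left_inv := fun ψ => by funext j; simp
      right_inv := fun ψ => by funext j; simp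
      map_mul' := fun _ _ => rfl }
  map_one' := by ext ψ j; simp
  map_mul' k k' := by ext ψ j; simp [add_assoc]

abbrev Wr (H : Type) [Group H] (n : ℕ) := SemidirectProduct (ZMod n → H) (MZ n) (shiftHom n)

lemma wr_mul_left (x y : Wr H n) (j : ZMod n) :
    (x * y).left j = x.left j * y.left (j + x.right.toAdd) := rfl

lemma wr_conj (x : Wr H n) (ψ : ZMod n → H) (j : ZMod n) :
    (x * SemidirectProduct.inl ψ * x⁻¹).left j =
      x.left j * ψ (j + x.right.toAdd) * (x.left j)⁻¹ := by
  have : x * SemidirectProduct.inl ψ * x⁻¹ =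
      SemidirectProduct.inl (fun j => x.left j * ψ (j + x.right.toAdd) * (x.left j)⁻¹) := by
    rw [mul_inv_eq_iff_eq_mul]
    apply SemidirectProduct.ext
    · funext j
      simp [wr_mul_left]
    · simp
  rw [this]; rfl

end wreath

section RS
open Multiplicative
variable {G : Type} [Group G] {n m : ℕ} [NeZero n] {a b : G} {z : Fin m → G × G}

/-- The induced marking on a cyclic cover. -/
def coverList (K : Subgroup G) [K.Normal] (a : G) (n : ℕ) (t b : K) (zK : List (K × K)) :
    List (K × K) :=
  (t, b) :: (List.range n).flatMap
    (fun j => mp (MulAut.conjNormal (H := K) (a ^ j)).toMonoidHom zK)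

lemma coverList_rel_aux (a R : G) (k : ℕ) :
    ((List.range k).map (fun j => a ^ j * R * (a ^ j)⁻¹)).prod = (R * a) ^ k * (a ^ k)⁻¹ := by
  induction k with
  | zero => simp
  | succ k ih =>
    rw [List.prod_range_succ, ih, pow_succ (R * a), pow_succ a]
    group

lemma PP_flatMap {X : Type} {H : Type} [Group H] (l : List X) (F : X → List (H × H)) :
    PP (l.flatMap F) = (l.map (fun x => PP (F x))).prod := by
  induction l with
  | nil => simp
  | cons x l ih => simp [ih]

lemma mp_flatMap {X : Type} {H L : Type} [Group H] [Group L] (f : H →* L)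
    (l : List X) (F : X → List (H × H)) :
    mp f (l.flatMap F) = l.flatMap (fun x => mp f (F x)) := by
  simp [mp, List.map_flatMap]

/-- wreath element of the `a` generator -/
def wrA {H : Type} [Group H] (n : ℕ) (t : H) : Wr H n :=
  ⟨fun j => if j.val + 1 = n then t else 1, ofAdd 1⟩

lemma wrA_pow {H : Type} [Group H] (t : H) (k : ℕ) (hk : k ≤ n) :
    ((wrA n t) ^ k).left 0 = (if k = n then t else 1) ∧
      ((wrA n t) ^ k).right = ofAdd (k : ZMod n) := by
  induction k with
  | zero => 
    have : (0 : ℕ) ≠ n := (NeZero.ne n).symm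
    simp [this]
  | succ k ih =>
    obtain ⟨h1, h2⟩ := ih (by omega)
    rw [pow_succ, wr_mul_left, h1, h2]
    refine ⟨?_, ?_⟩
    · have : ((k : ZMod n)).val = k := ZMod.val_cast_of_lt (by omega)
      have hk' : k ≠ n := by omega
      simp [wrA, this, hk']
    · rw [SemidirectProduct.mul_right, h2]
      simp [wrA, ← ofAdd_add]

/-- the `b` translates -/
def bseq {H : Type} [Group H] (R : ℕ → H) (b : H) : ℕ → H
  | 0 => b
  | k + 1 => (R k)⁻¹ * bseq R b k

lemma bseq_eq {H : Type} [Group H] (R : ℕ → H) (b : H) (k : ℕ) :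
    bseq R b k = (((List.range k).map R).prod)⁻¹ * b := by
  induction k with
  | zero => simp [bseq]
  | succ k ih => rw [bseq, ih, List.prod_range_succ]; group

lemma PP_pi {X H : Type} [Group H] (l : List ((X → H) × (X → H))) (x : X) :
    PP l x = PP (mp (Pi.evalMonoidHom (fun _ : X => H) x) l) := by
  rw [PP_mp]; rfl

lemma mp_ofFn {H L : Type} [Group H] [Group L] (f : H →* L) (w : Fin m → H × H) :
    mp f (List.ofFn w) = List.ofFn (fun i => (f (w i).1, f (w i).2)) := by
  rw [mp, List.map_ofFn]; rfl

theorem coverMarked (hm : Marked ((a, b) :: List.ofFn z)) (f : G →* MZ n)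
    (fa : f a = ofAdd 1) (fb : f b = 1) (fz : ∀ i, f (z i).1 = 1 ∧ f (z i).2 = 1)
    (t bK : f.ker) (zK : List (f.ker × f.ker)) (ht : (t : G) = a ^ n) (hb : (bK : G) = b)
    (hz : mp f.ker.subtype zK = List.ofFn z) :
    Marked (coverList f.ker a n t bK zK) := by
  have hR0 : PP (List.ofFn z) = b * a * b⁻¹ * a⁻¹ := by
    have := hm.rel
    rw [PP_cons, cm, mul_eq_one_iff_eq_inv'] at this
    rw [this]; group
  have hlen : zK.length = m := by rw [← mp_length f.ker.subtype, hz, List.length_ofFn]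
  obtain ⟨zF, rfl⟩ : ∃ zF : Fin m → f.ker × f.ker, zK = List.ofFn zF := by
    subst hlen; exact ⟨zK.get, (List.ofFn_get zK).symm⟩
  have hzF : ∀ i, (((zF i).1 : G), ((zF i).2 : G)) = z i := by
    rw [mp_ofFn] at hz
    intro i
    exact congrFun (List.ofFn_injective hz) i
  refine ⟨?_, ?_, ?_⟩
  · apply f.ker.subtype_injective
    rw [coverList, PP_cons, PP_flatMap]
    simp only [PP_mp]
    rw [map_mul, map_list_prod, List.map_map]
    have e : (f.ker.subtype ∘ fun j : ℕ => (MulAut.conjNormal (H := f.ker) (a ^ j)).toMonoidHom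
        (PP (List.ofFn zF))) = fun j : ℕ => a ^ j * PP (List.ofFn z) * (a ^ j)⁻¹ := by
      funext j
      simp only [Function.comp, MulEquiv.toMonoidHom_eq_coe, MonoidHom.coe_coe, Subgroup.coe_subtype,
        MulAut.conjNormal_apply]
      rw [← hz, PP_mp]
      rfl
    rw [e, coverList_rel_aux, hR0, ← cm_map]
    simp only [Subgroup.coe_subtype, ht, hb, cm]
    have : (b * a * b⁻¹ * a⁻¹ * a) ^ n = b * a ^ n * b⁻¹ := by
      rw [inv_mul_cancel_right, conj_pow]
    rw [this]
    simp only [OneMemClass.coe_one]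
    group
  · -- generation
    set C := Subgroup.closure (gens (coverList f.ker a n t bK (List.ofFn zF))) with hC
    set D := C.map f.ker.subtype with hD
    have htD : a ^ n ∈ D := by
      refine ⟨t, Subgroup.subset_closure ⟨(t, bK), ?_, Or.inl rfl⟩, ht⟩
      simp [coverList]
    have hbD : b ∈ D := by
      refine ⟨bK, Subgroup.subset_closure ⟨(t, bK), ?_, Or.inr rfl⟩, hb⟩
      simp [coverList]
    have hblk : ∀ j < n, ∀ i, (MulAut.conjNormal (H := f.ker) (a ^ j) (zF i).1 ∈ C) ∧
        (MulAut.conjNormal (H := f.ker) (a ^ j) (zF i).2 ∈ C) := by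
      intro j hj i
      have hmem : (MulAut.conjNormal (H := f.ker) (a ^ j) (zF i).1,
          MulAut.conjNormal (H := f.ker) (a ^ j) (zF i).2) ∈
          coverList f.ker a n t bK (List.ofFn zF) := by
        refine List.mem_cons_of_mem _ (List.mem_flatMap.2 ⟨j, List.mem_range.2 hj, ?_⟩)
        rw [mp_ofFn, List.mem_ofFn]
        exact ⟨i, rfl⟩
      exact ⟨Subgroup.subset_closure ⟨_, hmem, Or.inl rfl⟩,
        Subgroup.subset_closure ⟨_, hmem, Or.inr rfl⟩⟩
    have hzD : ∀ j < n, ∀ i, a ^ j * (z i).1 * (a ^ j)⁻¹ ∈ D ∧ a ^ j * (z i).2 * (a ^ j)⁻¹ ∈ D := by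
      intro j hj i
      obtain ⟨h1, h2⟩ := hblk j hj i
      rw [← hzF i]
      exact ⟨⟨_, h1, MulAut.conjNormal_apply _ _⟩, ⟨_, h2, MulAut.conjNormal_apply _ _⟩⟩
    have hz0 : ∀ i, (z i).1 ∈ D ∧ (z i).2 ∈ D := by
      intro i; simpa using hzD 0 (NeZero.pos n) i
    have hRD : PP (List.ofFn z) ∈ D := by
      obtain ⟨l', hl'⟩ := exists_lift_list D (List.ofFn z) (by
        rintro x ⟨p, hp, hx⟩
        rw [List.mem_ofFn] at hp
        obtain ⟨i, rfl⟩ := hp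
        rcases hx with rfl | rfl
        · exact (hz0 i).1
        · exact (hz0 i).2)
      rw [← hl', PP_mp]
      exact (PP l').2
    -- a conjugates D into D
    have hDcl : D = Subgroup.closure (f.ker.subtype '' gens (coverList f.ker a n t bK (List.ofFn zF))) := by
      rw [hD, hC, MonoidHom.map_closure]
    have haD : ∀ x ∈ D, a * x * a⁻¹ ∈ D := by
      have : D ≤ D.comap (MulAut.conj a).toMonoidHom := by
        conv_lhs => rw [hDcl]
        rw [Subgroup.closure_le]
        rintro _ ⟨x, ⟨p, hp, hx⟩, rfl⟩
        change a * (x : G) * a⁻¹ ∈ D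
        rcases List.mem_cons.1 hp with rfl | hp
        · rcases hx with rfl | rfl
          · rw [ht, ← pow_succ', pow_succ, mul_inv_cancel_right]; exact htD
          · rw [hb]
            have : a * b * a⁻¹ = (PP (List.ofFn z))⁻¹ * b := by rw [hR0]; group
            rw [this]
            exact D.mul_mem (D.inv_mem hRD) hbD
        · obtain ⟨j, hj, hp⟩ := List.mem_flatMap.1 hp
          rw [mp_ofFn, List.mem_ofFn] at hp
          obtain ⟨i, rfl⟩ := hp
          have hj := List.mem_range.1 hj
          have key : ∀ y : G, y ∈ D → (∀ j < n, a ^ j * y * (a ^ j)⁻¹ ∈ D) →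
              a * (a ^ j * y * (a ^ j)⁻¹) * a⁻¹ ∈ D := by
            intro y hy hyj
            have e : a * (a ^ j * y * (a ^ j)⁻¹) * a⁻¹ = a ^ (j + 1) * y * (a ^ (j + 1))⁻¹ := by
              rw [pow_succ']; group
            rw [e]
            rcases Nat.lt_or_ge (j + 1) n with h | h
            · exact hyj _ h
            · have : j + 1 = n := by omega
              rw [this]
              exact D.mul_mem (D.mul_mem htD hy) (D.inv_mem htD)
          rcases hx with rfl | rfl
          · have := key (z i).1 (hz0 i).1 (fun j hj => (hzD j hj i).1)
            rw [← hzF i] at this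
            change a * ((MulAut.conjNormal (H := f.ker) (a ^ j) (zF i).1 : f.ker) : G) * a⁻¹ ∈ D
            rw [MulAut.conjNormal_apply]
            exact this
          · have := key (z i).2 (hz0 i).2 (fun j hj => (hzD j hj i).2)
            rw [← hzF i] at this
            change a * ((MulAut.conjNormal (H := f.ker) (a ^ j) (zF i).2 : f.ker) : G) * a⁻¹ ∈ D
            rw [MulAut.conjNormal_apply]
            exact this
      exact fun x hx => this hx
    have hapD : ∀ (k : ℕ), ∀ x ∈ D, a ^ k * x * (a ^ k)⁻¹ ∈ D := by
      intro k
      induction k with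
      | zero => intro x hx; simpa using hx
      | succ k ih =>
        intro x hx
        have e : a ^ (k + 1) * x * (a ^ (k + 1))⁻¹ = a * (a ^ k * x * (a ^ k)⁻¹) * a⁻¹ := by
          rw [pow_succ']; group
        rw [e]
        exact haD _ (ih x hx)
    have haiD : ∀ x ∈ D, a⁻¹ * x * a ∈ D := by
      intro x hx
      have h1 := hapD (n - 1) x hx
      have h2 := D.mul_mem (D.mul_mem (D.inv_mem htD) h1) htD
      have e : a ^ n = a ^ (n - 1) * a := by
        rw [← pow_succ, Nat.sub_add_cancel (NeZero.pos n)]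
      rw [e] at h2
      convert h2 using 1
      group
    -- G = D <a>
    have hall : ∀ x : G, ∃ d ∈ D, ∃ k : ℤ, x = d * a ^ k := by
      have hconj : ∀ (k : ℤ), ∀ x ∈ D, a ^ k * x * (a ^ k)⁻¹ ∈ D := by
        intro k
        induction k with
        | zero => intro x hx; simpa using hx
        | succ k ih =>
          intro x hx
          have := haD _ (ih x hx)
          convert this using 1
          rw [zpow_add_one]; 
          have : a ^ (k : ℤ) * a = a * a ^ (k : ℤ) := by rw [← zpow_add_one, ← zpow_one_add, add_comm]
          rw [this]; group
        | pred k ih =>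
          intro x hx
          have := haiD _ (ih x hx)
          convert this using 1
          group
      intro x
      have hx : x ∈ Subgroup.closure (gens ((a, b) :: List.ofFn z)) := by rw [hm.gen]; trivial
      induction hx using Subgroup.closure_induction with
      | mem x hx =>
        obtain ⟨p, hp, hx⟩ := hx
        rcases List.mem_cons.1 hp with rfl | hp
        · rcases hx with rfl | rfl
          · exact ⟨1, D.one_mem, 1, by simp⟩
          · exact ⟨_, hbD, 0, by simp⟩
        · rw [List.mem_ofFn] at hp
          obtain ⟨i, rfl⟩ := hp
          rcases hx with rfl | rfl
          · exact ⟨_, (hz0 i).1, 0, by simp⟩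
          · exact ⟨_, (hz0 i).2, 0, by simp⟩
      | one => exact ⟨1, D.one_mem, 0, by simp⟩
      | mul x y _ _ hx hy =>
        obtain ⟨d, hd, k, rfl⟩ := hx
        obtain ⟨d', hd', k', rfl⟩ := hy
        refine ⟨d * (a ^ k * d' * (a ^ k)⁻¹), D.mul_mem hd (hconj k _ hd'), k + k', ?_⟩
        rw [zpow_add]; group
      | inv x _ hx =>
        obtain ⟨d, hd, k, rfl⟩ := hx
        refine ⟨a ^ (-k) * d⁻¹ * (a ^ (-k))⁻¹, hconj (-k) _ (D.inv_mem hd), -k, ?_⟩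
        group
    have hDK : D ≤ f.ker := by
      rintro _ ⟨x, _, rfl⟩; exact x.2
    rw [eq_top_iff]
    rintro x -
    obtain ⟨d, hd, k, hk⟩ := hall (x : G)
    have hx : f (x : G) = 1 := x.2
    have hfd : f d = 1 := hDK hd
    rw [hk, map_mul, hfd, one_mul, map_zpow, fa, ← ofAdd_zsmul] at hx
    have hk0 : ((k : ℤ) : ZMod n) = 0 := by
      have := congrArg toAdd hx
      simpa using this
    rw [ZMod.intCast_zmod_eq_zero_iff_dvd] at hk0
    obtain ⟨q, rfl⟩ := hk0
    have hxD : (x : G) ∈ D := by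
      rw [hk, zpow_mul, zpow_natCast]
      exact D.mul_mem hd (D.zpow_mem htD q)
    obtain ⟨y, hy, hyx⟩ := hxD
    have : y = x := Subtype.val_injective hyx
    rwa [← this]
  · -- lifting
    intro H _ l' hl' hP
    obtain ⟨p, L, rfl⟩ : ∃ p L, l' = p :: L := by
      cases l' with
      | nil => simp [coverList] at hl'
      | cons p L => exact ⟨p, L, rfl⟩
    have hL : L.length = n * m := by
      simpa [coverList, List.length_flatMap] using hl'
    obtain ⟨w, rfl⟩ := exists_blocks m n L hL
    obtain ⟨tt, bb⟩ := p
    set R : ℕ → H := fun j => PP (List.ofFn (w j)) with hR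
    rw [PP_cons, PP_flatMap] at hP
    change cm (tt, bb) * ((List.range n).map R).prod = 1 at hP
    set ZH : Fin m → (ZMod n → H) × (ZMod n → H) :=
      fun i => (fun j => (w j.val i).1, fun j => (w j.val i).2) with hZH
    set BH : ZMod n → H := fun j => bseq R bb j.val with hBH
    have hPZ : PP (List.ofFn ZH) = fun j : ZMod n => R j.val := by
      funext j
      rw [PP_pi, mp_ofFn]
      rfl
    obtain ⟨Θ, hΘ⟩ := hm.lift (Wr H n) ((wrA n tt, SemidirectProduct.inl BH) ::
      mp SemidirectProduct.inl (List.ofFn ZH)) (by simp) (by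
        rw [PP_cons, PP_mp, hPZ, cm]
        apply SemidirectProduct.ext
        · funext j
          have e1 : ∀ (x y : ZMod n → H) , (wrA n tt * SemidirectProduct.inl x * (wrA n tt)⁻¹ *
            (SemidirectProduct.inl y)⁻¹ * SemidirectProduct.inl (fun j : ZMod n => R j.val) : Wr H n).left j
            = (wrA n tt * SemidirectProduct.inl x * (wrA n tt)⁻¹ : Wr H n).left j * (y j)⁻¹ * R j.val := by
            intro x y
            have e2 : (wrA n tt * SemidirectProduct.inl x * (wrA n tt)⁻¹ : Wr H n).right = 1 := by simp
            have e3 : (wrA n tt * SemidirectProduct.inl x * (wrA n tt)⁻¹ * SemidirectProduct.inl y⁻¹ :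
                Wr H n).right = 1 := by
              rw [SemidirectProduct.mul_right, e2]; simp
            rw [← map_inv, wr_mul_left, wr_mul_left, e3, e2]
            simp
          rw [e1, wr_conj]
          have hj : j.val < n := ZMod.val_lt j
          have hv : (j + 1).val = (j.val + 1) % n := by
            rw [ZMod.val_add, ZMod.val_one_eq_one_mod, Nat.add_mod_mod]
          change (if j.val + 1 = n then tt else 1) * BH (j + 1) * (if j.val + 1 = n then tt else 1)⁻¹ *
            (BH j)⁻¹ * R j.val = 1
          by_cases hjn : j.val + 1 = n
          · rw [if_pos hjn]
            have h0 : BH (j + 1) = bb := by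
              simp only [hBH, hv, hjn, Nat.mod_self]; rfl
            have h1 : BH j = R j.val * ((((List.range n).map R).prod)⁻¹ * bb) := by
              have h3 : ∀ k, j.val + 1 = k → bseq R bb k = (R j.val)⁻¹ * bseq R bb j.val := by
                rintro _ rfl; rfl
              rw [← bseq_eq, h3 n hjn]; simp [hBH]
            rw [h0, h1]
            have h2 : (((List.range n).map R).prod)⁻¹ = tt * bb * tt⁻¹ * bb⁻¹ := by
              rw [mul_eq_one_iff_eq_inv] at hP
              rw [← hP, cm]
            rw [h2]; group
          · rw [if_neg hjn]
            have h0 : BH (j + 1) = (R j.val)⁻¹ * BH j := by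
              simp only [hBH, hv, Nat.mod_eq_of_lt (show j.val + 1 < n by omega)]; rfl
            rw [h0]; group
        · simp)
    rw [mp_cons, mp_ofFn, mp_ofFn] at hΘ
    simp only [List.cons.injEq, Prod.mk.injEq] at hΘ
    obtain ⟨⟨hΘa, hΘb⟩, hΘz⟩ := hΘ
    have hΘz := fun i => congrFun (List.ofFn_injective hΘz) i
    simp only [Prod.mk.injEq] at hΘz
    have hright : SemidirectProduct.rightHom.comp Θ = f := by
      apply hm.ext
      simp only [mp_cons, mp_ofFn, MonoidHom.comp_apply, hΘa, hΘb, fa, fb, (hΘz _).1, (hΘz _).2,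
        (fz _).1, (fz _).2, SemidirectProduct.rightHom_inl]
      rfl
    have hr : ∀ x : f.ker, (Θ x).right = 1 := by
      intro x
      exact (DFunLike.congr_fun hright (x : G)).trans x.2
    let F : f.ker →* H :=
      { toFun := fun x => (Θ x).left 0
        map_one' := by simp
        map_mul' := fun x y => by
          rw [Subgroup.coe_mul, map_mul, wr_mul_left, hr]; simp }
    have hF : ∀ x : f.ker, F x = (Θ x).left 0 := fun _ => rfl
    refine ⟨F, ?_⟩
    rw [coverList, mp_cons, mp_flatMap]
    congr 1
    · rw [hF, hF, ht, hb, map_pow, hΘa, hΘb, (wrA_pow tt n le_rfl).1]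
      simp [hBH, bseq]
    · apply List.flatMap_congr
      intro j hj
      have hj := List.mem_range.1 hj
      rw [mp_mp, mp_ofFn]
      congr 1
      funext i
      have key : ∀ (y : f.ker) (ψ : ZMod n → H), Θ y = SemidirectProduct.inl ψ →
          F (MulAut.conjNormal (H := f.ker) (a ^ j) y) = ψ (j : ZMod n) := by
        intro y ψ hy
        rw [hF, MulAut.conjNormal_apply, map_mul, map_mul, map_inv, map_pow, hΘa, hy, wr_conj,
          (wrA_pow tt j hj.le).1, (wrA_pow tt j hj.le).2]
        simp [hj.ne]
      have hv : ((j : ZMod n)).val = j := ZMod.val_cast_of_lt hj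
      have hz1 := (hΘz i).1
      have hz2 := (hΘz i).2
      rw [← hzF i] at hz1 hz2
      refine Prod.ext ?_ ?_
      · refine (key _ _ hz1).trans ?_
        simp [hZH, hv]
      · refine (key _ _ hz2).trans ?_
        simp [hZH, hv]
end RS
end SurfOrb

set_option autoImplicit false
namespace SurfOrb
open Multiplicative

/-- hyperbolic surface group -/
def Surf (G : Type) [Group G] : Prop := ∃ l : List (G × G), Marked l ∧ 2 ≤ l.length

lemma Surf.congr {G H : Type} [Group G] [Group H] (e : G ≃* H) (h : Surf G) : Surf H := by
  obtain ⟨l, hl, h2⟩ := h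
  refine ⟨mp e.toMonoidHom l, ⟨?_, ?_, ?_⟩, by simpa using h2⟩
  · rw [PP_mp, hl.rel, map_one]
  · rw [eq_top_iff]
    rintro x -
    have hx : e.symm x ∈ Subgroup.closure (gens l) := by rw [hl.gen]; trivial
    have hx2 : x ∈ (Subgroup.closure (gens l)).map e.toMonoidHom := ⟨_, hx, by simp⟩
    rw [MonoidHom.map_closure] at hx2
    refine Subgroup.closure_mono ?_ hx2
    rintro _ ⟨y, ⟨p, hp, hy⟩, rfl⟩
    refine ⟨Prod.map e e p, List.mem_map.2 ⟨p, hp, rfl⟩, ?_⟩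
    rcases hy with rfl | rfl
    · exact Or.inl rfl
    · exact Or.inr rfl
  · intro L _ l' hl' hP
    obtain ⟨f, hf⟩ := hl.lift L l' (by simpa using hl') hP
    refine ⟨f.comp e.symm.toMonoidHom, ?_⟩
    rw [mp_mp, ← hf]
    congr 1
    ext x; simp

lemma Marked.coverSurf {G : Type} [Group G] {n : ℕ} [NeZero n] {a b : G} {rest : List (G × G)}
    (hm : Marked ((a, b) :: rest)) (f : G →* MZ n) (fa : f a = ofAdd 1) (fb : f b = 1)
    (fz : ∀ x ∈ gens rest, f x = 1) :
    ∃ (t bK : f.ker) (zK : List (f.ker × f.ker)), (t : G) = a ^ n ∧ (bK : G) = b ∧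
      mp f.ker.subtype zK = rest ∧ Marked (coverList f.ker a n t bK zK) := by
  obtain ⟨zK, hz⟩ := exists_lift_list f.ker rest fz
  have ht : f (a ^ n) = 1 := by
    rw [map_pow, fa, ← ofAdd_nsmul]; simp
  refine ⟨⟨a ^ n, ht⟩, ⟨b, fb⟩, zK, rfl, rfl, hz, ?_⟩
  rw [← List.ofFn_get rest] at hm hz
  refine coverMarked hm f fa fb ?_ _ _ _ rfl rfl hz
  intro i
  exact ⟨fz _ ⟨_, List.get_mem _ _, Or.inl rfl⟩, fz _ ⟨_, List.get_mem _ _, Or.inr rfl⟩⟩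

lemma coverList_length {G : Type} [Group G] (K : Subgroup G) [K.Normal] (a : G) (n : ℕ) (t b : K)
    (zK : List (K × K)) : (coverList K a n t b zK).length = n * zK.length + 1 := by
  simp [coverList, List.length_flatMap]

variable {r : ℕ} [Fact r.Prime]

lemma Surf.ker {G : Type} [Group G] (h : Surf G) (f : G →* MZ r) (hf : f ≠ 1) : Surf f.ker := by
  obtain ⟨l, hl, h2⟩ := h
  obtain ⟨l', hl', hlen, hmp⟩ := hl.normalize f hf
  obtain ⟨⟨a, b⟩, rest, rfl⟩ : ∃ p L, l' = p :: L := by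
    cases l' with
    | nil => simp at hlen; omega
    | cons p L => exact ⟨p, L, rfl⟩
  have : NeZero r := ⟨(Fact.out : r.Prime).ne_zero⟩
  rw [mp_cons, List.cons.injEq, Prod.mk.injEq] at hmp
  obtain ⟨⟨fa, fb⟩, hrest⟩ := hmp
  have fz : ∀ x ∈ gens rest, f x = 1 := by
    rintro x ⟨p, hp, hx⟩
    have : (f p.1, f p.2) ∈ mp f rest := List.mem_map.2 ⟨p, hp, rfl⟩
    rw [hrest] at this
    have := List.eq_of_mem_replicate this
    rw [Prod.mk.injEq] at this
    rcases hx with rfl | rfl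
    · exact this.1
    · exact this.2
  obtain ⟨t, bK, zK, ht, hb, hz, hM⟩ := hl'.coverSurf f fa fb fz
  refine ⟨_, hM, ?_⟩
  rw [coverList_length]
  have h3 : zK.length = rest.length := by rw [← hz, mp_length]
  simp only [List.length_cons] at hlen
  have : 1 ≤ zK.length := by omega
  have := NeZero.pos r
  nlinarith

lemma exists_hom_of_pgroup {Q : Type} [Group Q] [Finite Q] (hQ : IsPGroup r Q) (hn : Nontrivial Q) :
    ∃ f : Q →* MZ r, f ≠ 1 := by
  have hr : r.Prime := Fact.out
  obtain ⟨n, hc⟩ := IsPGroup.iff_card.1 hQ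
  obtain ⟨k, rfl⟩ : ∃ k, n = k + 1 := by
    cases n with
    | zero => 
      have := Finite.one_lt_card (α := Q)
      simp at hc; omega
    | succ k => exact ⟨k, rfl⟩
  obtain ⟨H, hH⟩ := Sylow.exists_subgroup_card_pow_prime (G := Q) r (n := k) (by
    rw [hc]; exact pow_dvd_pow _ (by omega))
  have hi : H.index = r := by
    have := H.card_mul_index
    rw [hH, hc, pow_succ] at this
    exact Nat.eq_of_mul_eq_mul_left (pow_pos hr.pos k) this
  have : H.Normal := by
    apply Subgroup.normal_of_index_eq_minFac_card
    rw [hi, hc, hr.pow_minFac (by omega)]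
  have hq : Nat.card (Q ⧸ H) = r := hi
  let e : Q ⧸ H ≃* MZ r := mulEquivOfPrimeCardEq (p := r) hq (by simp [MZ])
  refine ⟨e.toMonoidHom.comp (QuotientGroup.mk' H), ?_⟩
  intro h1
  have : ∀ y : Q ⧸ H, y = 1 := by
    intro y
    obtain ⟨x, rfl⟩ := QuotientGroup.mk'_surjective H y
    have := DFunLike.congr_fun h1 x
    exact e.injective (by rw [map_one]; exact this)
  have hs : Subsingleton (Q ⧸ H) := ⟨fun x y => by rw [this x, this y]⟩
  have := Nat.card_of_subsingleton (1 : Q ⧸ H)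
  rw [hq] at this
  exact hr.one_lt.ne' this

lemma Surf.of_index {G : Type} [Group G] (h : Surf G) (K : Subgroup G) [K.Normal] (k : ℕ)
    (hk : K.index = r ^ k) : Surf K := by
  have hr : r.Prime := Fact.out
  induction k generalizing G with
  | zero =>
    rw [pow_zero, Subgroup.index_eq_one] at hk
    subst hk
    exact h.congr Subgroup.topEquiv.symm
  | succ k ih =>
    have : K.FiniteIndex := ⟨by rw [hk]; exact pow_ne_zero _ hr.ne_zero⟩
    have hc : Nat.card (G ⧸ K) = r ^ (k + 1) := hk
    have hp : IsPGroup r (G ⧸ K) := IsPGroup.iff_card.2 ⟨_, hc⟩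
    have hnt : Nontrivial (G ⧸ K) := by
      rw [← Finite.one_lt_card_iff_nontrivial, hc]
      exact Nat.one_lt_pow (by omega) hr.one_lt
    obtain ⟨f, hf⟩ := exists_hom_of_pgroup hp hnt
    let F := f.comp (QuotientGroup.mk' K)
    have hF : F ≠ 1 := by
      intro h1
      apply hf
      apply MonoidHom.ext
      intro y
      obtain ⟨x, rfl⟩ := QuotientGroup.mk'_surjective K y
      exact DFunLike.congr_fun h1 x
    have hKF : K ≤ F.ker := by
      intro x hx
      change f (QuotientGroup.mk' K x) = 1
      rw [(QuotientGroup.eq_one_iff x).2 hx |> fun h => (h : QuotientGroup.mk' K x = 1), map_one]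
    have hi : F.ker.index = r := by
      rw [Subgroup.index_ker]
      have h1 : F.range ≠ ⊥ := by
        intro h; apply hF; rwa [MonoidHom.range_eq_bot_iff] at h
      have hcm : Nat.card (MZ r) = r := by simp [MZ]
      have : Finite (MZ r) := Nat.finite_of_card_ne_zero (by rw [hcm]; exact hr.ne_zero)
      have h2 := Subgroup.card_subgroup_dvd_card F.range
      rw [hcm] at h2
      rcases (Nat.dvd_prime hr).1 h2 with h | h
      · exact absurd (Subgroup.card_eq_one.1 h) h1
      · exact h
    have hrel : (K.subgroupOf F.ker).index = r ^ k := by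
      have := Subgroup.relIndex_mul_index hKF
      rw [hi, hk, pow_succ] at this
      exact Nat.eq_of_mul_eq_mul_right hr.pos this
    exact (ih (h.ker F hF) (K.subgroupOf F.ker) hrel).congr (Subgroup.subgroupOfEquivOfLe hKF)

lemma Surf.finite_hom {G Q : Type} [Group G] [Group Q] [Finite Q] (h : Surf G) :
    Finite (G →* Q) := by
  obtain ⟨l, hl, -⟩ := h
  have hf : Finite (gens l) := by
    have : gens l ⊆ (Prod.fst '' {p | p ∈ l}) ∪ (Prod.snd '' {p | p ∈ l}) := by
      rintro x ⟨p, hp, rfl | rfl⟩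
      · exact Or.inl ⟨p, hp, rfl⟩
      · exact Or.inr ⟨p, hp, rfl⟩
    exact ((((List.finite_toSet l).image _).union ((List.finite_toSet l).image _)).subset this)
  refine Finite.of_injective (fun f : G →* Q => fun x : gens l => f x) ?_
  intro f f' hff
  apply hl.ext
  apply List.map_congr_left
  intro p hp
  exact Prod.ext (congrFun hff ⟨p.1, p, hp, Or.inl rfl⟩) (congrFun hff ⟨p.2, p, hp, Or.inr rfl⟩)

/-- common kernel of homs to `Q` -/
def Psi {P : Type} [Group P] (Q : Type) [Group Q] (K : Subgroup P) : Subgroup P :=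
  (⨅ f : K →* Q, f.ker).map K.subtype

section Psi
variable {P : Type} [Group P] {Q : Type} [Group Q] {K : Subgroup P}

lemma mem_Psi {x : P} : x ∈ Psi Q K ↔ ∃ h : x ∈ K, ∀ f : K →* Q, f ⟨x, h⟩ = 1 := by
  constructor
  · rintro ⟨y, hy, rfl⟩
    refine ⟨y.2, fun f => ?_⟩
    exact (Subgroup.mem_iInf.1 hy) f
  · rintro ⟨h, hf⟩
    exact ⟨⟨x, h⟩, Subgroup.mem_iInf.2 hf, rfl⟩

lemma Psi_le : Psi Q K ≤ K := fun x hx => (mem_Psi.1 hx).1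

lemma Psi_char [hK : K.Characteristic] : (Psi Q K).Characteristic := by
  rw [Subgroup.characteristic_iff_le_comap]
  intro φ x hx
  obtain ⟨h, hf⟩ := mem_Psi.1 hx
  have hle := Subgroup.characteristic_iff_le_comap.1 hK φ
  change φ x ∈ Psi Q K
  refine mem_Psi.2 ⟨hle h, fun f => ?_⟩
  let φK : K →* K := (φ.toMonoidHom.comp K.subtype).codRestrict K (fun y => hle y.2)
  exact hf (f.comp φK)

lemma Psi_index [Finite Q] (hQ : IsPGroup r Q) (hK : Surf K) :
    ∃ k, (Psi Q K).relIndex K = r ^ k := by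
  have : Finite (K →* Q) := hK.finite_hom
  let F : K →* ((K →* Q) → Q) := MonoidHom.pi (fun f => f)
  have e : (Psi Q K).subgroupOf K = F.ker := by
    ext x
    rw [Subgroup.mem_subgroupOf, mem_Psi]
    constructor
    · rintro ⟨h, hf⟩
      exact funext hf
    · intro h
      exact ⟨x.2, fun f => congrFun h f⟩
  have hp : IsPGroup r ((K →* Q) → Q) := by
    obtain ⟨n, hn⟩ := IsPGroup.iff_card.1 hQ
    rw [IsPGroup.iff_card]
    refine ⟨n * Nat.card (K →* Q), ?_⟩
    rw [Nat.card_fun, hn, pow_mul]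
  obtain ⟨k, hk⟩ := IsPGroup.iff_card.1 (hp.to_subgroup F.range)
  refine ⟨k, ?_⟩
  rw [Subgroup.relIndex, e, Subgroup.index_ker, hk]
end Psi
end SurfOrb

set_option autoImplicit false
namespace SurfOrb
open Multiplicative
variable {r : ℕ} [Fact r.Prime]

lemma isPGroup_MZ_pow (k : ℕ) : IsPGroup r (MZ (r ^ k)) := by
  have hr : r.Prime := Fact.out
  intro x
  refine ⟨k, ?_⟩
  apply toAdd.injective
  rw [toAdd_pow, toAdd_one, nsmul_eq_mul, ZMod.natCast_self, zero_mul]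

lemma isPGroup_MZ : IsPGroup r (MZ r) := by
  have := isPGroup_MZ_pow (r := r) 1
  rwa [pow_one] at this

/-- the mod `r` tower -/
def Kt (P : Type) [Group P] (r : ℕ) : ℕ → Subgroup P
  | 0 => ⊤
  | i + 1 => Psi (MZ r) (Kt P r i)

section
variable {P : Type} [Group P]

lemma Kt_anti {i j : ℕ} (h : i ≤ j) : Kt P r j ≤ Kt P r i := by
  induction h with
  | refl => exact le_rfl
  | step _ ih => exact Psi_le.trans ih

lemma Kt_spec (hP : Surf P) (i : ℕ) :
    (Kt P r i).Characteristic ∧ (∃ k, (Kt P r i).index = r ^ k) ∧ Surf (Kt P r i) := by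
  have hr : r.Prime := Fact.out
  have : NeZero r := ⟨hr.ne_zero⟩
  induction i with
  | zero =>
    exact ⟨inferInstanceAs ((⊤ : Subgroup P).Characteristic), ⟨0, Subgroup.index_top⟩,
      hP.congr Subgroup.topEquiv.symm⟩
  | succ i ih =>
    obtain ⟨h1, ⟨k, hk⟩, h3⟩ := ih
    have c : (Kt P r (i + 1)).Characteristic := Psi_char
    obtain ⟨k', hk'⟩ := Psi_index (Q := MZ r) isPGroup_MZ h3
    have hi : (Kt P r (i + 1)).index = r ^ (k' + k) := by
      rw [pow_add, ← hk', ← hk]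
      exact (Subgroup.relIndex_mul_index Psi_le).symm
    exact ⟨c, ⟨_, hi⟩, hP.of_index _ _ hi⟩

/-- lifting a mod `r` character to mod `r ^ 2`. -/
lemma Surf.lift_sq {G : Type} [Group G] (hG : Surf G) (f : G →* MZ r) :
    ∃ F : G →* MZ (r * r), ∀ x, (ZMod.castHom (dvd_mul_right r r) (ZMod r)) (toAdd (F x)) =
      toAdd (f x) := by
  obtain ⟨l, hl, -⟩ := hG
  have hr : r.Prime := Fact.out
  have : NeZero r := ⟨hr.ne_zero⟩
  let s : MZ r → MZ (r * r) := fun y => ofAdd ((toAdd y).val : ZMod (r * r))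
  obtain ⟨F, hF⟩ := hl.lift (MZ (r * r)) (l.map (fun p => (s (f p.1), s (f p.2)))) (by simp) (by
    unfold PP
    apply List.prod_eq_one
    simp only [List.map_map, List.mem_map]
    rintro _ ⟨p, _, rfl⟩
    simp [cm, mul_comm])
  refine ⟨F, ?_⟩
  let c : MZ (r * r) →* MZ r :=
    AddMonoidHom.toMultiplicative (ZMod.castHom (dvd_mul_right r r) (ZMod r)).toAddMonoidHom
  have hs : ∀ y, c (s y) = y := by
    intro y
    change ofAdd ((ZMod.castHom (dvd_mul_right r r) (ZMod r)) ((toAdd y).val : ZMod (r * r))) = y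
    rw [map_natCast, ZMod.natCast_zmod_val]
    rfl
  have : c.comp F = f := by
    apply hl.ext
    rw [← mp_mp, hF]
    simp only [mp, List.map_map]
    apply List.map_congr_left
    intro p _
    simp only [Function.comp, Prod.map, hs]
  intro x
  exact congrArg toAdd (DFunLike.congr_fun this x)

lemma Psi_pow {K : Subgroup P} (hK : Surf K) {x : P} (hx : x ∈ K) (hx' : x ∉ Psi (MZ r) K) :
    x ^ r ∈ Psi (MZ r) K ∧ x ^ r ∉ Psi (MZ r) (Psi (MZ r) K) := by
  have hr : r.Prime := Fact.out
  have : NeZero r := ⟨hr.ne_zero⟩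
  have h1 : ∀ f : K →* MZ r, f (⟨x, hx⟩ ^ r) = 1 := by
    intro f
    rw [map_pow]
    apply toAdd.injective
    simp
  have h1' : x ^ r ∈ Psi (MZ r) K := mem_Psi.2 ⟨K.pow_mem hx r, h1⟩
  refine ⟨h1', ?_⟩
  have : ∃ f : K →* MZ r, f ⟨x, hx⟩ ≠ 1 := by
    by_contra hcon
    push Not at hcon
    exact hx' (mem_Psi.2 ⟨hx, hcon⟩)
  obtain ⟨f, hf⟩ := this
  obtain ⟨F, hF⟩ := hK.lift_sq f
  -- restrict F to Psi: values are multiples of r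
  have hdiv : ∀ y : Psi (MZ r) K, r ∣ (toAdd (F ⟨y, Psi_le y.2⟩)).val := by
    intro y
    have := (mem_Psi.1 y.2).2 f
    have h2 := hF ⟨y, Psi_le y.2⟩
    rw [this, toAdd_one] at h2
    rw [← ZMod.natCast_eq_zero_iff, ← h2]
    simp
  let inc : ZMod r →+ ZMod (r * r) := ZMod.lift r ⟨(AddMonoidHom.mulLeft (r : ZMod (r * r))).comp
    (Int.castAddHom (ZMod (r * r))), by simp [← Nat.cast_mul]⟩
  have hinc : ∀ k : ℕ, inc (k : ZMod r) = (r * k : ℕ) := by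
    intro k
    have := ZMod.lift_coe r (A := ZMod (r * r)) ⟨(AddMonoidHom.mulLeft (r : ZMod (r * r))).comp
      (Int.castAddHom (ZMod (r * r))), by simp [← Nat.cast_mul]⟩ (k : ℤ)
    simp only [Int.cast_natCast] at this
    refine this.trans ?_
    simp
  have hinj : Function.Injective inc := by
    rw [injective_iff_map_eq_zero]
    intro y hy
    rw [← ZMod.natCast_zmod_val y, hinc, ZMod.natCast_eq_zero_iff] at hy
    rw [← ZMod.natCast_zmod_val y, ZMod.natCast_eq_zero_iff]
    exact Nat.dvd_of_mul_dvd_mul_left hr.pos hy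
  have hval : ∀ y : Psi (MZ r) K, inc ((((toAdd (F ⟨y, Psi_le y.2⟩)).val / r : ℕ)) : ZMod r) =
      toAdd (F ⟨y, Psi_le y.2⟩) := by
    intro y
    rw [hinc, Nat.mul_div_cancel' (hdiv y), ZMod.natCast_zmod_val]
  let g : Psi (MZ r) K →* MZ r :=
    { toFun := fun y => ofAdd ((((toAdd (F ⟨y, Psi_le y.2⟩)).val / r : ℕ)) : ZMod r)
      map_one' := by
        apply toAdd.injective
        apply hinj
        rw [toAdd_ofAdd, hval 1]
        change toAdd (F 1) = _
        simp
      map_mul' := fun y y' => by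
        apply toAdd.injective
        apply hinj
        rw [toAdd_mul, map_add, toAdd_ofAdd, toAdd_ofAdd, toAdd_ofAdd, hval, hval, hval,
          ← toAdd_mul, ← map_mul]
        rfl }
  intro hmem
  obtain ⟨h3, h4⟩ := mem_Psi.1 hmem
  have h5 := congrArg (fun t => inc (toAdd t)) (h4 g)
  have h6 : toAdd (F (⟨x, hx⟩ ^ r)) = 0 := by
    have := hval ⟨x ^ r, h3⟩
    refine this.symm.trans (h5.trans ?_)
    simp
  rw [map_pow, toAdd_pow] at h6
  apply hf
  apply toAdd.injective
  rw [← hF, toAdd_one]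
  generalize toAdd (F ⟨x, hx⟩) = w at h6 ⊢
  rw [← ZMod.natCast_zmod_val w, nsmul_eq_mul, ← Nat.cast_mul, ZMod.natCast_eq_zero_iff] at h6
  rw [← ZMod.natCast_zmod_val w, map_natCast, ZMod.natCast_eq_zero_iff]
  exact Nat.dvd_of_mul_dvd_mul_left hr.pos h6

lemma Kt_hom (hP : Surf P) : ∀ (n : ℕ) (Q : Type) [Group Q] [Finite Q], IsPGroup r Q → Nat.card Q ≤ n →
    ∀ (i : ℕ) (f : Kt P r i →* Q), ∃ j, i ≤ j ∧ ∀ x (hx : x ∈ Kt P r i), x ∈ Kt P r j → f ⟨x, hx⟩ = 1 := by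
  intro n
  induction n with
  | zero =>
    intro Q _ _ _ hc
    have := Nat.card_pos (α := Q)
    omega
  | succ n ih =>
    intro Q _ _ hQ hc i f
    rcases subsingleton_or_nontrivial Q with h | h
    · exact ⟨i, le_rfl, fun x hx _ => Subsingleton.elim _ _⟩
    · obtain ⟨φ, hφ⟩ := exists_hom_of_pgroup hQ h
      have hle : Kt P r (i + 1) ≤ Kt P r i := Psi_le
      let f' : Kt P r (i + 1) →* φ.ker := (f.comp (Subgroup.inclusion hle)).codRestrict φ.ker
        (fun y => (mem_Psi.1 y.2).2 (φ.comp f))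
      have hlt : Nat.card φ.ker < Nat.card Q := by
        have h1 := φ.ker.card_mul_index
        have h2 : φ.ker.index ≠ 1 := by
          rw [Ne, Subgroup.index_eq_one, MonoidHom.ker_eq_top_iff]; exact hφ
        have h3 : 0 < Nat.card Q := Nat.card_pos
        have h4 : φ.ker.index ≠ 0 := by rintro h0; rw [h0] at h1; omega
        have h5 : 0 < Nat.card φ.ker := Nat.card_pos
        have : 2 ≤ φ.ker.index := by omega
        nlinarith
      obtain ⟨j, hj, hj'⟩ := ih φ.ker (hQ.to_subgroup _) (by omega) (i + 1) f'
      refine ⟨j, by omega, fun x hx hxj => ?_⟩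
      have := hj' x (Kt_anti hj hxj) hxj
      exact congrArg Subtype.val this

/-- detection -/
lemma Kt_detect (hP : Surf P) (k : ℕ) (f : P →* MZ (r ^ k)) (Q : Type) [Group Q] [Finite Q]
    (hQ : IsPGroup r Q) (h : f.ker →* Q) (x : P) (hx : ∀ hxf : x ∈ f.ker, h ⟨x, hxf⟩ ≠ 1) :
    ∃ j, x ∉ Kt P r j := by
  have hr : r.Prime := Fact.out
  have : NeZero (r ^ k) := ⟨pow_ne_zero _ hr.ne_zero⟩
  obtain ⟨i, -, hi⟩ := Kt_hom (r := r) hP _ (MZ (r ^ k)) (isPGroup_MZ_pow k) le_rfl 0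
    (f.comp (Kt P r 0).subtype)
  have hle : Kt P r i ≤ f.ker := fun y hy => hi y trivial hy
  obtain ⟨j, hj, hj'⟩ := Kt_hom (r := r) hP _ Q hQ le_rfl i (h.comp (Subgroup.inclusion hle))
  refine ⟨j, fun hxj => ?_⟩
  exact hx (hle (Kt_anti hj hxj)) (hj' x (Kt_anti hj hxj) hxj)
end
end SurfOrb

set_option autoImplicit false
set_option linter.unusedSectionVars false
set_option linter.unusedVariables false
namespace SurfOrb
open Multiplicative
variable {r : ℕ} [Fact r.Prime] {n : ℕ}

abbrev Mat (n r : ℕ) := Matrix (Fin n) (Fin n) (ZMod r)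

/-- entries supported on or above the `k`-th superdiagonal -/
def SU (n r k : ℕ) : AddSubgroup (Mat n r) where
  carrier := {A | ∀ i j : Fin n, j.val < i.val + k → A i j = 0}
  zero_mem' := fun _ _ _ => rfl
  add_mem' := fun {A B} hA hB i j h => by
    rw [Matrix.add_apply, hA i j h, hB i j h, add_zero]
  neg_mem' := fun {A} hA i j h => by rw [Matrix.neg_apply, hA i j h, neg_zero]

lemma mem_SU {k : ℕ} {A : Mat n r} : A ∈ SU n r k ↔ ∀ i j : Fin n, j.val < i.val + k → A i j = 0 :=
  Iff.rfl

lemma SU_mono {k k' : ℕ} (h : k ≤ k') : SU n r k' ≤ SU n r k :=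
  fun _ hA i j hij => hA i j (by omega)

lemma SU_mul {a b : ℕ} {A B : Mat n r} (hA : A ∈ SU n r a) (hB : B ∈ SU n r b) :
    A * B ∈ SU n r (a + b) := by
  intro i j hij
  rw [Matrix.mul_apply]
  apply Finset.sum_eq_zero
  intro m _
  by_cases h : m.val < i.val + a
  · rw [hA i m h, zero_mul]
  · rw [hB m j (by omega), mul_zero]

lemma SU_one : (1 : Mat n r) ∈ SU n r 0 := by
  intro i j h
  rw [Matrix.one_apply_ne]
  intro e; subst e; omega

lemma SU_pow {A : Mat n r} (hA : A ∈ SU n r 1) (k : ℕ) : A ^ k ∈ SU n r k := by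
  induction k with
  | zero => rw [pow_zero]; exact SU_one
  | succ k ih => rw [pow_succ]; exact SU_mul ih hA

lemma SU_eq_zero {k : ℕ} (h : n ≤ k) {A : Mat n r} (hA : A ∈ SU n r k) : A = 0 := by
  ext i j
  exact hA i j (by omega)

lemma one_add_pow_r (A : Mat n r) (k : ℕ) : (1 + A) ^ r ^ k = 1 + A ^ r ^ k := by
  rcases Nat.eq_zero_or_pos n with h | h
  · subst h; exact Subsingleton.elim _ _
  · have : Nonempty (Fin n) := ⟨⟨0, h⟩⟩
    rw [add_pow_char_pow_of_commute r k (Commute.one_left A), one_pow]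

lemma one_add_pow_eq_one {A : Mat n r} (hA : A ∈ SU n r 1) : (1 + A) ^ r ^ n = 1 := by
  have hr : r.Prime := Fact.out
  rw [one_add_pow_r, SU_eq_zero (Nat.lt_pow_self hr.one_lt).le (SU_pow hA _), add_zero]

lemma SU_mul_sub_one {k : ℕ} {u v : Mat n r} (hu : u - 1 ∈ SU n r k) (hv : v - 1 ∈ SU n r k) :
    u * v - 1 ∈ SU n r k ∧ (u * v - 1) - ((u - 1) + (v - 1)) ∈ SU n r (k + k) := by
  have e : u * v - 1 = (u - 1) + (v - 1) + (u - 1) * (v - 1) := by noncomm_ring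
  have h := SU_mul hu hv
  rw [e]
  refine ⟨add_mem (add_mem hu hv) (SU_mono (by omega) h), ?_⟩
  rw [add_sub_cancel_left]; exact h

lemma SU_pow_sub_one {k : ℕ} {u : Mat n r} (hu : u - 1 ∈ SU n r k) (t : ℕ) :
    u ^ t - 1 ∈ SU n r k := by
  induction t with
  | zero => rw [pow_zero, sub_self]; exact zero_mem _
  | succ t ih => rw [pow_succ]; exact (SU_mul_sub_one ih hu).1

lemma units_pow_eq_one {u : (Mat n r)ˣ} (hu : (u : Mat n r) - 1 ∈ SU n r 1) : u ^ r ^ n = 1 := by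
  apply Units.ext
  rw [Units.val_pow_eq_pow_val, Units.val_one, ← one_add_pow_eq_one hu]
  congr 1
  abel

/-- congruence type subgroups of the unitriangular group (for `1 ≤ k`) -/
def UTk (n r k : ℕ) [Fact r.Prime] (hk : 1 ≤ k) : Subgroup (Mat n r)ˣ where
  carrier := {u | (u : Mat n r) - 1 ∈ SU n r k}
  one_mem' := by
    change ((1 : (Mat n r)ˣ) : Mat n r) - 1 ∈ SU n r k
    rw [Units.val_one, sub_self]; exact zero_mem _
  mul_mem' := fun {u v} hu hv => by
    change ((u * v : (Mat n r)ˣ) : Mat n r) - 1 ∈ SU n r k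
    rw [Units.val_mul]
    exact (SU_mul_sub_one hu hv).1
  inv_mem' := fun {u} hu => by
    have hr : r.Prime := Fact.out
    have h1 := units_pow_eq_one (SU_mono hk hu)
    have h2 : u⁻¹ = u ^ (r ^ n - 1) := by
      rw [inv_eq_iff_mul_eq_one, ← pow_succ', Nat.sub_add_cancel (Nat.pow_pos hr.pos), h1]
    change ((u⁻¹ : (Mat n r)ˣ) : Mat n r) - 1 ∈ SU n r k
    rw [h2, Units.val_pow_eq_pow_val]
    exact SU_pow_sub_one hu _

/-- unitriangular group -/
abbrev UT (n r : ℕ) [Fact r.Prime] := UTk n r 1 le_rfl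

lemma isPGroup_UT : IsPGroup r (UT n r) := fun u => ⟨n, Subtype.ext (units_pow_eq_one u.2)⟩

instance : Finite (UT n r) := by
  have : NeZero r := ⟨(Fact.out : r.Prime).ne_zero⟩
  infer_instance

/-- elements of the unitriangular group -/
def mkU (A : Mat n r) (hA : A ∈ SU n r 1) : UT n r :=
  ⟨Units.ofPowEqOne (1 + A) (r ^ n) (one_add_pow_eq_one hA)
    (pow_ne_zero _ (Fact.out : r.Prime).ne_zero), by
    change (1 + A) - 1 ∈ SU n r 1
    rw [add_sub_cancel_left]; exact hA⟩

lemma mkU_val (A : Mat n r) (hA : A ∈ SU n r 1) : ((mkU A hA : (Mat n r)ˣ) : Mat n r) = 1 + A := rfl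

/-- entries on the `k`-th superdiagonal are additive -/
def entryHom (n r k : ℕ) [Fact r.Prime] (hk : 1 ≤ k) (i j : Fin n) (hij : j.val = i.val + k) :
    UTk n r k hk →* MZ r where
  toFun u := ofAdd (((u : (Mat n r)ˣ) : Mat n r) i j)
  map_one' := by
    change ofAdd ((1 : Mat n r) i j) = 1
    rw [Matrix.one_apply_ne (by rintro rfl; omega)]; rfl
  map_mul' u v := by
    have h := (SU_mul_sub_one u.2 v.2).2 i j (by omega)
    have h1 : (1 : Mat n r) i j = 0 := Matrix.one_apply_ne (by rintro rfl; omega)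
    simp only [Matrix.sub_apply, Matrix.add_apply, h1, sub_zero] at h
    rw [← ofAdd_add]
    exact congrArg ofAdd (sub_eq_zero.1 h)

lemma SU_pow_entry {A : Mat n r} (hA : A ∈ SU n r 1) (k : ℕ) (d : ℕ → ZMod r)
    (hd : ∀ i j : Fin n, j.val = i.val + 1 → A i j = d i) (j i : Fin n) (hj : j.val = i.val + k) :
    (A ^ k) i j = ∏ l ∈ Finset.range k, d (i + l) := by
  induction k generalizing j with
  | zero =>
    have : i = j := Fin.ext (by omega)
    subst this
    simp
  | succ k ih =>
    rw [pow_succ, Matrix.mul_apply, Finset.prod_range_succ]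
    have hlt : i.val + k < n := by omega
    rw [Finset.sum_eq_single ⟨i.val + k, hlt⟩]
    · rw [ih _ rfl, hd ⟨i.val + k, hlt⟩ j (by simp; omega)]
    · intro m _ hm
      have hm' : m.val ≠ i.val + k := fun h => hm (Fin.ext h)
      by_cases h : m.val < i.val + k
      · rw [SU_pow hA k i m h, zero_mul]
      · rw [hA m j (by omega), mul_zero]
    · simp
end SurfOrb

set_option autoImplicit false
set_option linter.unusedSectionVars false
set_option linter.unusedVariables false
namespace SurfOrb
open Multiplicative
section magnus
open Classical
variable {r : ℕ} [Fact r.Prime] {n : ℕ} {X : Type}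

/-- nilpotent matrix of a letter -/
noncomputable def NX (n r : ℕ) (c : ℕ → Option X) (x : X) : Mat n r :=
  fun i j => if j.val = i.val + 1 ∧ c i = some x then 1 else 0

lemma NX_mem (c : ℕ → Option X) (x : X) : NX n r c x ∈ SU n r 1 := by
  intro i j h
  rw [NX, if_neg]
  omega

lemma vm_NX (c : ℕ → Option X) (x : X) (u : Fin n → ZMod r) (U : ℕ → ZMod r)
    (hU : ∀ j, u j = U j) (j : Fin n) :
    Matrix.vecMul u (NX n r c x) j = if 1 ≤ j.val ∧ c (j.val - 1) = some x then U (j.val - 1) else 0 := by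
  rw [Matrix.vecMul, dotProduct]
  by_cases h : 1 ≤ j.val
  · have hj : j.val - 1 < n := by omega
    rw [Finset.sum_eq_single ⟨j.val - 1, hj⟩]
    · rw [hU]
      have e : j.val = j.val - 1 + 1 := by omega
      simp only [NX]
      by_cases hc : c (j.val - 1) = some x
      · rw [if_pos ⟨e, hc⟩, if_pos ⟨h, hc⟩, mul_one]
      · rw [if_neg (fun h => hc h.2), if_neg (fun h => hc h.2), mul_zero]
    · intro m _ hm
      rw [NX, if_neg, mul_zero]
      rintro ⟨h1, -⟩
      exact hm (Fin.ext (by simp; omega))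
    · simp
  · rw [if_neg (fun h' => h h'.1)]
    apply Finset.sum_eq_zero
    intro m _
    rw [NX, if_neg, mul_zero]
    rintro ⟨h1, -⟩
    omega

lemma vm_NX_pow (c : ℕ → Option X) (x : X) (q : ℕ) (u : Fin n → ZMod r) (U : ℕ → ZMod r)
    (hU : ∀ j, u j = U j) (j : Fin n) :
    Matrix.vecMul u (NX n r c x ^ q) j =
      if q ≤ j.val ∧ (∀ l, j.val - q ≤ l → l < j.val → c l = some x) then U (j.val - q) else 0 := by
  induction q generalizing j with
  | zero =>
    rw [pow_zero, Matrix.vecMul_one, if_pos ⟨by omega, fun l h1 h2 => by omega⟩, hU]; rfl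
  | succ q ih =>
    rw [pow_succ, ← Matrix.vecMul_vecMul,
      vm_NX c x _ (fun j => if q ≤ j ∧ (∀ l, j - q ≤ l → l < j → c l = some x) then U (j - q) else 0) ih]
    by_cases h : q + 1 ≤ j.val ∧ (∀ l, j.val - (q + 1) ≤ l → l < j.val → c l = some x)
    · rw [if_pos h, if_pos ⟨by omega, h.2 _ (by omega) (by omega)⟩, if_pos]
      · congr 1; omega
      · exact ⟨by omega, fun l h1 h2 => h.2 l (by omega) (by omega)⟩
    · rw [if_neg h]
      split_ifs with h1 h2
      · exfalso
        apply h
        refine ⟨by omega, fun l h3 h4 => ?_⟩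
        rcases Nat.lt_or_ge l (j.val - 1) with h5 | h5
        · exact h2.2 l (by omega) h5
        · have : l = j.val - 1 := by omega
          rw [this]; exact h1.2
      · rfl
      · rfl

/-- leading position -/
def St (P : ℕ) (α : ZMod r) (u : Fin n → ZMod r) : Prop :=
  (∀ j : Fin n, P < j.val → u j = 0) ∧ (∀ j : Fin n, j.val = P → u j = α)

lemma St_step (c : ℕ → Option X) (x : X) (q : ℕ) (hq : 1 ≤ q) {P : ℕ} {α : ZMod r}
    {u : Fin n → ZMod r} (hu : St P α u) (hc : ∀ l, P ≤ l → l < P + q → c l = some x)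
    (hc0 : P = 0 ∨ c (P - 1) ≠ some x) (hc1 : c (P + q) ≠ some x) (t : ℕ) :
    St (P + q) ((t : ZMod r) * α) (Matrix.vecMul u ((1 + NX n r c x ^ q) ^ t)) := by
  have key : ∀ t : ℕ, let w := Matrix.vecMul u ((1 + NX n r c x ^ q) ^ t)
      (∀ j : Fin n, P < j.val → j.val ≠ P + q → w j = 0) ∧ (∀ j : Fin n, j.val = P → w j = α) ∧
      (∀ j : Fin n, j.val = P + q → w j = (t : ZMod r) * α) := by
    intro t
    induction t with
    | zero =>
      simp only [pow_zero, Matrix.vecMul_one]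
      exact ⟨fun j h _ => hu.1 j h, hu.2, fun j h => by rw [hu.1 j (by omega)]; simp⟩
    | succ t ih =>
      intro w
      set w0 := Matrix.vecMul u ((1 + NX n r c x ^ q) ^ t) with hw0
      obtain ⟨h1, h2, h3⟩ := ih
      have hw : ∀ j, w j = w0 j +
          if q ≤ j.val ∧ (∀ l, j.val - q ≤ l → l < j.val → c l = some x)
          then (fun k => if h : k < n then w0 ⟨k, h⟩ else 0) (j.val - q) else 0 := by
        intro j
        rw [← vm_NX_pow c x q w0 (fun k => if h : k < n then w0 ⟨k, h⟩ else 0)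
          (fun j => by simp [j.2]) j]
        simp only [w]
        rw [pow_succ, ← Matrix.vecMul_vecMul, ← hw0, Matrix.vecMul_add, Matrix.vecMul_one]
        rfl
      refine ⟨?_, ?_, ?_⟩
      · intro j hj hjq
        rw [hw, h1 j hj hjq, zero_add]
        split_ifs with h
        · obtain ⟨ha, hb⟩ := h
          have hlt : j.val - q < n := by omega
          simp only [hlt, dif_pos]
          rcases lt_trichotomy (j.val - q) P with h5 | h5 | h5
          · exfalso
            rcases hc0 with h0 | h0
            · omega
            · exact h0 (hb (P - 1) (by omega) (by omega))
          · omega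
          · by_cases h6 : j.val - q = P + q
            · exact absurd (hb (P + q) (by omega) (by omega)) hc1
            · exact h1 ⟨j.val - q, hlt⟩ h5 h6
        · rfl
      · intro j hj
        rw [hw, h2 j hj, if_neg, add_zero]
        rintro ⟨ha, hb⟩
        rcases hc0 with h0 | h0
        · omega
        · exact h0 (hb (P - 1) (by omega) (by omega))
      · intro j hj
        rw [hw, h3 j hj, if_pos ⟨by omega, fun l ha hb => hc l (by omega) (by omega)⟩]
        have hlt : j.val - q < n := by omega
        simp only [hlt, dif_pos]
        rw [h2 ⟨j.val - q, hlt⟩ (by simp; omega)]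
        push_cast
        ring
  obtain ⟨h1, h2, h3⟩ := key t
  exact ⟨fun j h => h1 j (by omega) (by omega), h3⟩

/-- syllable normal form -/
lemma exists_syll (w : FreeGroup X) : ∃ L : List (X × ℤ), (∀ p ∈ L, p.2 ≠ 0) ∧
    L.IsChain (fun p q => p.1 ≠ q.1) ∧ (L.map (fun p => FreeGroup.of p.1 ^ p.2)).prod = w := by
  have step : ∀ (x : X) (ε : ℤ) (hε : ε ≠ 0) (w : FreeGroup X), (∃ L : List (X × ℤ), (∀ p ∈ L, p.2 ≠ 0) ∧
    L.IsChain (fun p q => p.1 ≠ q.1) ∧ (L.map (fun p => FreeGroup.of p.1 ^ p.2)).prod = w) →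
    (∃ L : List (X × ℤ), (∀ p ∈ L, p.2 ≠ 0) ∧
    L.IsChain (fun p q => p.1 ≠ q.1) ∧
      (L.map (fun p => FreeGroup.of p.1 ^ p.2)).prod = FreeGroup.of x ^ ε * w) := by
    rintro x ε hε w ⟨L, h1, h2, rfl⟩
    cases L with
    | nil => exact ⟨[(x, ε)], by simpa using hε, by simp, by simp⟩
    | cons p L =>
      obtain ⟨y, e⟩ := p
      by_cases hxy : x = y
      · subst hxy
        by_cases he : ε + e = 0
        · refine ⟨L, fun p hp => h1 p (List.mem_cons_of_mem _ hp), h2.tail, ?_⟩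
          rw [List.map_cons, List.prod_cons, ← mul_assoc, ← zpow_add, he, zpow_zero, one_mul]
        · refine ⟨(x, ε + e) :: L, ?_, ?_, ?_⟩
          · intro p hp
            rcases List.mem_cons.1 hp with rfl | hp
            · exact he
            · exact h1 p (List.mem_cons_of_mem _ hp)
          · cases L with
            | nil => simp
            | cons q L =>
              rw [List.isChain_cons_cons] at h2 ⊢
              exact h2
          · rw [List.map_cons, List.prod_cons, List.map_cons, List.prod_cons, ← mul_assoc, ← zpow_add]
      · refine ⟨(x, ε) :: (y, e) :: L, ?_, ?_, ?_⟩
        · intro p hp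
          rcases List.mem_cons.1 hp with rfl | hp
          · exact hε
          · exact h1 p hp
        · rw [List.isChain_cons_cons]; exact ⟨hxy, h2⟩
        · simp
  induction w using FreeGroup.induction_on with
  | C1 => exact ⟨[], by simp, by simp, by simp⟩
  | of x => simpa using step x 1 (by decide) 1 ⟨[], by simp, by simp, by simp⟩
  | inv_of x _ => simpa using step x (-1) (by decide) 1 ⟨[], by simp, by simp, by simp⟩
  | mul x y hx hy =>
    obtain ⟨L, h1, -, rfl⟩ := hx
    induction L with
    | nil => simpa using hy
    | cons p L ih =>
      have := step p.1 p.2 (h1 p (by simp)) _ (ih (fun q hq => h1 q (List.mem_cons_of_mem _ hq)))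
      rw [← mul_assoc] at this
      simpa using this

/-- the Magnus representation -/
noncomputable def magnus (n r : ℕ) [Fact r.Prime] (c : ℕ → Option X) : FreeGroup X →* UT n r :=
  FreeGroup.lift (fun x => mkU (NX n r c x) (NX_mem c x))

lemma magnus_syll (c : ℕ → Option X) (x : X) (v : ℕ) (e : ℤ) (hn : 1 ≤ n) (he : ¬ (r : ℤ) ∣ e) :
    ∃ t : ℕ, (t : ZMod r) ≠ 0 ∧
      (((magnus n r c (FreeGroup.of x ^ ((r : ℤ) ^ v * e)) : UT n r) : (Mat n r)ˣ) : Mat n r) =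
        (1 + NX n r c x ^ (r ^ v)) ^ t := by
  have hr : r.Prime := Fact.out
  have hR : (0 : ℤ) < (r : ℤ) ^ n := by have := hr.pos; positivity
  refine ⟨(e % (r : ℤ) ^ n).toNat, ?_, ?_⟩
  · have h0 : 0 ≤ e % (r : ℤ) ^ n := Int.emod_nonneg _ hR.ne'
    intro h
    apply he
    have h2 : (((e % (r : ℤ) ^ n).toNat : ℤ) : ZMod r) = 0 := by exact_mod_cast h
    rw [Int.toNat_of_nonneg h0, ZMod.intCast_zmod_eq_zero_iff_dvd] at h2
    have h3 : (r : ℤ) ∣ (r : ℤ) ^ n := dvd_pow_self _ (by omega)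
    rw [← Int.emod_add_mul_ediv e ((r : ℤ) ^ n)]
    exact dvd_add h2 (h3.mul_right _)
  · set U := mkU (NX n r c x) (NX_mem c x) with hU
    have h1 : magnus n r c (FreeGroup.of x) = U := by simp [magnus, hU]
    have h4 : (U ^ (r ^ v)) ^ r ^ n = 1 := by
      apply Subtype.ext
      exact units_pow_eq_one (U ^ (r ^ v)).2
    have h5 : U ^ ((r : ℤ) ^ v * e) = (U ^ (r ^ v)) ^ (e % (r : ℤ) ^ n).toNat := by
      rw [zpow_mul]
      have : U ^ ((r : ℤ) ^ v) = U ^ (r ^ v) := by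
        rw [← Nat.cast_pow, zpow_natCast]
      rw [this, ← zpow_natCast (U ^ r ^ v), Int.toNat_of_nonneg (Int.emod_nonneg _ hR.ne')]
      conv_lhs => rw [← Int.emod_add_mul_ediv e ((r : ℤ) ^ n)]
      rw [zpow_add, zpow_mul]
      have h6 : (U ^ r ^ v) ^ ((r : ℤ) ^ n) = 1 := by rw [← Nat.cast_pow, zpow_natCast, h4]
      rw [h6, one_zpow, mul_one]
    rw [map_zpow, h1, h5, Subgroup.coe_pow, Subgroup.coe_pow, Units.val_pow_eq_pow_val,
      Units.val_pow_eq_pow_val, hU, mkU_val, one_add_pow_r]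

lemma magnus_main (vv : ℤ → ℕ) (ee : ℤ → ℤ)
    (hve : ∀ e : ℤ, e ≠ 0 → e = (r : ℤ) ^ vv e * ee e ∧ ¬ (r : ℤ) ∣ ee e) (W : List X)
    (hn : n = W.length + 1) (L : List (X × ℤ)) :
    ∀ (pre : List X) (α : ZMod r) (u : Fin n → ZMod r), α ≠ 0 → St pre.length α u →
    W = pre ++ L.flatMap (fun p => List.replicate (r ^ vv p.2) p.1) →
    (∀ p ∈ L, p.2 ≠ 0) → L.IsChain (fun p q => p.1 ≠ q.1) →
    (∀ p, L.head? = some p → pre = [] ∨ W[pre.length - 1]? ≠ some p.1) →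
    ∃ β : ZMod r, β ≠ 0 ∧ St W.length β (Matrix.vecMul u
      (((magnus n r (fun k => W[k]?) (L.map (fun p => FreeGroup.of p.1 ^ p.2)).prod : UT n r) :
        (Mat n r)ˣ) : Mat n r)) := by
  have hr : r.Prime := Fact.out
  induction L with
  | nil =>
    intro pre α u hα hu hW _ _ _
    refine ⟨α, hα, ?_⟩
    simp only [List.flatMap_nil, List.append_nil] at hW
    subst hW
    simpa using hu
  | cons p L ih =>
    intro pre α u hα hu hW h1 h2 h3
    obtain ⟨x, e⟩ := p
    have he0 : e ≠ 0 := h1 (x, e) (by simp)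
    obtain ⟨he, hne⟩ := hve e he0
    obtain ⟨t, ht, hmt⟩ := magnus_syll (n := n) (fun k => W[k]?) x (vv e) (ee e) (by omega) hne
    rw [← he] at hmt
    set q := r ^ vv e with hq
    have hq1 : 1 ≤ q := Nat.pow_pos hr.pos
    have hW' : W = (pre ++ List.replicate q x) ++
        L.flatMap (fun p => List.replicate (r ^ vv p.2) p.1) := by
      rw [hW]; simp [hq]
    have hst := St_step (fun k => W[k]?) x q hq1 hu (by
      intro l ha hb
      change W[l]? = some x
      rw [hW', List.getElem?_append_left (by simp; omega), List.getElem?_append_right ha,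
        List.getElem?_replicate, if_pos (by omega)]) (by
      rcases h3 (x, e) rfl with h | h
      · left; simp [h]
      · right; exact h) (by
      change W[pre.length + q]? ≠ some x
      rw [hW', List.getElem?_append_right (by simp)]
      simp only [List.length_append, List.length_replicate, Nat.sub_self]
      cases L with
      | nil => simp
      | cons p' L =>
        rw [List.isChain_cons_cons] at h2
        have hp' : 0 < r ^ vv p'.2 := Nat.pow_pos hr.pos
        rw [List.flatMap_cons, List.getElem?_append_left (by simpa using hp'), List.getElem?_replicate,
          if_pos hp']
        intro h
        exact h2.1 (Option.some.inj h).symm) t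
    obtain ⟨β, hβ, hfin⟩ := ih (pre ++ List.replicate q x) (t * α) _ (mul_ne_zero ht hα)
      (by simpa using hst) hW' (fun p hp => h1 p (List.mem_cons_of_mem _ hp)) h2.tail (by
        intro p hp
        right
        cases L with
        | nil => simp at hp
        | cons p' L =>
          simp only [List.head?_cons, Option.some.injEq] at hp
          subst hp
          rw [List.isChain_cons_cons] at h2
          have e1 : (pre ++ List.replicate q x).length - 1 = pre.length + (q - 1) := by
            simp; omega
          rw [e1, hW', List.getElem?_append_left (by simp; omega),
            List.getElem?_append_right (by omega), List.getElem?_replicate, if_pos (by omega)]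
          intro h
          exact h2.1 (Option.some.inj h))
    refine ⟨β, hβ, ?_⟩
    rw [List.map_cons, List.prod_cons, map_mul, Subgroup.coe_mul, Units.val_mul,
      ← Matrix.vecMul_vecMul, hmt]
    exact hfin

/-- free groups are residually finite `r`-groups -/
theorem free_resid (w : FreeGroup X) (hw : w ≠ 1) :
    ∃ (n : ℕ) (ρ : FreeGroup X →* UT n r), ρ w ≠ 1 := by
  have hr : r.Prime := Fact.out
  obtain ⟨L, h1, h2, rfl⟩ := exists_syll w
  have : ∀ e : ℤ, ∃ (v : ℕ) (e' : ℤ), e ≠ 0 → e = (r : ℤ) ^ v * e' ∧ ¬ (r : ℤ) ∣ e' := by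
    intro e
    by_cases he : e = 0
    · exact ⟨0, 0, fun h => absurd he h⟩
    · have hfm : FiniteMultiplicity (r : ℤ) e := by
        rw [Int.finiteMultiplicity_iff]
        exact ⟨by simpa using hr.one_lt.ne', he⟩
      obtain ⟨e', ha, hb⟩ := hfm.exists_eq_pow_mul_and_not_dvd
      exact ⟨_, e', fun _ => ⟨ha, hb⟩⟩
  choose vv ee hve using this
  set W := L.flatMap (fun p => List.replicate (r ^ vv p.2) p.1) with hW
  refine ⟨W.length + 1, magnus _ r (fun k => W[k]?), ?_⟩
  intro hone
  obtain ⟨β, hβ, hst⟩ := magnus_main (n := W.length + 1) vv ee hve W rfl L [] 1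
    (Pi.single 0 1) one_ne_zero ⟨fun j hj => by
      rw [Pi.single_eq_of_ne]; rintro rfl; simp at hj, fun j hj => by
      have : j = 0 := Fin.ext hj
      rw [this, Pi.single_eq_same]⟩ (by simp [hW]) h1 h2 (fun p _ => Or.inl rfl)
  rw [hone] at hst
  simp only [OneMemClass.coe_one, Units.val_one, Matrix.vecMul_one] at hst
  have hWpos : 0 < W.length := by
    cases L with
    | nil => simp at hw
    | cons p L =>
      have : 0 < r ^ vv p.2 := Nat.pow_pos hr.pos
      rw [hW, List.flatMap_cons, List.length_append, List.length_replicate]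
      omega
  have := hst.2 (Fin.last _) rfl
  rw [Pi.single_eq_of_ne] at this
  · exact hβ this.symm
  · intro h
    have := congrArg Fin.val h
    simp at this
    rw [this] at hWpos
    simp at hWpos
end magnus
end SurfOrb

set_option autoImplicit false
set_option linter.unusedSectionVars false
set_option linter.unusedVariables false
namespace SurfOrb
open Multiplicative
section resid
variable {r : ℕ} [Fact r.Prime] {P : Type} [Group P]

lemma PP_comm {A : Type} [CommGroup A] (l : List (A × A)) : PP l = 1 := by
  induction l with
  | nil => simp
  | cons p l ih => simp [ih, cm]

/-- orientation reversal -/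
def mirror {G : Type} (L : List (G × G)) : List (G × G) := (L.map Prod.swap).reverse

lemma PP_mirror {G : Type} [Group G] (L : List (G × G)) : PP (mirror L) = (PP L)⁻¹ := by
  induction L with
  | nil => simp [mirror]
  | cons p L ih =>
    have : mirror (p :: L) = mirror L ++ [p.swap] := by simp [mirror]
    rw [this, PP_append, ih, PP_cons, PP_cons, PP_nil]
    simp only [cm, Prod.fst_swap, Prod.snd_swap]
    group

lemma PP_replicate {G : Type} [Group G] (k : ℕ) : PP (List.replicate k ((1 : G), (1 : G))) = 1 := by
  induction k with
  | zero => simp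
  | succ k ih => rw [List.replicate_succ, PP_cons, ih]; simp [cm]

lemma flatMap_blocks {A : Type} (m N : ℕ) (F G : ℕ → List A) (hF : ∀ j, (F j).length = m)
    (hG : ∀ j, (G j).length = m) (h : (List.range N).flatMap F = (List.range N).flatMap G) :
    ∀ j < N, F j = G j := by
  induction N with
  | zero => intro j hj; omega
  | succ N ih =>
    rw [List.range_succ, List.flatMap_append, List.flatMap_append] at h
    obtain ⟨h1, h2⟩ := List.append_inj h (by simp [List.length_flatMap, hF, hG])
    intro j hj
    rcases Nat.lt_or_ge j N with hjN | hjN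
    · exact ih h1 j hjN
    · have : j = N := by omega
      subst this
      simpa using h2

/-- the increasing pieces of the kernel -/
def SN (a b : P) (rest : List (P × P)) (N : ℕ) : Subgroup P :=
  Subgroup.closure ({b} ∪ {x | ∃ j < N, ∃ y ∈ gens rest, x = a ^ j * y * (a ^ j)⁻¹})

variable {a b : P} {rest : List (P × P)}

lemma SN_mono {N N' : ℕ} (h : N ≤ N') : SN a b rest N ≤ SN a b rest N' := by
  apply Subgroup.closure_mono
  rintro x (hx | ⟨j, hj, y, hy, rfl⟩)
  · exact Or.inl hx
  · exact Or.inr ⟨j, by omega, y, hy, rfl⟩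

lemma SN_b (N : ℕ) : b ∈ SN a b rest N := Subgroup.subset_closure (Or.inl rfl)

lemma SN_gen {y : P} (hy : y ∈ gens rest) : y ∈ SN a b rest 1 :=
  Subgroup.subset_closure (Or.inr ⟨0, by omega, y, hy, by simp⟩)

lemma SN_PP : PP rest ∈ SN a b rest 1 := by
  obtain ⟨l', hl'⟩ := exists_lift_list (SN a b rest 1) rest (fun x hx => SN_gen hx)
  have h : (SN a b rest 1).subtype (PP l') = PP rest := by rw [← PP_mp, hl']
  rw [← h]
  exact (PP l').2

lemma SN_conj (hrel : PP ((a, b) :: rest) = 1) {N : ℕ} {x : P} (hx : x ∈ SN a b rest N) :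
    a * x * a⁻¹ ∈ SN a b rest (N + 1) := by
  have hR0 : PP rest = b * a * b⁻¹ * a⁻¹ := by
    rw [PP_cons, cm, mul_eq_one_iff_eq_inv'] at hrel
    rw [hrel]; group
  have hle : SN a b rest N ≤ (SN a b rest (N + 1)).comap (MulAut.conj a).toMonoidHom := by
    conv_lhs => rw [SN]
    rw [Subgroup.closure_le]
    rintro x (hx | ⟨j, hj, y, hy, rfl⟩)
    · rw [Set.mem_singleton_iff] at hx
      subst hx
      change a * x * a⁻¹ ∈ SN a x rest (N + 1)
      have : a * x * a⁻¹ = (PP rest)⁻¹ * x := by rw [hR0]; group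
      rw [this]
      exact mul_mem (inv_mem (SN_mono (by omega) SN_PP)) (SN_b _)
    · change a * (a ^ j * y * (a ^ j)⁻¹) * a⁻¹ ∈ SN a b rest (N + 1)
      refine Subgroup.subset_closure (Or.inr ⟨j + 1, by omega, y, hy, ?_⟩)
      rw [pow_succ']; group
  exact hle hx

lemma SN_conj_pow (hrel : PP ((a, b) :: rest) = 1) {N : ℕ} {x : P} (hx : x ∈ SN a b rest N) (p : ℕ) :
    a ^ p * x * (a ^ p)⁻¹ ∈ SN a b rest (N + p) := by
  induction p with
  | zero => simpa using hx
  | succ p ih =>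
    have := SN_conj hrel ih
    rw [← add_assoc]
    convert this using 1
    rw [pow_succ']; group

lemma SN_decomp (hm : Marked ((a, b) :: rest)) (y : P) :
    ∃ (p q N : ℕ) (s : P), s ∈ SN a b rest N ∧ y = (a ^ p)⁻¹ * s * a ^ q := by
  have hy : y ∈ Subgroup.closure (gens ((a, b) :: rest)) := by rw [hm.gen]; trivial
  induction hy using Subgroup.closure_induction with
  | mem x hx =>
    obtain ⟨p, hp, hx⟩ := hx
    rcases List.mem_cons.1 hp with rfl | hp
    · rcases hx with rfl | rfl
      · exact ⟨0, 1, 0, 1, one_mem _, by simp⟩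
      · exact ⟨0, 0, 0, _, SN_b _, by simp⟩
    · exact ⟨0, 0, 1, x, SN_gen ⟨p, hp, hx⟩, by simp⟩
  | one => exact ⟨0, 0, 0, 1, one_mem _, by simp⟩
  | mul x y _ _ hx hy =>
    obtain ⟨p, q, N, s, hs, rfl⟩ := hx
    obtain ⟨p', q', N', s', hs', rfl⟩ := hy
    rcases Nat.le_total p' q with h | h
    · obtain ⟨d, rfl⟩ := Nat.exists_eq_add_of_le h
      refine ⟨p, d + q', N + (N' + d), s * (a ^ d * s' * (a ^ d)⁻¹), mul_mem (SN_mono (by omega) hs)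
        (SN_mono (by omega) (SN_conj_pow hm.rel hs' d)), ?_⟩
      rw [pow_add a d q', add_comm p' d, pow_add a d p']
      group
    · obtain ⟨d, rfl⟩ := Nat.exists_eq_add_of_le h
      refine ⟨d + p, q', (N + d) + N', (a ^ d * s * (a ^ d)⁻¹) * s', mul_mem
        (SN_mono (by omega) (SN_conj_pow hm.rel hs d)) (SN_mono (by omega) hs'), ?_⟩
      rw [pow_add a d p, pow_add a q d]
      group
  | inv x _ hx =>
    obtain ⟨p, q, N, s, hs, rfl⟩ := hx
    exact ⟨q, p, N, s⁻¹, inv_mem hs, by group⟩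

theorem Kt_inter (hP : Surf P) (x : P) (hx : x ≠ 1) : ∃ j, x ∉ Kt P r j := by
  have hr : r.Prime := Fact.out
  obtain ⟨l, hl, h2⟩ := hP
  have hP : Surf P := ⟨l, hl, h2⟩
  obtain ⟨⟨a, b⟩, rest, rfl⟩ : ∃ p L, l = p :: L := by
    cases l with
    | nil => simp at h2
    | cons p L => exact ⟨p, L, rfl⟩
  obtain ⟨ε, hε⟩ := hl.lift (Multiplicative ℤ) ((ofAdd 1, 1) :: List.replicate rest.length (1, 1))
    (by simp) (PP_comm _)
  rw [mp_cons, List.cons.injEq, Prod.mk.injEq] at hε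
  obtain ⟨⟨εa, εb⟩, hrest⟩ := hε
  have εz : ∀ x ∈ gens rest, ε x = 1 := by
    rintro x ⟨p, hp, hx⟩
    have : (ε p.1, ε p.2) ∈ mp ε rest := List.mem_map.2 ⟨p, hp, rfl⟩
    rw [hrest] at this
    have := List.eq_of_mem_replicate this
    rw [Prod.mk.injEq] at this
    rcases hx with rfl | rfl
    · exact this.1
    · exact this.2
  let fk : (k : ℕ) → P →* MZ (r ^ k) := fun k =>
    (AddMonoidHom.toMultiplicative (Int.castAddHom (ZMod (r ^ k)))).comp ε
  have hfk : ∀ k y, fk k y = ofAdd ((toAdd (ε y) : ℤ) : ZMod (r ^ k)) := fun _ _ => rfl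
  by_cases hε0 : ε x = 1
  · obtain ⟨p, q, N, s, hs, hxs⟩ := SN_decomp hl x
    have hεs : ε s = 1 := by
      have : SN a b rest N ≤ ε.ker := by
        rw [SN, Subgroup.closure_le]
        rintro y (hy | ⟨j, hj, y, hy, rfl⟩)
        · rw [Set.mem_singleton_iff.1 hy]; exact εb
        · change ε _ = 1
          rw [map_mul, map_mul, εz y hy]; simp
      exact this hs
    have hpq : p = q := by
      rw [hxs] at hε0
      simp only [map_mul, map_inv, map_pow, εa, hεs] at hε0
      have := congrArg toAdd hε0
      simp at this
      omega
    subst hpq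
    have hs1 : s ≠ 1 := by rintro rfl; apply hx; rw [hxs]; simp
    suffices ∃ j, s ∉ Kt P r j by
      obtain ⟨j, hj⟩ := this
      refine ⟨j, fun h => hj ?_⟩
      have := (Kt_spec (r := r) hP j).1
      have hn : (Kt P r j).Normal := inferInstance
      have := hn.conj_mem x h (a ^ p)
      rw [hxs] at this
      convert this using 1
      group
    obtain ⟨k, hk⟩ : ∃ k, 2 * N ≤ r ^ k := ⟨2 * N, (Nat.lt_pow_self hr.one_lt).le⟩
    have : NeZero (r ^ k) := ⟨pow_ne_zero _ hr.ne_zero⟩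
    obtain ⟨t, bK, zK, ht, hb, hz, hM⟩ := hl.coverSurf (fk k) (by rw [hfk, εa]; simp)
      (by rw [hfk, εb]; simp) (fun y hy => by rw [hfk, εz y hy]; simp)
    generalize hf : fk k = f at t bK zK ht hb hz hM
    let Y := Option (Fin N × Fin zK.length × Bool)
    let η : FreeGroup Y →* f.ker := FreeGroup.lift (fun y => match y with
      | none => bK
      | some (j, i, false) => MulAut.conjNormal (H := f.ker) (a ^ j.val) (zK.get i).1
      | some (j, i, true) => MulAut.conjNormal (H := f.ker) (a ^ j.val) (zK.get i).2)
    have hrange : SN a b rest N ≤ (f.ker.subtype.comp η).range := by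
      rw [SN, Subgroup.closure_le]
      rintro y (hy | ⟨j, hj, y, hy, rfl⟩)
      · rw [Set.mem_singleton_iff.1 hy]
        exact ⟨FreeGroup.of none, by simp [η, hb]⟩
      · rw [← hz] at hy
        obtain ⟨p', hp', hy⟩ := hy
        obtain ⟨p'', hp'', rfl⟩ := List.mem_map.1 hp'
        obtain ⟨i, rfl⟩ := List.get_of_mem hp''
        rcases hy with rfl | rfl
        · refine ⟨FreeGroup.of (some (⟨j, hj⟩, i, false)), ?_⟩
          simp only [η, MonoidHom.comp_apply, FreeGroup.lift_apply_of]
          exact MulAut.conjNormal_apply _ _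
        · refine ⟨FreeGroup.of (some (⟨j, hj⟩, i, true)), ?_⟩
          simp only [η, MonoidHom.comp_apply, FreeGroup.lift_apply_of]
          exact MulAut.conjNormal_apply _ _
    obtain ⟨V, hV⟩ := hrange hs
    have hV1 : V ≠ 1 := by rintro rfl; apply hs1; rw [← hV, map_one]
    obtain ⟨n0, ρ, hρ⟩ := free_resid (r := r) V hV1
    let w : ℕ → List (UT n0 r × UT n0 r) := fun j => List.ofFn (fun i : Fin zK.length =>
      if hj : j < N then (ρ (FreeGroup.of (some (⟨j, hj⟩, i, false))),
        ρ (FreeGroup.of (some (⟨j, hj⟩, i, true)))) else (1, 1))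
    set L := (List.range N).flatMap w with hL
    have hLlen : L.length = N * zK.length := by simp [hL, List.length_flatMap, w]
    obtain ⟨F, hF⟩ := hM.lift (UT n0 r) ((1, ρ (FreeGroup.of none)) :: (L ++ (mirror L ++
      List.replicate ((r ^ k - 2 * N) * zK.length) (1, 1)))) (by
        rw [coverList_length]
        simp only [List.length_cons, List.length_append, hLlen, mirror, List.length_reverse,
          List.length_map, List.length_replicate, Nat.add_right_cancel_iff]
        rw [← add_mul, ← add_mul]
        congr 1
        omega) (by
        rw [PP_cons, PP_append, PP_append, PP_mirror, PP_replicate]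
        simp [cm])
    rw [coverList, mp_cons, List.cons.injEq, Prod.mk.injEq, mp_flatMap] at hF
    obtain ⟨⟨-, hFb⟩, hF⟩ := hF
    have hsplit : List.range (r ^ k) = List.range N ++ (List.range (r ^ k - N)).map (N + ·) := by
      rw [← List.range_add]; congr 1; omega
    rw [hsplit, List.flatMap_append] at hF
    have hF1 := (List.append_inj hF (by simp [List.length_flatMap, w, hL])).1
    have hF2 := flatMap_blocks zK.length N _ _ (by simp) (by simp [w]) hF1
    have hcomp : F.comp η = ρ := by
      apply FreeGroup.ext_hom
      rintro (_ | ⟨j, i, _ | _⟩)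
      · simpa [η] using hFb
      · have := hF2 j.val j.2
        have h3 := congrArg (fun l => l[i.val]?) this
        simp only [w, mp, List.getElem?_map, List.getElem?_ofFn, i.2, List.getElem?_eq_getElem,
          Option.map_some, dif_pos, j.2, Option.some.injEq, Prod.map, Prod.mk.injEq] at h3
        simp only [η, MonoidHom.comp_apply, FreeGroup.lift_apply_of]
        exact h3.1
      · have := hF2 j.val j.2
        have h3 := congrArg (fun l => l[i.val]?) this
        simp only [w, mp, List.getElem?_map, List.getElem?_ofFn, i.2, List.getElem?_eq_getElem,
          Option.map_some, dif_pos, j.2, Option.some.injEq, Prod.map, Prod.mk.injEq] at h3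
        simp only [η, MonoidHom.comp_apply, FreeGroup.lift_apply_of]
        exact h3.2
    refine Kt_detect hP k f (UT n0 r) isPGroup_UT F s ?_
    intro hsf
    have : (⟨s, hsf⟩ : f.ker) = η V := Subtype.ext hV.symm
    rw [this, ← MonoidHom.comp_apply, hcomp]
    exact hρ
  · refine Kt_detect hP ((toAdd (ε x)).natAbs) (fk _) (UT 0 r) isPGroup_UT 1 x ?_
    intro h
    exfalso
    apply hε0
    have h' : fk _ x = 1 := h
    rw [hfk] at h'
    have h3 := congrArg toAdd h'
    rw [toAdd_ofAdd, toAdd_one, ZMod.intCast_zmod_eq_zero_iff_dvd] at h3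
    have h4 := Int.natAbs_dvd_natAbs.2 h3
    rw [Int.natAbs_natCast] at h4
    apply toAdd.injective
    rw [toAdd_one]
    by_contra hne
    have h5 := Nat.le_of_dvd (Int.natAbs_pos.2 hne) h4
    exact absurd h5 (not_le.2 (Nat.lt_pow_self hr.one_lt))

/-- A level which is hit by a power of each element. -/
theorem exists_level (hP : Surf P) (T : Finset P) :
    ∃ I, ∀ t ∈ T, t ≠ 1 → ∃ m : ℕ, t ^ m ∈ Kt P r I ∧ t ^ m ∉ Kt P r (I + 1) := by
  have h1 : ∀ t : P, t ≠ 1 → ∃ i, t ∈ Kt P r i ∧ t ∉ Kt P r (i + 1) := by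
    intro t ht
    by_contra hcon
    push Not at hcon
    obtain ⟨j, hj⟩ := Kt_inter (r := r) hP t ht
    apply hj
    clear hj
    induction j with
    | zero => trivial
    | succ j ih => exact hcon j ih
  have h2 : ∀ (t : P) (i d : ℕ), t ∈ Kt P r i → t ∉ Kt P r (i + 1) →
      ∃ m : ℕ, t ^ m ∈ Kt P r (i + d) ∧ t ^ m ∉ Kt P r (i + d + 1) := by
    intro t i d hi hi'
    induction d with
    | zero => exact ⟨1, by simpa using hi, by simpa using hi'⟩
    | succ d ih =>
      obtain ⟨m, hm, hm'⟩ := ih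
      have := Psi_pow (Kt_spec (r := r) hP (i + d)).2.2 hm hm'
      rw [← pow_mul] at this
      exact ⟨m * r, this.1, this.2⟩
  choose! lev hlev using h1
  refine ⟨T.sup lev, fun t ht ht1 => ?_⟩
  obtain ⟨m, hm⟩ := h2 t (lev t) (T.sup lev - lev t) (hlev t ht1).1 (hlev t ht1).2
  have : lev t ≤ T.sup lev := Finset.le_sup ht
  rw [Nat.add_sub_cancel' this] at hm
  exact ⟨m, hm⟩
end resid
end SurfOrb

set_option autoImplicit false
set_option linter.unusedSectionVars false
set_option linter.unusedVariables false
namespace SurfOrb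
open Multiplicative
section walk

lemma exists_walk {V : Type} [Finite V] [Nonempty V] (R : V → V → Prop) (hrefl : ∀ a, R a a)
    (hconn : ∀ a b, Relation.ReflTransGen R a b) :
    ∃ w : ℕ → V, ∃ n0 : ℕ, (∀ i, R (w i) (w (i + 1))) ∧ ∀ v, ∃ i, i < n0 ∧ w i = v := by
  classical
  cases nonempty_fintype V
  have key : ∀ S : Finset V, ∃ w : ℕ → V, ∃ n0 : ℕ, (∀ i, R (w i) (w (i + 1))) ∧
      (∀ i, n0 ≤ i → w i = w n0) ∧ ∀ v ∈ S, ∃ i, i ≤ n0 ∧ w i = v := by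
    intro S
    induction S using Finset.induction_on with
    | empty =>
      exact ⟨fun _ => Classical.arbitrary V, 0, fun _ => hrefl _, fun _ _ => rfl, by simp⟩
    | insert a S ha ih =>
      obtain ⟨w, n0, h1, h2, h3⟩ := ih
      have ext : ∀ b, Relation.ReflTransGen R (w n0) b → ∃ w' : ℕ → V, ∃ n1 : ℕ, n0 ≤ n1 ∧
          (∀ i, R (w' i) (w' (i + 1))) ∧ (∀ i, n1 ≤ i → w' i = w' n1) ∧ w' n1 = b ∧
          ∀ i, i ≤ n0 → w' i = w i := by
        intro b hb
        induction hb with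
        | refl => exact ⟨w, n0, le_rfl, h1, h2, rfl, fun _ _ => rfl⟩
        | @tail b c hb hbc ih =>
          obtain ⟨w', n1, g1, g2, g3, g4, g5⟩ := ih
          refine ⟨fun i => if i ≤ n1 then w' i else c, n1 + 1, by omega, ?_, ?_, ?_, ?_⟩
          · intro i
            by_cases hi : i + 1 ≤ n1
            · simp only [hi, (by omega : i ≤ n1), if_true]; exact g2 i
            · by_cases hi' : i ≤ n1
              · have : i = n1 := by omega
                subst this
                simp only [hi, le_refl, if_true, if_false]
                rw [g4]; exact hbc
              · simp only [hi, hi', if_false]; exact hrefl c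
          · intro i hi
            exact (if_neg (by omega)).trans (if_neg (by omega)).symm
          · exact if_neg (by omega)
          · intro i hi
            simp only [(by omega : i ≤ n1), if_true]; exact g5 i hi
      obtain ⟨w', n1, g1, g2, g3, g4, g5⟩ := ext a (hconn _ _)
      refine ⟨w', n1, g2, g3, ?_⟩
      intro v hv
      rcases Finset.mem_insert.1 hv with rfl | hv
      · exact ⟨n1, le_rfl, g4⟩
      · obtain ⟨i, hi, e⟩ := h3 v hv
        exact ⟨i, by omega, by rw [g5 i hi, e]⟩
  obtain ⟨w, n0, h1, h2, h3⟩ := key Finset.univ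
  refine ⟨w, n0 + 1, h1, fun v => ?_⟩
  obtain ⟨i, hi, e⟩ := h3 v (Finset.mem_univ v)
  exact ⟨i, by omega, e⟩
end walk

section forms
variable {r : ℕ} [Fact r.Prime] {G : Type} [Group G]

/-- value of a form -/
def ev (f : G →* MZ r) (x : G) : ZMod r := toAdd (f x)

lemma ev_mul (f : G →* MZ r) (x y : G) : ev f (x * y) = ev f x + ev f y := by simp [ev]
lemma ev_inv (f : G →* MZ r) (x : G) : ev f x⁻¹ = - ev f x := by simp [ev]
lemma mul_ev (f f' : G →* MZ r) (x : G) : ev (f * f') x = ev f x + ev f' x := by simp [ev]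
lemma inv_ev (f : G →* MZ r) (x : G) : ev f⁻¹ x = - ev f x := by simp [ev]
lemma ev_eq_zero (f : G →* MZ r) (x : G) : ev f x = 0 ↔ f x = 1 := by
  unfold ev; exact Iff.rfl
lemma ev_pow (f : G →* MZ r) (x : G) (n : ℕ) : ev f (x ^ n) = n * ev f x := by
  simp [ev]

/-- rescale -/
def scl (c : ZMod r) (f : G →* MZ r) : G →* MZ r := f ^ c.val

lemma scl_ev (c : ZMod r) (f : G →* MZ r) (x : G) : ev (scl c f) x = c * ev f x := by
  have : NeZero r := ⟨(Fact.out : r.Prime).ne_zero⟩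
  simp [ev, scl]

/-- vanish on a handle list -/
def Van (f : G →* MZ r) (l : List (G × G)) : Prop := ∀ p ∈ l, ev f p.1 = 0 ∧ ev f p.2 = 0

lemma exists_form {l : List (G × G)} (h : Marked l) (l' : List (MZ r × MZ r))
    (hl : l'.length = l.length) : ∃ f : G →* MZ r, mp f l = l' := h.lift _ l' hl (PP_comm l')

lemma van_of_mp {f : G →* MZ r} {l : List (G × G)} {k : ℕ}
    (h : mp f l = List.replicate k (1, 1)) : Van f l := by
  intro p hp
  have : Prod.map f f p ∈ mp f l := List.mem_map.2 ⟨p, hp, rfl⟩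
  rw [h] at this
  have := List.eq_of_mem_replicate this
  rw [Prod.ext_iff] at this
  exact ⟨(ev_eq_zero _ _).2 this.1, (ev_eq_zero _ _).2 this.2⟩

lemma exists_two {l : List (G × G)} (h : Marked l) (hl : 2 ≤ l.length) {x : G}
    {f0 : G →* MZ r} (hf0 : f0 x ≠ 1) :
    ∃ (p q : G × G) (l' : List (G × G)), Marked (p :: q :: l') ∧ ∃ f1 f2 : G →* MZ r,
      ev f1 x ≠ 0 ∧ ev f2 x ≠ 0 ∧ Van f1 (q :: l') ∧ Van f2 (p :: l') := by
  have hne : f0 ≠ 1 := by rintro rfl; exact hf0 rfl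
  obtain ⟨l1, h1, hl1, e1⟩ := h.normalize f0 hne
  obtain ⟨n, hn⟩ : ∃ n, l.length = n + 2 := ⟨l.length - 2, by omega⟩
  rcases l1 with _ | ⟨p, _ | ⟨q, l2⟩⟩
  · simp at hl1; omega
  · simp at hl1; omega
  have hl2 : l2.length = n := by simp at hl1; omega
  have hs : l.length - 1 = n + 1 := by omega
  rw [mp_cons, hs, List.cons.injEq] at e1
  obtain ⟨e1, e2⟩ := e1
  have v0 : Van f0 (q :: l2) := van_of_mp e2
  rw [Prod.ext_iff] at e1
  have p1 : ev f0 p.1 = 1 := congrArg toAdd e1.1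
  have p2 : ev f0 p.2 = 0 := congrArg toAdd e1.2
  have hx : ev f0 x ≠ 0 := fun e => hf0 ((ev_eq_zero _ _).1 e)
  obtain ⟨α, hα⟩ := exists_form (r := r) h1 ((1, 1) :: (ofAdd 1, 1) :: List.replicate n (1, 1))
    (by simp [hl2])
  obtain ⟨β, hβ⟩ := exists_form (r := r) h1 ((1, 1) :: (1, ofAdd 1) :: List.replicate n (1, 1))
    (by simp [hl2])
  simp only [mp_cons, List.cons.injEq, Prod.mk.injEq] at hα hβ
  obtain ⟨⟨a1, a2⟩, ⟨a3, a4⟩, a5⟩ := hα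
  obtain ⟨⟨b1, b2⟩, ⟨b3, b4⟩, b5⟩ := hβ
  replace a1 := congrArg toAdd a1
  replace a2 := congrArg toAdd a2
  replace a3 := congrArg toAdd a3
  replace a4 := congrArg toAdd a4
  replace b1 := congrArg toAdd b1
  replace b2 := congrArg toAdd b2
  replace b3 := congrArg toAdd b3
  replace b4 := congrArg toAdd b4
  simp only [toAdd_one, toAdd_ofAdd] at a1 a2 a3 a4 b1 b2 b3 b4
  change ev α _ = _ at a1 a2 a3 a4
  change ev β _ = _ at b1 b2 b3 b4
  have va : Van α l2 := van_of_mp a5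
  have vb : Van β l2 := van_of_mp b5
  by_cases ha : ev α x = 0
  swap
  · refine ⟨p, q, l2, h1, f0, α, hx, ha, v0, ?_⟩
    intro s hs
    rcases List.mem_cons.1 hs with rfl | hs
    · exact ⟨a1, a2⟩
    · exact va s hs
  by_cases hb : ev β x = 0
  swap
  · refine ⟨p, q, l2, h1, f0, β, hx, hb, v0, ?_⟩
    intro s hs
    rcases List.mem_cons.1 hs with rfl | hs
    · exact ⟨b1, b2⟩
    · exact vb s hs
  have hC := h1.move Mv.C
  have q0 := v0 q (by simp)
  refine ⟨(p.1 * (gam p q)⁻¹, gam p q * p.2 * (gam p q)⁻¹), (gam p q * q.1, q.2), l2, hC,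
    f0, f0 * β * α⁻¹, hx, ?_, ?_, ?_⟩
  · rw [mul_ev, mul_ev, inv_ev, ha, hb]; simpa using hx
  · intro s hs
    rcases List.mem_cons.1 hs with rfl | hs
    · simp [gam, ev_mul, ev_inv, q0.1, q0.2, p2]
    · exact v0 s (List.mem_cons_of_mem _ hs)
  · intro s hs
    rcases List.mem_cons.1 hs with rfl | hs
    · simp [gam, ev_mul, ev_inv, mul_ev, inv_ev, q0.1, q0.2, p2, p1, a1, a2, a3, a4, b1, b2, b3, b4]
    · have u1 := v0 s (List.mem_cons_of_mem _ hs)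
      have u2 := va s hs
      have u3 := vb s hs
      simp [mul_ev, inv_ev, u1.1, u1.2, u2.1, u2.2, u3.1, u3.2]

/-- compatibility of consecutive forms -/
def Compat (l : List (G × G)) (f f' : G →* MZ r) : Prop :=
  ∀ p ∈ l, ev f p.1 * ev f' p.2 = ev f p.2 * ev f' p.1

lemma Compat.refl (l : List (G × G)) (f : G →* MZ r) : Compat l f f := fun p _ => mul_comm _ _
lemma Compat.symm {l : List (G × G)} {f f' : G →* MZ r} (h : Compat l f f') : Compat l f' f :=
  fun p hp => by rw [mul_comm, ← h p hp, mul_comm]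

lemma compat_conn {p q : G × G} {l : List (G × G)} (h : Marked (p :: q :: l)) {x : G}
    {f1 f2 : G →* MZ r} (h1 : ev f1 x = 1) (h2 : ev f2 x = 1) (v1 : Van f1 (q :: l))
    (v2 : Van f2 (p :: l)) (a b : {f : G →* MZ r // ev f x = 1}) :
    Relation.ReflTransGen (fun a b : {f : G →* MZ r // ev f x = 1} =>
      Compat (p :: q :: l) a.1 b.1) a b := by
  set L := p :: q :: l with hL
  let R := fun a b : {f : G →* MZ r // ev f x = 1} => Compat L a.1 b.1
  have hsymm : Std.Symm R := ⟨fun a b h => Compat.symm h⟩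
  have cross : ∀ f f' : G →* MZ r, Van f (q :: l) → ev f' p.1 = 0 → ev f' p.2 = 0 →
      Compat L f f' := by
    intro f f' hf e1 e2 s hs
    rcases List.mem_cons.1 hs with rfl | hs
    · rw [e1, e2, mul_zero, mul_zero]
    · rw [(hf s hs).1, (hf s hs).2, zero_mul, zero_mul]
  have p2 := v2 p (by simp)
  have c12 : R ⟨f1, h1⟩ ⟨f2, h2⟩ := cross _ _ v1 p2.1 p2.2
  have toBase : ∀ a, Relation.ReflTransGen R a ⟨f2, h2⟩ := by
    rintro ⟨f, hf⟩
    obtain ⟨fp, hfp⟩ := exists_form h ((f p.1, f p.2) :: List.replicate (l.length + 1) (1, 1))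
      (by simp [hL])
    rw [mp_cons, List.cons.injEq, Prod.mk.injEq] at hfp
    obtain ⟨⟨e1, e2⟩, e3⟩ := hfp
    have vp : Van fp (q :: l) := van_of_mp e3
    replace e1 : ev fp p.1 = ev f p.1 := congrArg toAdd e1
    replace e2 : ev fp p.2 = ev f p.2 := congrArg toAdd e2
    by_cases hx : ev fp x = 0
    · have hx' : ev (f * fp⁻¹) x = 1 := by rw [mul_ev, inv_ev, hx, hf]; simp
      have z1 : ev (f * fp⁻¹) p.1 = 0 := by rw [mul_ev, inv_ev, e1]; simp
      have z2 : ev (f * fp⁻¹) p.2 = 0 := by rw [mul_ev, inv_ev, e2]; simp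
      have r1 : R ⟨f, hf⟩ ⟨f * fp⁻¹, hx'⟩ := by
        intro s hs
        change ev f s.1 * ev (f * fp⁻¹) s.2 = ev f s.2 * ev (f * fp⁻¹) s.1
        rcases List.mem_cons.1 hs with rfl | hs
        · rw [z1, z2, mul_zero, mul_zero]
        · rw [mul_ev, mul_ev, inv_ev, inv_ev, (vp s hs).1, (vp s hs).2]; ring
      have r2 : R ⟨f * fp⁻¹, hx'⟩ ⟨f1, h1⟩ := Compat.symm (cross _ _ v1 z1 z2)
      exact ((Relation.ReflTransGen.single r1).tail r2).tail c12
    · have hx' : ev (scl (ev fp x)⁻¹ fp) x = 1 := by rw [scl_ev, inv_mul_cancel₀ hx]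
      have vp' : Van (scl (ev fp x)⁻¹ fp) (q :: l) := fun s hs => by
        rw [scl_ev, scl_ev, (vp s hs).1, (vp s hs).2]; simp
      have r1 : R ⟨f, hf⟩ ⟨scl (ev fp x)⁻¹ fp, hx'⟩ := by
        intro s hs
        change ev f s.1 * ev (scl (ev fp x)⁻¹ fp) s.2 = ev f s.2 * ev (scl (ev fp x)⁻¹ fp) s.1
        rcases List.mem_cons.1 hs with rfl | hs
        · rw [scl_ev, scl_ev, e1, e2]; ring
        · rw [(vp' s hs).1, (vp' s hs).2, mul_zero, mul_zero]
      have r2 : R ⟨scl (ev fp x)⁻¹ fp, hx'⟩ ⟨f2, h2⟩ := cross _ _ vp' p2.1 p2.2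
      exact (Relation.ReflTransGen.single r1).tail r2
  have hs : Std.Symm (Relation.ReflTransGen R) := inferInstance
  exact (toBase a).trans (hs.symm _ _ (toBase b))

end forms
end SurfOrb

set_option autoImplicit false
set_option linter.unusedSectionVars false
set_option linter.unusedVariables false
namespace SurfOrb
open Multiplicative
section rep
variable {r : ℕ} [Fact r.Prime] {G : Type} [Group G] {n : ℕ}

/-- superdiagonal matrix -/
def sd (n r : ℕ) (d : ℕ → ZMod r) : Mat n r :=
  Matrix.of fun i j => if j.val = i.val + 1 then d i.val else 0

lemma sd_mem (d : ℕ → ZMod r) : sd n r d ∈ SU n r 1 := by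
  intro i j h
  change (if j.val = i.val + 1 then d i.val else 0) = 0
  rw [if_neg (by omega)]

lemma sd_mul (d d' : ℕ → ZMod r) (i j : Fin n) :
    (sd n r d * sd n r d') i j = if j.val = i.val + 2 then d i.val * d' (i.val + 1) else 0 := by
  rw [Matrix.mul_apply]
  split_ifs with h
  · rw [Finset.sum_eq_single ⟨i.val + 1, by omega⟩]
    · simp [sd, h]
    · intro m _ hm
      have : m.val ≠ i.val + 1 := fun e => hm (Fin.ext e)
      simp [sd, this]
    · simp
  · apply Finset.sum_eq_zero
    intro m _
    simp only [sd, Matrix.of_apply]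
    split_ifs with h1 h2 <;> first | omega | simp

lemma sd_comm (d d' : ℕ → ZMod r) (h : ∀ i, d i * d' (i + 1) = d' i * d (i + 1)) :
    sd n r d * sd n r d' = sd n r d' * sd n r d := by
  ext i j
  rw [sd_mul, sd_mul, h]

lemma exists_rep {l : List (G × G)} (h : Marked l) (w : ℕ → (G →* MZ r))
    (hw : ∀ i, Compat l (w i) (w (i + 1))) (n : ℕ) :
    ∃ M : G →* UT n r, ∀ z, ∀ i j : Fin n, j.val = i.val + 1 →
      (((M z : UT n r) : (Mat n r)ˣ) : Mat n r) i j = ev (w i) z := by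
  let U : G → UT n r := fun z => mkU (sd n r fun i => ev (w i) z) (sd_mem _)
  have hPP : PP (l.map (Prod.map U U)) = 1 := by
    unfold PP
    apply List.prod_eq_one
    intro y hy
    simp only [List.map_map, List.mem_map] at hy
    obtain ⟨p, hp, rfl⟩ := hy
    have hc : U p.1 * U p.2 = U p.2 * U p.1 := by
      apply Subtype.ext
      apply Units.ext
      change (1 + sd n r fun i => ev (w i) p.1) * (1 + sd n r fun i => ev (w i) p.2) =
        (1 + sd n r fun i => ev (w i) p.2) * (1 + sd n r fun i => ev (w i) p.1)
      have := sd_comm (n := n) (fun i => ev (w i) p.1) (fun i => ev (w i) p.2)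
        (fun i => hw i p hp)
      rw [mul_add, add_mul, add_mul, mul_add, add_mul, add_mul, this]
      simp only [one_mul, mul_one]
      abel
    change U p.1 * U p.2 * (U p.1)⁻¹ * (U p.2)⁻¹ = 1
    rw [hc]; group
  obtain ⟨M, hM⟩ := h.lift (UT n r) (l.map (Prod.map U U)) (by simp) hPP
  refine ⟨M, fun z i j hij => ?_⟩
  have e : (entryHom n r 1 le_rfl i j hij).comp M = w i := by
    apply h.ext
    rw [← mp_mp, hM]
    unfold mp
    rw [List.map_map]
    apply List.map_congr_left
    intro p hp
    have : ∀ z, entryHom n r 1 le_rfl i j hij (U z) = w i z := by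
      intro z
      change ofAdd ((1 + sd n r fun i => ev (w i) z) i j) = w i z
      rw [Matrix.add_apply, Matrix.one_apply_ne (by rintro rfl; omega)]
      simp [sd, hij, ev]
    exact Prod.ext (this _) (this _)
  have := DFunLike.congr_fun e z
  exact congrArg toAdd this

/-- the corner representation attached to `x` -/
lemma corner_rep (hG : Surf G) (x : G) {f0 : G →* MZ r} (hf0 : f0 x ≠ 1) :
    ∃ n0 : ℕ, ∀ e : ℕ, n0 ≤ r ^ e → ∃ M : G →* UT (r ^ e + 1) r, ∀ u : G,
      (((M u ^ r ^ e : UT (r ^ e + 1) r) : (Mat (r ^ e + 1) r)ˣ) : Mat (r ^ e + 1) r) - 1 ∈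
        SU (r ^ e + 1) r (r ^ e) ∧
      ((((M u ^ r ^ e : UT (r ^ e + 1) r) : (Mat (r ^ e + 1) r)ˣ) : Mat (r ^ e + 1) r)
        0 (Fin.last _) ≠ 0 ↔ ∀ f : G →* MZ r, ev f x = 1 → ev f u ≠ 0) := by
  have hr : r.Prime := Fact.out
  obtain ⟨l0, h0, hl0⟩ := hG
  obtain ⟨p, q, l, hM, f1, f2, h1, h2, v1, v2⟩ := exists_two h0 hl0 hf0
  have : Finite (G →* MZ r) := by
    have : NeZero r := ⟨hr.ne_zero⟩
    exact Surf.finite_hom ⟨l0, h0, hl0⟩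
  have sv : ∀ (c : ZMod r) (f : G →* MZ r) L, Van f L → Van (scl c f) L := fun c f L hv s hs => by
    rw [scl_ev, scl_ev, (hv s hs).1, (hv s hs).2]; simp
  have e1 : ev (scl (ev f1 x)⁻¹ f1) x = 1 := by rw [scl_ev, inv_mul_cancel₀ h1]
  have e2 : ev (scl (ev f2 x)⁻¹ f2) x = 1 := by rw [scl_ev, inv_mul_cancel₀ h2]
  have : Nonempty {f : G →* MZ r // ev f x = 1} := ⟨⟨_, e1⟩⟩
  obtain ⟨w, n0, hw, hcov⟩ := exists_walk (V := {f : G →* MZ r // ev f x = 1})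
    (fun a b => Compat (p :: q :: l) a.1 b.1) (fun a => Compat.refl _ _)
    (compat_conn hM e1 e2 (sv _ _ _ v1) (sv _ _ _ v2))
  refine ⟨n0, fun e he => ?_⟩
  obtain ⟨M, hMM⟩ := exists_rep hM (fun i => (w i).1) hw (r ^ e + 1)
  refine ⟨M, fun u => ?_⟩
  set A : Mat (r ^ e + 1) r := (((M u : UT (r ^ e + 1) r) : (Mat (r ^ e + 1) r)ˣ) :
    Mat (r ^ e + 1) r) - 1 with hA
  have hAmem : A ∈ SU (r ^ e + 1) r 1 := (M u).2
  have hpow : (((M u ^ r ^ e : UT (r ^ e + 1) r) : (Mat (r ^ e + 1) r)ˣ) : Mat (r ^ e + 1) r)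
      = 1 + A ^ r ^ e := by
    rw [← one_add_pow_r, hA, add_sub_cancel]
    simp
  have hpos : 0 < r ^ e := Nat.pow_pos hr.pos
  have hent := SU_pow_entry hAmem (r ^ e) (fun i => ev (w i).1 u) (by
    intro i j hij
    rw [hA, Matrix.sub_apply, Matrix.one_apply_ne (by rintro rfl; omega), sub_zero, hMM u i j hij])
    (Fin.last _) 0 (by simp)
  rw [hpow]
  refine ⟨by rw [add_sub_cancel_left]; exact SU_pow hAmem _, ?_⟩
  rw [Matrix.add_apply, Matrix.one_apply_ne (by
    intro h; have := congrArg Fin.val h; simp at this; omega), zero_add, hent,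
    Finset.prod_ne_zero_iff]
  constructor
  · intro h f hf
    obtain ⟨i, hi, e⟩ := hcov ⟨f, hf⟩
    have := h i (Finset.mem_range.2 (by omega))
    simp only [Fin.val_zero, zero_add, e] at this
    exact this
  · intro h i hi
    exact h _ (w _).2

/-- proportionality -/
lemma prop_of_ne {x u : G} {f0 : G →* MZ r} (hf0 : ev f0 x = 1)
    (h : ∀ f : G →* MZ r, ev f x = 1 → ev f u ≠ 0) :
    ∃ c : ZMod r, c ≠ 0 ∧ ∀ f : G →* MZ r, ev f u = c * ev f x := by
  have ker : ∀ f : G →* MZ r, ev f x = 0 → ev f u = 0 := by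
    intro f hf
    by_contra hne
    apply h (f0 * scl (-(ev f0 u) / ev f u) f)
    · rw [mul_ev, scl_ev, hf, hf0]; simp
    · rw [mul_ev, scl_ev]; field_simp; ring
  refine ⟨ev f0 u, h f0 hf0, fun f => ?_⟩
  have := ker (f * scl (-(ev f x)) f0) (by rw [mul_ev, scl_ev, hf0]; ring)
  rw [mul_ev, scl_ev] at this
  linear_combination this

/-- the character -/
lemma exists_char (r : ℕ) [Fact r.Prime] (hG : Surf G) :
    ∃ (N : ℕ) (Q : Type) (_ : Group Q) (_ : Finite Q) (_ : IsPGroup r Q) (M : G →* Q)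
      (C0 : Subgroup Q) (χ : C0 →* MZ r), ∀ u : G, (∃ f : G →* MZ r, f u ≠ 1) →
        ∃ h : M u ^ N ∈ C0, χ ⟨_, h⟩ ≠ 1 := by
  classical
  have hr : r.Prime := Fact.out
  have : NeZero r := ⟨hr.ne_zero⟩
  have : Finite (G →* MZ r) := hG.finite_hom
  let G' := {u : G // ∃ f : G →* MZ r, f u ≠ 1}
  let S : Setoid G' :=
    { r := fun u v => ∃ c : ZMod r, c ≠ 0 ∧ ∀ f : G →* MZ r, ev f u.1 = c * ev f v.1
      iseqv := by
        refine ⟨fun u => ⟨1, one_ne_zero, fun f => (one_mul _).symm⟩, ?_, ?_⟩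
        · rintro u v ⟨c, hc, h⟩
          exact ⟨c⁻¹, inv_ne_zero hc, fun f => by rw [h f, ← mul_assoc, inv_mul_cancel₀ hc, one_mul]⟩
        · rintro u v z ⟨c, hc, h⟩ ⟨c', hc', h'⟩
          exact ⟨c * c', mul_ne_zero hc hc', fun f => by rw [h f, h' f, mul_assoc]⟩ }
  let evf : G' → ((G →* MZ r) → ZMod r) := fun u f => ev f u.1
  have hfin : Finite (Quotient S) := by
    apply Finite.of_surjective (fun φ : Set.range evf => (Quotient.mk S φ.2.choose))
    intro s
    induction s using Quotient.inductionOn with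
    | _ u =>
      refine ⟨⟨evf u, u, rfl⟩, Quotient.sound ⟨1, one_ne_zero, fun f => ?_⟩⟩
      have hh : ∃ y, evf y = evf u := ⟨u, rfl⟩
      rw [one_mul]
      exact congrFun hh.choose_spec f
  have key : ∀ s : Quotient S, ∃ n0 : ℕ, ∀ e : ℕ, n0 ≤ r ^ e → ∃ M : G →* UT (r ^ e + 1) r,
      ∀ u : G,
      (((M u ^ r ^ e : UT (r ^ e + 1) r) : (Mat (r ^ e + 1) r)ˣ) : Mat (r ^ e + 1) r) - 1 ∈
        SU (r ^ e + 1) r (r ^ e) ∧ ∀ hu : (∃ f : G →* MZ r, f u ≠ 1),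
      ((((M u ^ r ^ e : UT (r ^ e + 1) r) : (Mat (r ^ e + 1) r)ˣ) : Mat (r ^ e + 1) r)
        0 (Fin.last _) ≠ 0 ↔ Quotient.mk S ⟨u, hu⟩ = s) := by
    intro s
    induction s using Quotient.inductionOn with
    | _ x =>
      obtain ⟨x, f0, hf0⟩ := x
      obtain ⟨n0, h⟩ := corner_rep hG x hf0
      refine ⟨n0, fun e he => ?_⟩
      obtain ⟨M, hM⟩ := h e he
      refine ⟨M, fun u => ⟨(hM u).1, fun hu => ?_⟩⟩
      rw [(hM u).2]
      have hx : ev f0 x ≠ 0 := fun e => hf0 ((ev_eq_zero _ _).1 e)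
      constructor
      · intro h
        exact Quotient.sound (prop_of_ne (f0 := scl (ev f0 x)⁻¹ f0)
          (by rw [scl_ev, inv_mul_cancel₀ hx]) h)
      · intro h f hf
        obtain ⟨c, hc, h⟩ := Quotient.exact h
        have := h f
        simp only at this
        rw [this, hf, mul_one]; exact hc
  choose n0 hn0 using key
  cases nonempty_fintype (Quotient S)
  obtain ⟨e, he⟩ : ∃ e : ℕ, ∀ s, n0 s ≤ r ^ e :=
    ⟨∑ s, n0 s, fun s => (Finset.single_le_sum (fun _ _ => Nat.zero_le _) (Finset.mem_univ s)).trans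
      (Nat.lt_pow_self hr.one_lt).le⟩
  choose M hM1 using fun s => hn0 s e (he s)
  have hpos : 1 ≤ r ^ e := Nat.pow_pos hr.pos
  let Q := Quotient S → UT (r ^ e + 1) r
  let C0 : Subgroup Q := Subgroup.pi Set.univ fun _ =>
    (UTk (r ^ e + 1) r (r ^ e) hpos).subgroupOf (UT (r ^ e + 1) r)
  let κ : ∀ s, C0 →* UTk (r ^ e + 1) r (r ^ e) hpos := fun s =>
    MonoidHom.codRestrict ((UT (r ^ e + 1) r).subtype.comp
      ((Pi.evalMonoidHom (fun _ : Quotient S => UT (r ^ e + 1) r) s).comp C0.subtype)) _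
      (fun q => q.2 s (Set.mem_univ s))
  let χ : C0 →* MZ r := ∏ s, (entryHom (r ^ e + 1) r (r ^ e) hpos 0 (Fin.last _) (by simp)).comp (κ s)
  refine ⟨r ^ e, Q, inferInstance, inferInstance, ?_, MonoidHom.mk' (fun u s => M s u)
    (fun a b => by funext s; exact map_mul (M s) a b), C0, χ, ?_⟩
  · intro q
    refine ⟨r ^ e + 1, ?_⟩
    funext s
    exact Subtype.ext (units_pow_eq_one (q s).2)
  · intro u hu
    refine ⟨fun s _ => (hM1 s u).1, ?_⟩
    intro hχ
    rw [MonoidHom.finsetProd_apply, Finset.prod_eq_single (Quotient.mk S ⟨u, hu⟩)] at hχ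
    · exact (((hM1 _ u).2 hu).2 rfl) hχ
    · intro s _ hs
      by_contra hne
      exact hs ((((hM1 s u).2 hu).1 hne).symm)
    · simp
end rep
end SurfOrb

set_option autoImplicit false
set_option linter.unusedSectionVars false
set_option linter.unusedVariables false
namespace SurfOrb
open Multiplicative
section coho
variable {P : Type} [Group P] {V : Type} [AddCommGroup V] [Module ℂ V]

/-- action on the multiplicative copy of a representation -/
def actAut (ρ : Representation ℂ P V) : P →* MulAut (Multiplicative V) where
  toFun x :=
    { toFun := fun v => ofAdd (ρ x (toAdd v))
      invFun := fun v => ofAdd (ρ x⁻¹ (toAdd v))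
      left_inv := fun v => by simp
      right_inv := fun v => by simp
      map_mul' := fun v w => by simp }
  map_one' := by ext v; simp
  map_mul' x y := by ext v; simp

lemma actAut_apply (ρ : Representation ℂ P V) (x : P) (v : Multiplicative V) :
    actAut ρ x v = ofAdd (ρ x (toAdd v)) := rfl

/-- the semidirect product -/
abbrev SD (ρ : Representation ℂ P V) := Multiplicative V ⋊[actAut ρ] P

/-- one handle of the Fox derivative of the relator -/
def foxD (ρ : Representation ℂ P V) (p : P × P) : V × V →ₗ[ℂ] V :=
  LinearMap.fst ℂ V V + ρ p.1 ∘ₗ LinearMap.snd ℂ V V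
    - ρ (p.1 * p.2 * p.1⁻¹) ∘ₗ LinearMap.fst ℂ V V - ρ (cm p) ∘ₗ LinearMap.snd ℂ V V

lemma cm_left (ρ : Representation ℂ P V) (p : P × P) (v : V × V) :
    cm ((⟨ofAdd v.1, p.1⟩, ⟨ofAdd v.2, p.2⟩) :
      (Multiplicative V ⋊[actAut ρ] P) × (Multiplicative V ⋊[actAut ρ] P)) =
      ⟨ofAdd (foxD ρ p v), cm p⟩ := by
  apply SemidirectProduct.ext
  · apply toAdd.injective
    simp [cm, foxD, actAut_apply]
    abel
  · simp [cm]

lemma exists_crossed {p q : P × P} {l : List (P × P)} (h : Marked (p :: q :: l))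
    (ρ : Representation ℂ P V) (v v' : V × V)
    (hv : foxD ρ p v + ρ (cm p) (foxD ρ q v') = 0) :
    ∃ c : P → V, (∀ x y, c (x * y) = c x + ρ x (c y)) ∧
      ((c p.1, c p.2), (c q.1, c q.2)) = (v, v') := by
  let inr : P →* SD ρ := SemidirectProduct.inr
  let l' : List (SD ρ × SD ρ) := (⟨ofAdd v.1, p.1⟩, ⟨ofAdd v.2, p.2⟩) ::
    (⟨ofAdd v'.1, q.1⟩, ⟨ofAdd v'.2, q.2⟩) :: mp inr l
  have hrel : cm p * (cm q * PP l) = 1 := by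
    have := h.rel
    rwa [PP_cons, PP_cons] at this
  have hPP : PP l' = 1 := by
    change PP (_ :: _ :: _) = 1
    rw [PP_cons, PP_cons, cm_left, cm_left, PP_mp]
    apply SemidirectProduct.ext
    · apply toAdd.injective
      simp [inr, actAut_apply, hv]
    · simpa [inr] using hrel
  obtain ⟨M, hM⟩ := h.lift (SD ρ) l' (by simp [l']) hPP
  have hright : (SemidirectProduct.rightHom : SD ρ →* P).comp M = MonoidHom.id P := by
    apply h.ext
    rw [← mp_mp, hM]
    simp only [l', mp_cons, mp_mp]
    simp [mp, inr]
  have hr : ∀ x, (M x).right = x := fun x => DFunLike.congr_fun hright x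
  refine ⟨fun x => toAdd (M x).left, ?_, ?_⟩
  · intro x y
    simp only [map_mul, SemidirectProduct.mul_left, toAdd_mul, actAut_apply, toAdd_ofAdd, hr]
  · simp only [l', mp_cons, List.cons.injEq, Prod.mk.injEq] at hM
    obtain ⟨⟨h1, h2⟩, ⟨h3, h4⟩, -⟩ := hM
    simp [h1, h2, h3, h4]

lemma exists_cocycle [FiniteDimensional ℂ V] [Nontrivial V] (hP : Surf P)
    (ρ : Representation ℂ P V) (R : Subgroup P) [R.Normal] [R.FiniteIndex]
    (hR : ∀ y ∈ R, ρ y = 1) :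
    ∃ c : P → V, (∀ x y, c (x * y) = c x + ρ x (c y)) ∧ ∃ y ∈ R, c y ≠ 0 := by
  obtain ⟨l, h, hl⟩ := hP
  rcases l with _ | ⟨p, _ | ⟨q, l⟩⟩
  · simp at hl
  · simp at hl
  let T : (V × V) × (V × V) →ₗ[ℂ] V :=
    foxD ρ p ∘ₗ LinearMap.fst ℂ _ _ + ρ (cm p) ∘ₗ foxD ρ q ∘ₗ LinearMap.snd ℂ _ _
  let B : P → V →ₗ[ℂ] V := fun x => LinearMap.id - ρ x
  let δ : V →ₗ[ℂ] (V × V) × (V × V) := ((B p.1).prod (B p.2)).prod ((B q.1).prod (B q.2))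
  have hnot : ¬ LinearMap.ker T ≤ LinearMap.range δ := by
    intro hle
    have h1 := Submodule.finrank_mono hle
    have h2 := LinearMap.finrank_range_add_finrank_ker T
    have h3 := LinearMap.finrank_range_le δ
    have h4 := Submodule.finrank_le (LinearMap.range T)
    have h5 : 0 < Module.finrank ℂ V := Module.finrank_pos
    simp only [Module.finrank_prod] at h2
    omega
  obtain ⟨⟨v, v'⟩, hv, hv'⟩ := SetLike.not_le_iff_exists.1 hnot
  obtain ⟨c, hc, hcv⟩ := exists_crossed h ρ v v' hv
  refine ⟨c, hc, ?_⟩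
  by_contra hno
  push Not at hno
  apply hv'
  have hcR : ∀ x, ∀ y ∈ R, c (x * y) = c x := fun x y hy => by
    rw [hc, hno y hy, map_zero, add_zero]
  let cb : P ⧸ R → V := fun s => Quotient.liftOn' s c (fun a b hab => by
    have := hcR a (a⁻¹ * b) (QuotientGroup.leftRel_apply.1 hab)
    rw [mul_inv_cancel_left] at this
    exact this.symm)
  have hcb : ∀ x : P, cb (x : P ⧸ R) = c x := fun x => rfl
  have : Fintype (P ⧸ R) := Fintype.ofFinite _
  let w : V := ∑ s, cb s
  have hw : ∀ x, ρ x w = w - (Fintype.card (P ⧸ R) : ℂ) • c x := by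
    intro x
    have e1 : ∀ s, ρ x (cb s) = cb ((x : P ⧸ R) * s) - c x := by
      intro s
      induction s using QuotientGroup.induction_on with
      | _ y =>
        rw [← QuotientGroup.mk_mul, hcb, hcb, hc]; abel
    have e2 : ∑ s, cb ((x : P ⧸ R) * s) = ∑ s, cb s :=
      Equiv.sum_comp (Equiv.mulLeft (x : P ⧸ R)) cb
    change ρ x (∑ s, cb s) = _
    rw [map_sum, Finset.sum_congr rfl (fun s _ => e1 s), Finset.sum_sub_distrib,
      e2]
    simp [w, Nat.cast_smul_eq_nsmul]
  have hn : (Fintype.card (P ⧸ R) : ℂ) ≠ 0 := by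
    exact_mod_cast Fintype.card_ne_zero
  refine ⟨(Fintype.card (P ⧸ R) : ℂ)⁻¹ • w, ?_⟩
  have hB : ∀ x, B x ((Fintype.card (P ⧸ R) : ℂ)⁻¹ • w) = c x := by
    intro x
    change (Fintype.card (P ⧸ R) : ℂ)⁻¹ • w - ρ x ((Fintype.card (P ⧸ R) : ℂ)⁻¹ • w) = _
    rw [map_smul (ρ x), hw, smul_sub, smul_smul, inv_mul_cancel₀ hn, one_smul]
    simp
  rw [← hcv]
  exact Prod.ext (Prod.ext (hB _) (hB _)) (Prod.ext (hB _) (hB _))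

lemma proper_of_cocycle (ρ : Representation ℂ P V) (R : Subgroup P)
    (hR : ∀ y ∈ R, ρ y = 1) (c : P → V) (hc : ∀ x y, c (x * y) = c x + ρ x (c y))
    (hcy : ∃ y ∈ R, c y ≠ 0) (O : Set P) (hO : ∀ x ∈ O, ∀ v, ρ x v = v → v = 0) :
    OHomology R O ≠ ⊤ := by
  let f : R →* Multiplicative V := MonoidHom.mk' (fun y => ofAdd (c y)) (fun a b => by
    rw [← ofAdd_add, Subgroup.coe_mul, hc, hR a a.2]; rfl)
  let F : Additive (Abelianization R) →+ V := MonoidHom.toAdditiveLeft (Abelianization.lift f)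
  have hF : ∀ y : R, F (Additive.ofMul (Abelianization.of y)) = c y := by
    intro y
    change toAdd (Abelianization.lift f (Abelianization.of y)) = _
    rw [Abelianization.lift_apply_of]; rfl
  let _ : Module ℚ V := Module.compHom V (algebraMap ℚ ℂ)
  let Φ : (TensorProduct ℤ ℚ (Additive (Abelianization R))) →ₗ[ℚ] V :=
    LinearMap.liftBaseChange ℚ F.toIntLinearMap
  have hΦ : ∀ y : R, Φ (1 ⊗ₜ Additive.ofMul (Abelianization.of y)) = c y := by
    intro y
    change LinearMap.liftBaseChange ℚ F.toIntLinearMap _ = _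
    rw [LinearMap.liftBaseChange_tmul, one_smul]
    exact hF y
  have hle : OHomology R O ≤ LinearMap.ker Φ := by
    refine Submodule.span_le.2 ?_
    rintro v ⟨x, hx, m, hm, rfl⟩
    change Φ _ = 0
    rw [hΦ]
    apply hO x hx
    have h1 : x * x ^ m = x ^ m * x := by group
    have h2 := hc x (x ^ m)
    rw [h1, hc, hR _ hm] at h2
    change c (x ^ m) + c x = _ at h2
    rw [add_comm] at h2
    exact (add_left_cancel h2).symm
  intro htop
  obtain ⟨y, hy, hne⟩ := hcy
  apply hne
  rw [← hΦ ⟨y, hy⟩]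
  have : (1 : ℚ) ⊗ₜ[ℤ] Additive.ofMul (Abelianization.of (⟨y, hy⟩ : R)) ∈ OHomology R O := by
    rw [htop]; trivial
  exact hle this
end coho

section induced
variable {P : Type} [Group P]

/-- induced representation space -/
def indV (C : Subgroup P) (χ : C →* ℂˣ) : Submodule ℂ (P → ℂ) where
  carrier := {F | ∀ (c : C) (y : P), F (c * y) = χ c * F y}
  zero_mem' := fun c y => by simp
  add_mem' := fun {F F'} h h' c y => by simp only [Pi.add_apply]; rw [h, h']; ring
  smul_mem' := fun a F h c y => by simp only [Pi.smul_apply, smul_eq_mul]; rw [h]; ring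

/-- right translation -/
def indRep (C : Subgroup P) (χ : C →* ℂˣ) : Representation ℂ P (indV C χ) where
  toFun x :=
    { toFun := fun F => ⟨fun y => F.1 (y * x), fun c y => by
        change F.1 (c * y * x) = χ c * F.1 (y * x)
        rw [mul_assoc]; exact F.2 c _⟩
      map_add' := fun _ _ => rfl
      map_smul' := fun _ _ => rfl }
  map_one' := by
    ext F y
    change F.1 (y * 1) = F.1 y
    rw [mul_one]
  map_mul' x x' := by
    ext F y
    change F.1 (y * (x * x')) = F.1 (y * x * x')
    rw [mul_assoc]

lemma indRep_apply (C : Subgroup P) (χ : C →* ℂˣ) (x y : P) (F : indV C χ) :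
    (indRep C χ x F).1 y = F.1 (y * x) := rfl

lemma proper_of_char (hP : Surf P) (R : Subgroup P) [R.Normal] [R.FiniteIndex] (C : Subgroup P)
    (hRC : R ≤ C) (χ : C →* ℂˣ) (hχ : ∀ y (hy : y ∈ R), χ ⟨y, hRC hy⟩ = 1) (O : Set P)
    (hO : ∀ x ∈ O, ∀ y : P, ∃ m : ℕ, ∃ h : (y * x * y⁻¹) ^ m ∈ C, χ ⟨_, h⟩ ≠ 1) :
    OHomology R O ≠ ⊤ := by
  classical
  have inv : ∀ (F : indV C χ) (y z : P), z ∈ R → F.1 (y * z) = F.1 y := by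
    intro F y z hz
    have hz' : y * z * y⁻¹ ∈ R := Subgroup.Normal.conj_mem inferInstance z hz y
    have := F.2 ⟨_, hRC hz'⟩ y
    rw [hχ _ hz'] at this
    simpa using this
  have hR : ∀ y ∈ R, indRep C χ y = 1 := by
    intro y hy
    apply LinearMap.ext
    intro F
    apply Subtype.ext
    funext z
    exact inv F z y hy
  have hfd : FiniteDimensional ℂ (indV C χ) := by
    let Φ : indV C χ →ₗ[ℂ] (P ⧸ R → ℂ) :=
      { toFun := fun F s => F.1 s.out
        map_add' := fun _ _ => rfl
        map_smul' := fun _ _ => rfl }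
    apply FiniteDimensional.of_injective Φ
    intro F F' h
    apply Subtype.ext
    funext y
    obtain ⟨z, hz⟩ := QuotientGroup.mk_out_eq_mul R y
    have := congrFun h (y : P ⧸ R)
    change F.1 _ = F'.1 _ at this
    rw [hz, inv _ _ _ z.2, inv _ _ _ z.2] at this
    exact this
  have hnt : Nontrivial (indV C χ) := by
    let F0 : indV C χ := ⟨fun y => if h : y ∈ C then (χ ⟨y, h⟩ : ℂ) else 0, by
      intro c y
      beta_reduce
      by_cases hy : y ∈ C
      · have hcy : (c : P) * y ∈ C := C.mul_mem c.2 hy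
        rw [dif_pos hy, dif_pos hcy, ← Units.val_mul, ← map_mul]; rfl
      · have hcy : (c : P) * y ∉ C := fun h => hy ((C.mul_mem_cancel_left c.2).1 h)
        rw [dif_neg hy, dif_neg hcy, mul_zero]⟩
    refine ⟨F0, 0, fun h => ?_⟩
    have := congrFun (congrArg Subtype.val h) 1
    change (if h : (1 : P) ∈ C then (χ ⟨1, h⟩ : ℂ) else 0) = 0 at this
    rw [dif_pos C.one_mem] at this
    exact (Units.ne_zero _) this
  obtain ⟨c, hc, hcy⟩ := exists_cocycle hP (indRep C χ) R hR
  refine proper_of_cocycle (indRep C χ) R hR c hc hcy O ?_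
  intro x hx F hF
  have hF1 : ∀ y, F.1 (y * x) = F.1 y := fun y => congrFun (congrArg Subtype.val hF) y
  have hFm : ∀ (m : ℕ) y, F.1 (y * x ^ m) = F.1 y := by
    intro m
    induction m with
    | zero => intro y; simp
    | succ m ih => intro y; rw [pow_succ, ← mul_assoc, hF1, ih]
  apply Subtype.ext
  funext y
  change F.1 y = 0
  obtain ⟨m, hm, hne⟩ := hO x hx y
  have h1 := F.2 ⟨_, hm⟩ y
  simp only [conj_pow, inv_mul_cancel_right, hFm] at h1
  by_contra h0
  apply hne
  apply Units.ext
  have h2 := mul_right_cancel₀ h0 ((one_mul _).trans h1)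
  simp only [Units.val_one]
  rw [h2]
  congr 3
  simp only [conj_pow]
end induced
end SurfOrb

set_option autoImplicit false
set_option linter.unusedSectionVars false
set_option linter.unusedVariables false
namespace SurfOrb
open Multiplicative
section final
variable {r : ℕ} [Fact r.Prime] {P : Type} [Group P]

/-- an injective complex character of `ℤ/r` -/
lemma exists_chi (r : ℕ) [Fact r.Prime] : ∃ χ : MZ r →* ℂˣ, ∀ x, χ x = 1 → x = 1 := by
  have : NeZero r := ⟨(Fact.out : r.Prime).ne_zero⟩
  refine ⟨(ZMod.stdAddChar (N := r)).toMonoidHom.toHomUnits, fun x hx => ?_⟩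
  have h := congrArg Units.val hx
  rw [MonoidHom.coe_toHomUnits] at h
  change ZMod.stdAddChar (toAdd x) = 1 at h
  rw [← AddChar.map_zero_eq_one (ZMod.stdAddChar (N := r))] at h
  exact ZMod.injective_stdAddChar h

lemma char_mem {H : Subgroup P} (h : H.Characteristic) (ψ : MulAut P) (x : P) :
    ψ x ∈ H ↔ x ∈ H := by
  have := Subgroup.characteristic_iff_comap_eq.1 h ψ
  conv_rhs => rw [← this]
  rfl

theorem main (r : ℕ) [Fact r.Prime] (hP : Surf P) (O : Set P) (h1 : (1 : P) ∉ O) (T : Finset P)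
    (hO : ∀ x ∈ O, ∃ t ∈ T, ∃ φ : MulAut P, φ t = x) :
    ∃ R : Subgroup P, R.Normal ∧ R.FiniteIndex ∧ (∃ k : ℕ, R.index = r ^ k) ∧
      OHomology R O ≠ ⊤ := by
  have hr : r.Prime := Fact.out
  obtain ⟨I, hI⟩ := exists_level (r := r) hP T
  obtain ⟨hch, ⟨k1, hk1⟩, hK⟩ := Kt_spec (r := r) hP I
  obtain ⟨hch', -, -⟩ := Kt_spec (r := r) hP (I + 1)
  set K := Kt P r I with hKdef
  obtain ⟨N, Q, _, _, hQ, M, C0, χ0, hχ0⟩ := exists_char r hK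
  obtain ⟨χ1, hχ1⟩ := exists_chi r
  have hchR : (Psi Q K).Characteristic := Psi_char
  obtain ⟨k2, hk2⟩ := Psi_index hQ hK
  have hidx : (Psi Q K).index = r ^ (k2 + k1) := by
    rw [← Subgroup.relIndex_mul_index (Psi_le (Q := Q) (K := K)), hk1, hk2, pow_add]
  have hfin : (Psi Q K).FiniteIndex := ⟨by rw [hidx]; exact pow_ne_zero _ hr.ne_zero⟩
  have hnorm : (Psi Q K).Normal := inferInstance
  refine ⟨Psi Q K, hnorm, hfin, ⟨_, hidx⟩, ?_⟩
  let C : Subgroup P := (C0.comap M).map K.subtype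
  let eC : (C0.comap M) ≃* C :=
    (C0.comap M).equivMapOfInjective K.subtype K.subtype_injective
  let χ : C →* ℂˣ := χ1.comp (χ0.comp ((M.subgroupComap C0).comp eC.symm.toMonoidHom))
  have hmem : ∀ k : K, M k ∈ C0 → (k : P) ∈ C := fun k hk => ⟨k, hk, rfl⟩
  have hval : ∀ (k : K) (hk : M k ∈ C0), χ ⟨k, hmem k hk⟩ = χ1 (χ0 ⟨M k, hk⟩) := by
    intro k hk
    have : eC.symm ⟨k, hmem k hk⟩ = ⟨k, hk⟩ := by
      rw [MulEquiv.symm_apply_eq]; rfl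
    change χ1 (χ0 (M.subgroupComap C0 (eC.symm ⟨k, hmem k hk⟩))) = _
    rw [this]; rfl
  have hRM : ∀ y (hy : y ∈ Psi Q K), M ⟨y, Psi_le hy⟩ = 1 := fun y hy =>
    (mem_Psi.1 hy).2 M
  have hRC0 : ∀ y (hy : y ∈ Psi Q K), M ⟨y, Psi_le hy⟩ ∈ C0 := fun y hy => by
    rw [hRM y hy]; exact C0.one_mem
  have hRC : Psi Q K ≤ C := fun y hy => hmem ⟨y, Psi_le hy⟩ (hRC0 y hy)
  refine proper_of_char hP (Psi Q K) C hRC χ ?_ O ?_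
  · intro y hy
    rw [hval ⟨y, Psi_le hy⟩ (hRC0 y hy)]
    have : (⟨M ⟨y, Psi_le hy⟩, hRC0 y hy⟩ : C0) = 1 := Subtype.ext (hRM y hy)
    rw [this, map_one, map_one]
  · intro x hx y
    obtain ⟨t, ht, φ, rfl⟩ := hO x hx
    have ht1 : t ≠ 1 := by rintro rfl; rw [map_one] at hx; exact h1 hx
    obtain ⟨m, hm1, hm2⟩ := hI t ht ht1
    let ψ : MulAut P := MulAut.conj y * φ
    have hψ : y * φ t * y⁻¹ = ψ t := rfl
    rw [hψ]
    have hu : (ψ t) ^ m ∈ K := by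
      rw [← map_pow]; exact (char_mem hch ψ _).2 hm1
    have hu' : (ψ t) ^ m ∉ Psi (MZ r) K := by
      rw [← map_pow]
      intro h
      exact hm2 ((char_mem hch' ψ _).1 h)
    have hf : ∃ f : K →* MZ r, f ⟨_, hu⟩ ≠ 1 := by
      by_contra hno
      push Not at hno
      exact hu' (mem_Psi.2 ⟨hu, hno⟩)
    obtain ⟨h, hne⟩ := hχ0 ⟨_, hu⟩ hf
    have h' : M (⟨_, hu⟩ ^ N) ∈ C0 := by rw [map_pow]; exact h
    have hpow : (((⟨(ψ t) ^ m, hu⟩ : K) ^ N : K) : P) = ψ t ^ (m * N) := by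
      rw [Subgroup.coe_pow, pow_mul]
    have hC := hmem _ h'
    have hv := hval _ h'
    refine ⟨m * N, hpow ▸ hC, fun hone => hne (hχ1 _ ?_)⟩
    have e1 : (⟨M (⟨_, hu⟩ ^ N), h'⟩ : C0) = ⟨_, h⟩ := Subtype.ext (map_pow _ _ _)
    rw [← e1, ← hv, ← hone]
    congr 1
    exact Subtype.ext hpow
end final
end SurfOrb

/-- Corollary 3.3 (surface case): if O ⊆ π₁Σ_g ∖ {1} is contained in the union of finitely
many Aut(π₁Σ_g)-orbits, then the O-homology of a suitable normal cover of r-power index is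
proper. -/
theorem orbit_homology_surface (g : ℕ) (hg : 2 ≤ g)
    (r : ℕ) (hr : r.Prime) (hodd : Odd r)
    (O : Set (SurfaceGroup g)) (h1 : (1 : SurfaceGroup g) ∉ O)
    (T : Finset (SurfaceGroup g))
    (hO : ∀ x ∈ O, ∃ t ∈ T, ∃ φ : MulAut (SurfaceGroup g), φ t = x) :
    ∃ R : Subgroup (SurfaceGroup g), R.Normal ∧ R.FiniteIndex ∧
      (∃ k : ℕ, R.index = r ^ k) ∧
      OHomology R O ≠ ⊤ := by
  have : Fact r.Prime := ⟨hr⟩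
  exact SurfOrb.main r ⟨_, SurfOrb.marked_surface g, by simpa using hg⟩ O h1 T hO
end

section
/- Let F be a free group of finite rank m ≥ 2, let d > 1 be an odd squarefree integer, and let 𝒪 ⊆ F be the set of d-primitive elements, i.e. elements whose image under the mod-d abelianization F → (ℤ/d)^m is nonzero. Then there exists a finite-index normal subgroup R of F whose index [F : R] divides a power of d and such that H₁^𝒪(R;ℚ) is a proper ℚ-subspace of H₁(R;ℚ) = Abelianization(R) ⊗_ℤ ℚ. -/
open scoped TensorProduct


/-- Exponent-sum map. -/
def expSum (m : ℕ) : FreeGroup (Fin m) →* Multiplicative (Fin m → ℤ) :=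
  FreeGroup.lift fun i => Multiplicative.ofAdd (Pi.single i (1 : ℤ))

lemma freeModAb_apply (m d : ℕ) (x : FreeGroup (Fin m)) (i : Fin m) :
    (freeModAb m d x).toAdd i = (((expSum m x).toAdd i : ℤ) : ZMod d) := by
  induction x using FreeGroup.induction_on with
  | C1 => simp
  | of j =>
    by_cases h : i = j
    · subst h; simp [freeModAb, expSum]
    · simp [freeModAb, expSum, h]
  | inv_of j ih => simp only [map_inv, toAdd_inv, Pi.neg_apply, ih, Int.cast_neg]
  | mul x y hx hy => simp only [map_mul, toAdd_mul, Pi.add_apply, hx, hy, Int.cast_add]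

lemma freeModAb_eq_one (m d : ℕ) (x : FreeGroup (Fin m)) :
    freeModAb m d x = 1 ↔ ∀ i, (d : ℤ) ∣ (expSum m x).toAdd i := by
  rw [← toAdd_eq_zero, funext_iff]
  refine forall_congr' fun i => ?_
  rw [freeModAb_apply, Pi.zero_apply, ZMod.intCast_zmod_eq_zero_iff_dvd]

/-- The data from which a suitable cover is built. -/
def Good (m d : ℕ) : Prop :=
  ∃ (n k : ℕ) (R : Subgroup (FreeGroup (Fin m))) (Φ : FreeGroup (Fin m) → ℂ),
    n ∣ d ^ k ∧ R.Normal ∧ R.FiniteIndex ∧ (∀ x, x ^ (n * d) ∈ R) ∧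
    (∀ y, ∀ r ∈ R, Φ (y * r) = Φ y) ∧ Φ 1 = 1 ∧
    (∀ x y, Φ (x ^ n * y) = Φ (x ^ n) * Φ y) ∧
    ∀ x, freeModAb m d x ≠ 1 → Φ (x ^ n) ≠ 1

lemma good_root {m d n : ℕ} {R : Subgroup (FreeGroup (Fin m))} {Φ : FreeGroup (Fin m) → ℂ}
    (h1 : ∀ x, x ^ (n * d) ∈ R) (h2 : ∀ y, ∀ r ∈ R, Φ (y * r) = Φ y) (h3 : Φ 1 = 1)
    (h4 : ∀ x y, Φ (x ^ n * y) = Φ (x ^ n) * Φ y) (x : FreeGroup (Fin m)) :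
    Φ (x ^ n) ^ d = 1 := by
  have key : ∀ j : ℕ, Φ (x ^ (n * j)) = Φ (x ^ n) ^ j := by
    intro j
    induction j with
    | zero => simp [h3]
    | succ j ih =>
      rw [mul_add, mul_one, add_comm, pow_add, h4, ih, pow_succ']
  rw [← key d, ← h3, ← h2 1 _ (h1 x), one_mul]

lemma good_one (m : ℕ) : Good m 1 := by
  refine ⟨1, 1, ⊤, fun _ => 1, by simp, inferInstance, inferInstance, by simp, by simp, rfl,
    by simp, fun x hx => (hx ?_).elim⟩
  rw [freeModAb_eq_one]; simp

lemma freeModAb_pow_ne {m d n k e : ℕ} (hde : Nat.Coprime d e) (hn : n ∣ e ^ k)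
    (x : FreeGroup (Fin m)) (hx : freeModAb m d x ≠ 1) : freeModAb m d (x ^ n) ≠ 1 := by
  intro h
  apply hx
  rw [freeModAb_eq_one] at h ⊢
  intro i
  have := h i
  rw [map_pow, toAdd_pow, Pi.smul_apply, nsmul_eq_mul] at this
  refine IsCoprime.dvd_of_dvd_mul_left ?_ this
  rw [Nat.isCoprime_iff_coprime]
  exact Nat.Coprime.coprime_dvd_right hn (hde.pow_right k)

lemma good_mul_aux {z w : ℂ} {a b : ℕ} (hab : Nat.Coprime a b) (hz : z ^ a = 1) (hw : w ^ b = 1)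
    (h : z * w = 1) : z = 1 := by
  have h1 : z ^ b = 1 := by
    have : (z * w) ^ b = 1 := by rw [h, one_pow]
    rwa [mul_pow, hw, mul_one] at this
  have := pow_gcd_eq_one.2 ⟨hz, h1⟩
  rwa [hab, pow_one] at this

lemma good_mul {m a b : ℕ} (hab : Nat.Coprime a b) (ha : Good m a) (hb : Good m b) :
    Good m (a * b) := by
  obtain ⟨n, k, R, Φ, h1, h2, h3, h4, h5, h6, h7, h8⟩ := ha
  obtain ⟨n', k', R', Φ', h1', h2', h3', h4', h5', h6', h7', h8'⟩ := hb
  refine ⟨n * n', k + k', R ⊓ R', fun x => Φ x * Φ' x, ?_, inferInstance, inferInstance,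
    ?_, ?_, by simp [h6, h6'], ?_, ?_⟩
  · rw [mul_pow]
    apply mul_dvd_mul
    · exact h1.trans (pow_dvd_pow _ (by omega))
    · exact h1'.trans (pow_dvd_pow _ (by omega))
  · intro x
    rw [Subgroup.mem_inf]
    constructor
    · have := h4 (x ^ (n' * b))
      rw [← pow_mul] at this
      rw [show n * n' * (a * b) = n' * b * (n * a) by ring]
      exact this
    · have := h4' (x ^ (n * a))
      rw [← pow_mul] at this
      rw [show n * n' * (a * b) = n * a * (n' * b) by ring]
      exact this
  · intro y r hr
    simp only [h5 y r hr.1, h5' y r hr.2]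
  · intro x y
    have e1 := h7 (x ^ n') y
    have e2 := h7' (x ^ n) y
    rw [← pow_mul] at e1 e2
    rw [mul_comm n' n] at e1
    simp only [e1, e2]
    ring
  · intro x hx h
    have r1 := good_root h4 h5 h6 h7 (x ^ n')
    have r2 := good_root h4' h5' h6' h7' (x ^ n)
    rw [← pow_mul] at r1 r2
    rw [mul_comm n' n] at r1
    simp only at h
    have z1 := good_mul_aux hab r1 r2 h
    have z2 := good_mul_aux hab.symm r2 r1 (by rw [mul_comm]; exact h)
    have : freeModAb m a x = 1 := by
      by_contra hne
      apply h8 _ (freeModAb_pow_ne hab h1' x hne)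
      rw [← pow_mul, mul_comm n' n, z1]
    have t' : freeModAb m b x = 1 := by
      by_contra hne
      apply h8' _ (freeModAb_pow_ne hab.symm h1 x hne)
      rw [← pow_mul, z2]
    apply hx
    rw [freeModAb_eq_one] at this t' ⊢
    intro i
    push_cast
    exact IsCoprime.mul_dvd (Nat.isCoprime_iff_coprime.2 hab) (this i) (t' i)


/-- Matrices supported on or above the `k`-th superdiagonal. -/
def upTri (N : ℕ) (L : Type) [Field L] (k : ℕ) :
    AddSubgroup (Matrix (Fin (N + 1)) (Fin (N + 1)) L) where
  carrier := {M | ∀ i j, j.val < i.val + k → M i j = 0}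
  zero_mem' := by intro i j _; rfl
  add_mem' := by
    intro a b ha hb i j h
    rw [Matrix.add_apply, ha i j h, hb i j h, add_zero]
  neg_mem' := by
    intro a ha i j h
    rw [Matrix.neg_apply, ha i j h, neg_zero]

lemma upTri_mul {N : ℕ} {L : Type} [Field L] {k l : ℕ}
    {A B : Matrix (Fin (N + 1)) (Fin (N + 1)) L}
    (hA : A ∈ upTri N L k) (hB : B ∈ upTri N L l) : A * B ∈ upTri N L (k + l) := by
  intro i j h
  rw [Matrix.mul_apply]
  refine Finset.sum_eq_zero fun t _ => ?_
  by_cases h1 : t.val < i.val + k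
  · rw [hA i t h1, zero_mul]
  · rw [hB t j (by omega), mul_zero]

lemma upTri_mono {N : ℕ} {L : Type} [Field L] {k l : ℕ} (h : l ≤ k)
    {A : Matrix (Fin (N + 1)) (Fin (N + 1)) L}
    (hA : A ∈ upTri N L k) : A ∈ upTri N L l :=
  fun i j hij => hA i j (by omega)

lemma upTri_one {N : ℕ} {L : Type} [Field L] : (1 : Matrix _ _ L) ∈ upTri N L 0 := by
  intro i j hij
  rw [Matrix.one_apply_ne]
  rintro rfl
  omega

lemma upTri_pow {N : ℕ} {L : Type} [Field L]
    {A : Matrix (Fin (N + 1)) (Fin (N + 1)) L}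
    (hA : A ∈ upTri N L 1) (k : ℕ) : A ^ k ∈ upTri N L k := by
  induction k with
  | zero => exact upTri_one
  | succ k ih => rw [pow_succ]; exact upTri_mul ih hA

lemma upTri_top {N : ℕ} {L : Type} [Field L] {k : ℕ} (hk : N + 1 ≤ k)
    {A : Matrix (Fin (N + 1)) (Fin (N + 1)) L}
    (hA : A ∈ upTri N L k) : A = 0 := by
  ext i j
  exact hA i j (by omega)

/-- The twisted shift. -/
def shiftMat (p N : ℕ) (L : Type) [Field L] (a : L) : Matrix (Fin (N + 1)) (Fin (N + 1)) L :=
  Matrix.of fun i j => if j.val = i.val + 1 then a ^ (p ^ i.val) else 0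

lemma shiftMat_mem (p N : ℕ) (L : Type) [Field L] (a : L) :
    shiftMat p N L a ∈ upTri N L 1 := by
  intro i j h
  simp only [shiftMat, Matrix.of_apply]
  rw [if_neg (by omega)]

lemma shiftMat_add (p N : ℕ) [Fact p.Prime] (L : Type) [Field L] [CharP L p] (a b : L) :
    shiftMat p N L (a + b) = shiftMat p N L a + shiftMat p N L b := by
  ext i j
  simp only [shiftMat, Matrix.of_apply, Matrix.add_apply]
  split_ifs
  · exact add_pow_char_pow a b _ _
  · simp

lemma shiftMat_pow (p N : ℕ) (L : Type) [Field L] (a : L) (k : ℕ) (i j : Fin (N + 1)) :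
    (shiftMat p N L a ^ k) i j =
      if j.val = i.val + k then ∏ t ∈ Finset.range k, a ^ (p ^ (i.val + t)) else 0 := by
  induction k generalizing j with
  | zero => simp [Matrix.one_apply, Fin.ext_iff, eq_comm]
  | succ k ih =>
    rw [pow_succ, Matrix.mul_apply]
    simp only [ih]
    simp only [shiftMat, Matrix.of_apply]
    split_ifs with h
    · rw [Finset.sum_eq_single (⟨i.val + k, by omega⟩ : Fin (N + 1))]
      · simp only [if_true]
        rw [if_pos (by omega), Finset.prod_range_succ]
      · intro b _ hb
        rw [if_neg, zero_mul]
        intro h'; exact hb (Fin.ext h')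
      · simp
    · refine Finset.sum_eq_zero fun t _ => ?_
      by_cases h1 : t.val = i.val + k
      · rw [if_neg (show ¬ j.val = t.val + 1 by omega), mul_zero]
      · rw [if_neg h1, zero_mul]

/-- `g = 1 + shift a + higher`. -/
def Approx (p N : ℕ) (L : Type) [Field L] (g : Matrix (Fin (N + 1)) (Fin (N + 1)) L) (a : L) :
    Prop := g - 1 - shiftMat p N L a ∈ upTri N L 2

lemma Approx.sub_one {p N : ℕ} {L : Type} [Field L]
    {g : Matrix (Fin (N + 1)) (Fin (N + 1)) L} {a : L} (h : Approx p N L g a) :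
    g - 1 ∈ upTri N L 1 := by
  have := add_mem (upTri_mono (show 1 ≤ 2 by omega) h) (shiftMat_mem p N L a)
  rwa [sub_add_cancel] at this

lemma Approx.mul {p N : ℕ} [Fact p.Prime] {L : Type} [Field L] [CharP L p]
    {g h : Matrix (Fin (N + 1)) (Fin (N + 1)) L} {a b : L} (hg : Approx p N L g a)
    (hh : Approx p N L h b) : Approx p N L (g * h) (a + b) := by
  have := add_mem (add_mem (upTri_mul hg.sub_one hh.sub_one) hg) hh
  unfold Approx
  rw [shiftMat_add]
  convert this using 1
  noncomm_ring

lemma Approx.one {p N : ℕ} [Fact p.Prime] {L : Type} [Field L] :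
    Approx p N L 1 0 := by
  have : shiftMat p N L 0 = 0 := by
    ext i j
    simp [shiftMat, (Fact.out : p.Prime).ne_zero]
  unfold Approx
  rw [this, sub_self, sub_zero]
  exact zero_mem _

lemma Approx.pow {p N : ℕ} [Fact p.Prime] {L : Type} [Field L] [CharP L p]
    {g : Matrix (Fin (N + 1)) (Fin (N + 1)) L} {a : L} (hg : Approx p N L g a) (k : ℕ) :
    Approx p N L (g ^ k) (k * a) := by
  induction k with
  | zero => simpa using Approx.one
  | succ k ih =>
    rw [pow_succ]
    push_cast
    rw [add_mul, one_mul]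
    exact ih.mul hg

lemma Approx.gen {p N : ℕ} {L : Type} [Field L] (a : L) :
    Approx p N L (1 + shiftMat p N L a) a := by
  unfold Approx
  rw [add_sub_cancel_left, sub_self]
  exact zero_mem _

lemma Approx.sub_pow {p N : ℕ} {L : Type} [Field L]
    {g : Matrix (Fin (N + 1)) (Fin (N + 1)) L} {a : L} (hg : Approx p N L g a) (k : ℕ) :
    (g - 1) ^ k - shiftMat p N L a ^ k ∈ upTri N L (k + 1) := by
  induction k with
  | zero => simp
  | succ k ih =>
    have h1 := upTri_mul ih hg.sub_one
    have h2 := upTri_mul (upTri_pow (shiftMat_mem p N L a) k) hg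
    have := add_mem h1 h2
    convert this using 1
    rw [pow_succ, pow_succ]
    noncomm_ring

/-- The key power computation. -/
lemma Approx.pow_eq {p m N : ℕ} [Fact p.Prime] (hN : N = p ^ m) {L : Type} [Field L] [CharP L p]
    {g : Matrix (Fin (N + 1)) (Fin (N + 1)) L} {a : L} (hg : Approx p N L g a) :
    g ^ N = 1 + shiftMat p N L a ^ N := by
  have h := upTri_top le_rfl (hg.sub_pow N)
  rw [sub_eq_zero] at h
  rw [← h]
  have : (1 + (g - 1)) ^ (p ^ m) = 1 ^ (p ^ m) + (g - 1) ^ (p ^ m) :=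
    add_pow_char_pow_of_commute _ _ (Commute.one_left _)
  rw [← hN] at this
  simpa using this

lemma Approx.pow_eq_one {p m N : ℕ} [Fact p.Prime] (hN : N = p ^ m) {L : Type} [Field L]
    [CharP L p]
    {g : Matrix (Fin (N + 1)) (Fin (N + 1)) L} {a : L} (hg : Approx p N L g a) :
    g ^ (N * p) = 1 := by
  have hp := (Fact.out : p.Prime).two_le
  have hN0 : 0 < N := by rw [hN]; positivity
  rw [pow_mul, hg.pow_eq hN,
    add_pow_char_of_commute _ (Commute.one_left _), one_pow, ← pow_mul,
    upTri_top (A := shiftMat p N L a ^ (N * p)) ?_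
    (upTri_pow (shiftMat_mem p N L a) (N * p)), add_zero]
  nlinarith

lemma Approx.corner {p m N : ℕ} [Fact p.Prime] (hN : N = p ^ m) {L : Type} [Field L]
    [CharP L p]
    {g h : Matrix (Fin (N + 1)) (Fin (N + 1)) L} {a b : L} (hg : Approx p N L g a)
    (hh : Approx p N L h b) :
    (g ^ N * h) 0 (Fin.last N) =
      ∏ t ∈ Finset.range N, a ^ (p ^ t) + h 0 (Fin.last N) := by
  have hN0 : 0 < N := by rw [hN]; exact pow_pos (Fact.out : p.Prime).pos _
  rw [hg.pow_eq hN, add_mul, one_mul, Matrix.add_apply, add_comm, Matrix.mul_apply]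
  congr 1
  rw [Finset.sum_eq_single (Fin.last N)]
  · have : h (Fin.last N) (Fin.last N) = 1 := by
      have := hh.sub_one (Fin.last N) (Fin.last N) (by simp)
      rw [Matrix.sub_apply, Matrix.one_apply_eq, sub_eq_zero] at this
      exact this
    rw [this, shiftMat_pow]
    simp
  · intro b _ hb
    rw [shiftMat_pow, if_neg, zero_mul]
    intro h'
    apply hb
    ext
    simpa using h'
  · simp

lemma good_prime (m p : ℕ) (hp : p.Prime) : Good m p := by
  haveI : Fact p.Prime := ⟨hp⟩
  obtain ⟨N, hN⟩ : ∃ N, N = p ^ m := ⟨_, rfl⟩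
  have hN0 : N ≠ 0 := by rw [hN]; exact (pow_pos hp.pos _).ne'
  have hmN : m ≤ N := by rw [hN]; exact (Nat.lt_pow_self hp.one_lt).le
  have hNp : N * p ≠ 0 := mul_ne_zero hN0 hp.ne_zero
  obtain ⟨ℓ, hℓ⟩ : ∃ f : (Fin m → ZMod p) →ₗ[ZMod p] GaloisField p N, Function.Injective f := by
    apply finrank_le_iff_exists_linearMap.mp
    rw [GaloisField.finrank p hN0]
    simpa using hmN
  obtain ⟨tr, htr⟩ := LinearMap.exists_leftInverse_of_injective
    (Algebra.linearMap (ZMod p) (GaloisField p N))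
    (LinearMap.ker_eq_bot.2 (algebraMap (ZMod p) (GaloisField p N)).injective)
  have htr' : ∀ c : ZMod p, tr (algebraMap _ _ c) = c := fun c => LinearMap.congr_fun htr c
  let ρ : FreeGroup (Fin m) →*
      (Matrix (Fin (N + 1)) (Fin (N + 1)) (GaloisField p N))ˣ :=
    FreeGroup.lift fun i => Units.ofPowEqOne
      (1 + shiftMat p N (GaloisField p N) (ℓ (Pi.single i 1))) (N * p)
      ((Approx.gen _).pow_eq_one hN) hNp
  let v : FreeGroup (Fin m) → GaloisField p N := fun x => ℓ (freeModAb m p x).toAdd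
  have hgen : ∀ i, Approx p N (GaloisField p N) (ρ (FreeGroup.of i)).val (v (FreeGroup.of i)) := by
    intro i
    simp only [ρ, v, freeModAb, FreeGroup.lift_apply_of, toAdd_ofAdd]
    exact Approx.gen _
  have hρ : ∀ x, Approx p N (GaloisField p N) (ρ x).val (v x) := by
    intro x
    induction x using FreeGroup.induction_on with
    | C1 => simpa [v] using Approx.one
    | of i => exact hgen i
    | inv_of i ih =>
      have h1 : (ρ (FreeGroup.of i)) ^ (N * p) = 1 := by
        ext1
        rw [Units.val_pow_eq_pow_val]
        exact (hgen i).pow_eq_one hN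
      have h2 : (ρ (FreeGroup.of i))⁻¹ = (ρ (FreeGroup.of i)) ^ (N * p - 1) := by
        rw [inv_eq_iff_mul_eq_one, ← pow_succ', Nat.sub_add_cancel (by omega), h1]
      rw [map_inv, h2, Units.val_pow_eq_pow_val]
      have h3 : v (FreeGroup.of i)⁻¹ =
          ((N * p - 1 : ℕ) : GaloisField p N) * v (FreeGroup.of i) := by
        rw [Nat.cast_sub (by omega)]
        simp [v]
      rw [h3]
      exact (hgen i).pow _
    | mul x y hx hy =>
      have : v (x * y) = v x + v y := by simp [v]
      rw [this, map_mul, Units.val_mul]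
      exact hx.mul hy
  let χ : GaloisField p N → ℂ := fun a => ZMod.stdAddChar (tr a)
  have hχ0 : χ 0 = 1 := by simp [χ]
  have hχ : ∀ a b, χ (a + b) = χ a * χ b := by
    intro a b; simp only [χ, map_add, AddChar.map_add_eq_mul]
  let Φ : FreeGroup (Fin m) → ℂ := fun x => χ ((ρ x).val 0 (Fin.last N))
  have hΦ1 : Φ 1 = 1 := by
    simp only [Φ, map_one, Units.val_one]
    rw [Matrix.one_apply_ne, hχ0]
    intro h
    have := congrArg Fin.val h
    simp at this
    exact hN0 this.symm
  have hcorner : ∀ x y, Φ (x ^ N * y) =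
      χ (∏ t ∈ Finset.range N, (v x) ^ (p ^ t)) * Φ y := by
    intro x y
    simp only [Φ, map_mul, map_pow, Units.val_mul, Units.val_pow_eq_pow_val]
    rw [(hρ x).corner hN (hρ y), hχ]
  have hcorner1 : ∀ x, Φ (x ^ N) = χ (∏ t ∈ Finset.range N, (v x) ^ (p ^ t)) := by
    intro x
    have := hcorner x 1
    rwa [mul_one, hΦ1, mul_one] at this
  refine ⟨N, m, ρ.ker, Φ, by rw [hN], inferInstance, ?_, ?_, ?_, hΦ1, ?_, ?_⟩
  · infer_instance
  · intro x
    rw [MonoidHom.mem_ker, map_pow]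
    ext1
    rw [Units.val_pow_eq_pow_val]
    exact (hρ x).pow_eq_one hN
  · intro y r hr
    rw [MonoidHom.mem_ker] at hr
    simp only [Φ, map_mul, hr, mul_one]
  · intro x y
    rw [hcorner, hcorner1]
  · intro x hx h
    rw [hcorner1] at h
    have hv : v x ≠ 0 := by
      intro h0
      apply hx
      rw [← toAdd_eq_zero]
      exact hℓ (by rw [map_zero]; exact h0)
    have hn := FiniteField.algebraMap_norm_eq_prod_pow (ZMod p) (GaloisField p N) (v x)
    rw [GaloisField.finrank p hN0, Nat.card_zmod] at hn
    rw [← hn] at h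
    simp only [χ, htr'] at h
    have h0 : Algebra.norm (ZMod p) (v x) = 0 := by
      apply ZMod.injective_stdAddChar
      rw [h, AddChar.map_zero_eq_one]
    rw [Algebra.norm_eq_zero_iff] at h0
    exact hv h0

lemma good_squarefree (m d : ℕ) (hd : Squarefree d) : Good m d := by
  induction d using Nat.recOnPosPrimePosCoprime with
  | prime_pow p n hp hn =>
    have : n = 1 := by
      rcases (Nat.squarefree_pow_iff hp.ne_one hn.ne').1 hd with ⟨_, h⟩
      exact h
    subst this
    rw [pow_one]
    exact good_prime m p hp
  | zero => exact (not_squarefree_zero hd).elim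
  | one => exact good_one m
  | coprime a b ha hb hab iha ihb =>
    exact good_mul hab (iha (hd.of_mul_left)) (ihb hd.of_mul_right)


section Final

variable {m : ℕ}

/-- The affine permutation of `F → ℂ` attached to translation by `s` and the vector `w`. -/
def affPerm (s : FreeGroup (Fin m)) (w : FreeGroup (Fin m) → ℂ) :
    Equiv.Perm (FreeGroup (Fin m) → ℂ) where
  toFun f := fun y => f (y * s) + w y
  invFun f := fun y => f (y * s⁻¹) - w (y * s⁻¹)
  left_inv f := by funext y; simp
  right_inv f := by funext y; simp

/-- The crossed homomorphism with prescribed values on generators exists. -/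
lemma exists_crossed (w : Fin m → FreeGroup (Fin m) → ℂ) :
    ∃ c : FreeGroup (Fin m) → FreeGroup (Fin m) → ℂ,
      (∀ i, c (FreeGroup.of i) = w i) ∧
      (∀ a b y, c (a * b) y = c b (y * a) + c a y) := by
  let A : FreeGroup (Fin m) →* Equiv.Perm (FreeGroup (Fin m) → ℂ) :=
    FreeGroup.lift fun i => affPerm (FreeGroup.of i) (w i)
  have key : ∀ x f y, A x f y = f (y * x) + A x 0 y := by
    intro x
    induction x using FreeGroup.induction_on with
    | C1 => intro f y; simp
    | of i => intro f y; simp [A, affPerm]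
    | inv_of i ih =>
      intro f y
      have h : ∀ g, A (FreeGroup.of i)⁻¹ g = (affPerm (FreeGroup.of i) (w i)).symm g := by
        intro g
        simp only [A, map_inv, FreeGroup.lift_apply_of]
        rfl
      rw [h, h]
      simp only [affPerm, Equiv.coe_fn_symm_mk, Pi.zero_apply]
      ring
    | mul a b ha hb =>
      intro f y
      rw [map_mul, Equiv.Perm.mul_apply, Equiv.Perm.mul_apply, ha, hb, ha (A b 0), mul_assoc]
      ring
  refine ⟨fun x => A x 0, ?_, ?_⟩
  · intro i
    funext y
    simp [A, affPerm]
  · intro a b y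
    simp only [map_mul, Equiv.Perm.mul_apply]
    exact key a _ y

lemma index_dvd_pow (R : Subgroup (FreeGroup (Fin m))) [R.Normal] [R.FiniteIndex] (d n k : ℕ)
    (hd : d ≠ 0) (hn : n ∣ d ^ k) (h : ∀ x, x ^ (n * d) ∈ R) : ∃ k, R.index ∣ d ^ k := by
  rw [UniqueFactorizationMonoid.exists_dvd_pow_iff_radical_dvd Subgroup.FiniteIndex.index_ne_zero]
  have : ∀ q : ℕ, q.Prime → q ∣ R.index → q ∣ d := by
    intro q hq hqi
    haveI : Fact q.Prime := ⟨hq⟩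
    haveI : Finite (FreeGroup (Fin m) ⧸ R) := Subgroup.finite_quotient_of_finiteIndex
    obtain ⟨g, hg⟩ := exists_prime_orderOf_dvd_card' (G := FreeGroup (Fin m) ⧸ R) q hqi
    obtain ⟨x, rfl⟩ := QuotientGroup.mk_surjective g
    have h1 : (x : FreeGroup (Fin m) ⧸ R) ^ (n * d) = 1 := by
      rw [← QuotientGroup.mk_pow, QuotientGroup.eq_one_iff]
      exact h x
    have h2 := orderOf_dvd_of_pow_eq_one h1
    rw [hg] at h2
    rcases (Nat.Prime.dvd_mul hq).1 h2 with h3 | h3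
    · exact hq.dvd_of_dvd_pow (h3.trans hn)
    · exact h3
  rw [UniqueFactorizationMonoid.radical_dvd_iff_primeFactors_subset hd]
  simp only [UniqueFactorizationMonoid.primeFactors_eq_natPrimeFactors]
  intro q hq
  rw [Nat.mem_primeFactors] at hq ⊢
  exact ⟨hq.1, this q hq.1 hq.2.1, hd⟩

lemma final (hm : 2 ≤ m) (d : ℕ) (hd : 1 < d) (hG : Good m d) :
    ∃ R : Subgroup (FreeGroup (Fin m)), R.Normal ∧ R.FiniteIndex ∧
      (∃ k : ℕ, R.index ∣ d ^ k) ∧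
      OHomology R {x | freeModAb m d x ≠ 1} ≠ ⊤ := by
  obtain ⟨n, k, R, Φ, h1, h2, h3, h4, h5, h6, h7, h8⟩ := hG
  refine ⟨R, h2, h3, index_dvd_pow R d n k (by omega) h1 h4, fun htop => ?_⟩
  -- the representation
  let V : AddSubgroup (FreeGroup (Fin m) → ℂ) :=
    { carrier := {f | (∀ x y, f (x ^ n * y) = Φ (x ^ n) * f y) ∧ ∀ y, ∀ r ∈ R, f (y * r) = f y}
      zero_mem' := by simp
      add_mem' := by
        intro f g hf hg
        refine ⟨fun x y => ?_, fun y r hr => ?_⟩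
        · rw [Pi.add_apply, Pi.add_apply, hf.1, hg.1, mul_add]
        · rw [Pi.add_apply, Pi.add_apply, hf.2 y r hr, hg.2 y r hr]
      neg_mem' := by
        intro f hf
        refine ⟨fun x y => ?_, fun y r hr => ?_⟩
        · rw [Pi.neg_apply, Pi.neg_apply, hf.1, mul_neg]
        · rw [Pi.neg_apply, Pi.neg_apply, hf.2 y r hr] }
  have hVtr : ∀ f ∈ V, ∀ a, (fun y => f (y * a)) ∈ V := by
    intro f hf a
    refine ⟨fun x y => ?_, fun y r hr => ?_⟩
    · simp only [mul_assoc]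
      exact hf.1 x (y * a)
    · have := hf.2 (y * a) (a⁻¹ * r * a) (by simpa using h2.conj_mem r hr a⁻¹)
      simpa [mul_assoc] using this
  have hVfix : ∀ f ∈ V, ∀ x, freeModAb m d x ≠ 1 → (∀ y, f (y * x) = f y) → f = 0 := by
    intro f hf x hx hfix
    funext y
    have e1 : ∀ j : ℕ, f (y * x ^ j) = f y := by
      intro j
      induction j with
      | zero => simp
      | succ j ih => rw [pow_succ, ← mul_assoc, hfix, ih]
    have e2 : y * x ^ n = (y * x * y⁻¹) ^ n * y := by simp
    have e3 := e1 n
    rw [e2, hf.1] at e3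
    have e4 : Φ ((y * x * y⁻¹) ^ n) ≠ 1 := by
      apply h8
      simpa using hx
    by_contra hne
    exact e4 (mul_right_cancel₀ hne (by rw [e3, one_mul]))
  -- the crossed homomorphism
  let i0 : Fin m := ⟨0, by omega⟩
  let i1 : Fin m := ⟨1, by omega⟩
  have hi : i0 ≠ i1 := by simp [i0, i1]
  obtain ⟨c, hc, hmul⟩ := exists_crossed (m := m) (fun i => if i = i1 then Φ else 0)
  have hΦV : Φ ∈ V := ⟨h7, h5⟩
  have hc1 : c 1 = 0 := by
    funext y
    have := hmul 1 1 y
    simpa using this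
  have hcV : ∀ x, c x ∈ V := by
    intro x
    have hgen : ∀ i, c (FreeGroup.of i) ∈ V := by
      intro i
      rw [hc]
      split_ifs
      · exact hΦV
      · exact V.zero_mem
    induction x using FreeGroup.induction_on with
    | C1 => rw [hc1]; exact V.zero_mem
    | of i => exact hgen i
    | inv_of i ih =>
      have : c (FreeGroup.of i)⁻¹ = - fun y => c (FreeGroup.of i) (y * (FreeGroup.of i)⁻¹) := by
        funext y
        have := hmul (FreeGroup.of i)⁻¹ (FreeGroup.of i) y
        rw [inv_mul_cancel, hc1] at this
        rw [Pi.neg_apply]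
        exact eq_neg_of_add_eq_zero_right this.symm
      rw [this]
      exact V.neg_mem (hVtr _ ih _)
    | mul a b ha hb =>
      have : c (a * b) = (fun y => c b (y * a)) + c a := by
        funext y
        exact hmul a b y
      rw [this]
      exact V.add_mem (hVtr _ hb _) ha
  -- vanishing on elevations
  have hvan : ∀ x, freeModAb m d x ≠ 1 → ∀ j : ℤ, x ^ j ∈ R → c (x ^ j) = 0 := by
    intro x hx j hj
    apply hVfix _ (hcV _) x hx
    intro y
    have e1 := hmul x (x ^ j) y
    have e2 := hmul (x ^ j) x y
    rw [(hcV x).2 y _ hj] at e2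
    rw [(Commute.self_zpow x j).eq, e2, add_comm] at e1
    exact (add_right_cancel e1).symm
  -- the induced linear map
  let φ : R →* Multiplicative (FreeGroup (Fin m) → ℂ) :=
    { toFun := fun r => Multiplicative.ofAdd (c r)
      map_one' := by simp [hc1]
      map_mul' := by
        intro r s
        rw [← ofAdd_add]
        congr 1
        funext y
        rw [Subgroup.coe_mul, hmul, (hcV s).2 y _ r.2, add_comm]
        rfl }
  let Λ : ℚ ⊗[ℤ] Additive (Abelianization R) →ₗ[ℚ] (FreeGroup (Fin m) → ℂ) :=
    LinearMap.liftBaseChange ℚ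
      (MonoidHom.toAdditiveLeft (Abelianization.lift φ)).toIntLinearMap
  have hΛ : ∀ r : R, Λ ((1 : ℚ) ⊗ₜ[ℤ] Additive.ofMul (Abelianization.of r)) = c r := by
    intro r
    simp [Λ, φ]
  have hker : OHomology R {x | freeModAb m d x ≠ 1} ≤ LinearMap.ker Λ := by
    unfold OHomology
    rw [Submodule.span_le]
    rintro v ⟨x, hx, j, hj, rfl⟩
    rw [SetLike.mem_coe, LinearMap.mem_ker, hΛ]
    exact hvan x hx j hj
  have hzero : ∀ r ∈ R, c r = 0 := by
    intro r hr
    rw [← hΛ ⟨r, hr⟩, ← LinearMap.mem_ker]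
    apply hker
    rw [htop]
    trivial
  -- averaging
  have hcR : ∀ x, ∀ r ∈ R, c (x * r) = c x := by
    intro x r hr
    funext y
    rw [hmul, hzero r hr]
    simp
  let C : FreeGroup (Fin m) ⧸ R → FreeGroup (Fin m) → ℂ :=
    Quotient.lift c (by
      intro a b hab
      have hab' : a⁻¹ * b ∈ R := QuotientGroup.leftRel_apply.1 hab
      rw [← hcR a _ hab', mul_inv_cancel_left])
  have hCmk : ∀ a : FreeGroup (Fin m), C (a : FreeGroup (Fin m) ⧸ R) = c a := fun a => rfl
  haveI : Finite (FreeGroup (Fin m) ⧸ R) := Subgroup.finite_quotient_of_finiteIndex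
  haveI := Fintype.ofFinite (FreeGroup (Fin m) ⧸ R)
  let u : FreeGroup (Fin m) → ℂ := ∑ q, C q
  have huV : u ∈ V := by
    apply sum_mem
    intro q _
    obtain ⟨a, rfl⟩ := QuotientGroup.mk_surjective q
    rw [hCmk]
    exact hcV a
  have hu : ∀ x y, u y = u (y * x) + (Fintype.card (FreeGroup (Fin m) ⧸ R) : ℂ) * c x y := by
    intro x y
    have e1 : ∀ q, C ((x : FreeGroup (Fin m) ⧸ R) * q) y = C q (y * x) + c x y := by
      intro q
      obtain ⟨a, rfl⟩ := QuotientGroup.mk_surjective q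
      rw [← QuotientGroup.mk_mul, hCmk, hCmk, hmul]
    simp only [u, Finset.sum_apply]
    rw [← Equiv.sum_comp (Equiv.mulLeft (x : FreeGroup (Fin m) ⧸ R))]
    simp only [Equiv.coe_mulLeft, e1, Finset.sum_add_distrib, Finset.sum_const, nsmul_eq_mul,
      Finset.card_univ]
  have hprim : freeModAb m d (FreeGroup.of i0) ≠ 1 := by
    intro h
    rw [freeModAb_eq_one] at h
    have := h i0
    simp [expSum] at this
    have := Int.natAbs_dvd_natAbs.2 this
    simp at this
    omega
  have hu0 : u = 0 := by
    apply hVfix u huV _ hprim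
    intro y
    have := hu (FreeGroup.of i0) y
    rw [hc, if_neg hi] at this
    simpa using this.symm
  have hlast := hu (FreeGroup.of i1) 1
  rw [hu0, hc, if_pos rfl, h6] at hlast
  simp only [Pi.zero_apply, zero_add, mul_one] at hlast
  exact Fintype.card_ne_zero (Nat.cast_eq_zero.1 hlast.symm)

end Final

/-- Corollary 3.4 (free case): for odd squarefree d > 1, the d-primitive homology of a
suitable normal cover whose index divides a power of d is a proper subspace. -/
theorem dprimitive_homology_free (m : ℕ) (hm : 2 ≤ m)
    (d : ℕ) (hd : 1 < d) (hodd : Odd d) (hsf : Squarefree d) :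
    ∃ R : Subgroup (FreeGroup (Fin m)), R.Normal ∧ R.FiniteIndex ∧
      (∃ k : ℕ, R.index ∣ d ^ k) ∧
      OHomology R {x | freeModAb m d x ≠ 1} ≠ ⊤ := by
  exact final hm d hd (good_squarefree m d hsf)
end
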